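/- Let ℓ ≥ 5 be prime. Suppose there exists an integer n ≥ 1 with n ≡ 23 (mod 24) such that the Legendre symbol (−n / ℓ) is not equal to 1 and ℓ does not divide a(n). Then spt does not have a congruence at ℓ. -/

import Mathlib

open Finset

/-- `spt n`: the total number of smallest parts in the partitions of `n`. -/
def spt (n : ℕ) : ℕ :=
  ∑ p : Nat.Partition n, (p.parts.filter (fun j => ∀ i ∈ p.parts, j ≤ i)).card

/-- `partitionCount n` is the number of partitions of `n`. -/
def partitionCount (n : ℕ) : ℕ := Fintype.card (Nat.Partition n)

/-- The coefficients `a(n)` of the mock modular form `f = ∑ a(n) q^(n/24)`: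
for `n ≥ -1` with `n ≡ -1 (mod 24)`, `a(n) = -(12 spt((n+1)/24) + n p((n+1)/24))`,
and `a(n) = 0` otherwise. -/
noncomputable def sptA (n : ℤ) : ℤ :=
  if -1 ≤ n ∧ (24 : ℤ) ∣ n + 1 then
    -(12 * spt ((n + 1) / 24).toNat + n * partitionCount ((n + 1) / 24).toNat)
  else 0

namespace SptCongruence

open PowerSeries PowerSeries.WithPiTopology

section Adic

variable {R : Type*} [CommRing R] {ι κ : Type*}

/-- For every `N`, all but finitely many members of the family are divisible by `X ^ N`. -/
def AdicFinite (F : ι → R⟦X⟧) : Prop := ∀ N : ℕ, {i | ¬ X ^ N ∣ F i}.Finite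

theorem AdicFinite.of_imp {F : ι → R⟦X⟧} {G : ι → R⟦X⟧} (hF : AdicFinite F)
    (h : ∀ N i, X ^ N ∣ F i → X ^ N ∣ G i) : AdicFinite G :=
  fun N => (hF N).subset fun i hi hd => hi (h N i hd)

theorem AdicFinite.mul_right {F : ι → R⟦X⟧} (hF : AdicFinite F) (g : ι → R⟦X⟧) :
    AdicFinite fun i => F i * g i :=
  hF.of_imp fun _ _ h => h.mul_right _

theorem AdicFinite.mul_left {F : ι → R⟦X⟧} (hF : AdicFinite F) (g : ι → R⟦X⟧) :
    AdicFinite fun i => g i * F i :=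
  hF.of_imp fun _ _ h => h.mul_left _

theorem AdicFinite.neg {F : ι → R⟦X⟧} (hF : AdicFinite F) : AdicFinite fun i => -F i :=
  hF.of_imp fun _ _ h => (dvd_neg).2 h

theorem AdicFinite.comp {F : ι → R⟦X⟧} (hF : AdicFinite F) {e : κ → ι}
    (he : Function.Injective e) : AdicFinite fun k => F (e k) :=
  fun N => (hF N).preimage he.injOn

theorem AdicFinite.add {F G : ι → R⟦X⟧} (hF : AdicFinite F) (hG : AdicFinite G) :
    AdicFinite fun i => F i + G i := fun N =>
  ((hF N).union (hG N)).subset fun i hi => by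
    by_contra h
    simp only [Set.mem_union, Set.mem_ofPred_eq, not_or, not_not] at h
    exact hi (dvd_add h.1 h.2)

theorem AdicFinite.sub {F G : ι → R⟦X⟧} (hF : AdicFinite F) (hG : AdicFinite G) :
    AdicFinite fun i => F i - G i := by
  simpa [sub_eq_add_neg] using hF.add hG.neg

theorem AdicFinite.prod {F : ι → R⟦X⟧} {G : κ → R⟦X⟧} (hF : AdicFinite F) (hG : AdicFinite G) :
    AdicFinite fun p : ι × κ => F p.1 * G p.2 := fun N =>
  ((hF N).prod (hG N)).subset fun _ hp =>
    ⟨fun h => hp (h.mul_right _), fun h => hp (h.mul_left _)⟩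

theorem adicFinite_X_pow {d : ι → ℕ} (hd : ∀ N, {i | d i < N}.Finite) :
    AdicFinite fun i => (X : R⟦X⟧) ^ d i := fun N =>
  (hd N).subset fun i hi => by
    by_contra h
    exact hi (pow_dvd_pow _ (not_lt.1 h))

theorem adicFinite_of_finite_support {F : ι → R⟦X⟧} (h : {i | F i ≠ 0}.Finite) : AdicFinite F :=
  fun _ => h.subset fun _ hi h0 => hi (by rw [h0]; exact dvd_zero _)

theorem AdicFinite.finite_coeff {F : ι → R⟦X⟧} (hF : AdicFinite F) (n : ℕ) :
    {i | coeff n (F i) ≠ 0}.Finite :=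
  (hF (n + 1)).subset fun _ hi h => hi (X_pow_dvd_iff.1 h n (Nat.lt_succ_self n))

variable [TopologicalSpace R]

theorem AdicFinite.summable {F : ι → R⟦X⟧} (hF : AdicFinite F) : Summable F := by
  rw [summable_iff_summable_coeff]
  exact fun d => summable_of_hasFiniteSupport (hF.finite_coeff d)

theorem coeff_tsum [T2Space R] {F : ι → R⟦X⟧} (hF : Summable F) (n : ℕ) :
    coeff n (∑' i, F i) = ∑' i, coeff n (F i) :=
  ((hasSum_iff_hasSum_coeff _).1 hF.hasSum n).tsum_eq.symm

end Adic

section QDerivation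

variable {R : Type*} [CommRing R]

/-- The derivation `q d/dq` on power series in `q = X`. -/
noncomputable def qD : Derivation R R⟦X⟧ R⟦X⟧ := (X : R⟦X⟧) • PowerSeries.derivative R

theorem coeff_qD (f : R⟦X⟧) (n : ℕ) : coeff n (qD f) = n * coeff n f := by
  cases n with
  | zero => simp [qD]
  | succ n => simp [qD, coeff_succ_X_mul, coeff_derivative, mul_comm]

theorem qD_mul (f g : R⟦X⟧) : qD (f * g) = f * qD g + g * qD f := by
  simp [Derivation.leibniz]

theorem qD_pow (f : R⟦X⟧) (n : ℕ) : qD (f ^ n) = n * f ^ (n - 1) * qD f := by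
  simp [Derivation.leibniz_pow, mul_assoc]

theorem qD_X_pow_mul_intCast (d : ℕ) (c : ℤ) :
    qD ((X : R⟦X⟧) ^ d * (c : R⟦X⟧)) = (d : R⟦X⟧) * ((X : R⟦X⟧) ^ d * (c : R⟦X⟧)) := by
  ext n
  rw [coeff_qD]
  have h1 : (d : R⟦X⟧) = C (d : R) := by simp
  have h2 : (c : R⟦X⟧) = C (c : R) := by simp
  rw [h1, h2, coeff_C_mul, mul_comm (X ^ d), coeff_C_mul, coeff_X_pow]
  split_ifs with h
  · rw [h]
  · simp

theorem map_qD {S : Type*} [CommRing S] (φ : R →+* S) (f : R⟦X⟧) :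
    PowerSeries.map φ (qD f) = qD (PowerSeries.map φ f) := by
  ext n
  simp [coeff_qD]

variable [TopologicalSpace R] {ι : Type*}

theorem qD_tsum [T2Space R] {F : ι → R⟦X⟧} (hF : AdicFinite F) :
    qD (∑' i, F i) = ∑' i, qD (F i) := by
  have h2 : AdicFinite fun i => qD (F i) := hF.of_imp fun N i h => by
    rw [X_pow_dvd_iff] at h ⊢
    intro m hm
    rw [coeff_qD, h m hm, mul_zero]
  ext n
  rw [coeff_qD, coeff_tsum hF.summable, coeff_tsum h2.summable,
    tsum_eq_finsum (hF.finite_coeff n), tsum_eq_finsum (h2.finite_coeff n), mul_finsum' _ _ (hF.finite_coeff n)]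
  simp [coeff_qD]

end QDerivation

end SptCongruence

namespace SptCongruence

open PowerSeries PowerSeries.WithPiTopology

/-- The generating function `∑ₙ (∑_{p ⊢ n} w p) Xⁿ` of partitions weighted by `w`. -/
noncomputable def partGF (w : Multiset ℕ → ℤ) : ℤ⟦X⟧ :=
  PowerSeries.mk fun n => ∑ p : Nat.Partition n, w p.parts

theorem partGF_add (v w : Multiset ℕ → ℤ) :
    partGF (fun M => v M + w M) = partGF v + partGF w := by
  ext n; simp [partGF, sum_add_distrib]

theorem partGF_split (w : Multiset ℕ → ℤ) {s : ℕ} (hs : 1 ≤ s) :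
    partGF w = X ^ s * partGF (fun M => w (s ::ₘ M)) +
      partGF (fun M => if s ∈ M then 0 else w M) := by
  ext n
  simp only [partGF, coeff_mk, map_add, coeff_X_pow_mul']
  have h1 : ∑ p : Nat.Partition n, w p.parts =
      (∑ p : Nat.Partition n, if s ∈ p.parts then w p.parts else 0) +
        ∑ p : Nat.Partition n, if s ∈ p.parts then 0 else w p.parts := by
    rw [← sum_add_distrib]
    refine sum_congr rfl fun p _ => ?_
    split_ifs <;> simp
  rw [h1]
  congr 1
  split_ifs with h
  · rw [← sum_filter, sum_subtype (p := fun p : n.Partition => s ∈ p.parts) _ (by simp),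
      ← (Nat.Partition.partitionWithPartEquiv hs h).symm.sum_comp]
    refine sum_congr rfl fun p _ => ?_
    simp [Nat.Partition.partitionWithPartEquiv_symm_apply_parts]
  · refine sum_eq_zero fun p _ => if_neg fun hp => h (p.le_of_mem_parts hp)

/-- Generating function of partitions with all parts at least `s`. -/
noncomputable def partGeGF (s : ℕ) : ℤ⟦X⟧ :=
  partGF fun M => if ∀ i ∈ M, s ≤ i then 1 else 0

/-- Generating function for the number of occurrences of `s` as a smallest part. -/
noncomputable def smallestGF (s : ℕ) : ℤ⟦X⟧ :=
  partGF fun M => if ∀ i ∈ M, s ≤ i then (M.count s : ℤ) else 0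

/-- Generating function for the number of occurrences of the part `s`. -/
noncomputable def countGF (s : ℕ) : ℤ⟦X⟧ := partGF fun M => (M.count s : ℤ)

theorem partGeGF_succ {s : ℕ} (hs : 1 ≤ s) :
    (1 - X ^ s) * partGeGF s = partGeGF (s + 1) := by
  have h := partGF_split (fun M => if ∀ i ∈ M, s ≤ i then 1 else 0) hs
  have h1 : (fun M : Multiset ℕ => if s ∈ M then (0 : ℤ) else if ∀ i ∈ M, s ≤ i then 1 else 0) =
      fun M => if ∀ i ∈ M, s + 1 ≤ i then 1 else 0 := by
    funext M
    by_cases hM : s ∈ M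
    · rw [if_pos hM, if_neg fun h => absurd (h s hM) (by simp)]
    · rw [if_neg hM]
      refine if_congr ⟨fun h i hi => ?_, fun h i hi => (Nat.le_succ s).trans (h i hi)⟩ rfl rfl
      exact lt_of_le_of_ne (h i hi) fun e => hM (e ▸ hi)
  rw [h1] at h
  simp only [Multiset.mem_cons, forall_eq_or_imp, le_refl, true_and] at h
  unfold partGeGF
  linear_combination h

theorem smallestGF_eq {s : ℕ} (hs : 1 ≤ s) :
    (1 - X ^ s) * smallestGF s = X ^ s * partGeGF s := by
  have h := partGF_split (fun M => if ∀ i ∈ M, s ≤ i then (M.count s : ℤ) else 0) hs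
  have h1 : (fun M : Multiset ℕ => if s ∈ M then (0 : ℤ) else
      if ∀ i ∈ M, s ≤ i then (M.count s : ℤ) else 0) = fun _ => 0 := by
    funext M
    by_cases hM : s ∈ M <;> simp [hM]
  have h2 : (fun M : Multiset ℕ => if ∀ i ∈ s ::ₘ M, s ≤ i then (((s ::ₘ M).count s : ℕ) : ℤ)
      else 0) = fun M => (if ∀ i ∈ M, s ≤ i then (M.count s : ℤ) else 0) +
        if ∀ i ∈ M, s ≤ i then 1 else 0 := by
    funext M
    simp only [Multiset.mem_cons, forall_eq_or_imp, le_refl, true_and, Multiset.count_cons_self]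
    split_ifs <;> simp
  rw [h1, h2, partGF_add] at h
  have h3 : partGF (fun _ => 0) = 0 := by ext; simp [partGF]
  unfold partGeGF smallestGF
  rw [h3] at h
  linear_combination h

theorem countGF_eq {s : ℕ} (hs : 1 ≤ s) :
    (1 - X ^ s) * countGF s = X ^ s * partGF fun _ => 1 := by
  have h := partGF_split (fun M => (M.count s : ℤ)) hs
  have h1 : (fun M : Multiset ℕ => if s ∈ M then (0 : ℤ) else (M.count s : ℤ)) = fun _ => 0 := by
    funext M
    by_cases hM : s ∈ M <;> simp [hM]
  have h2 : (fun M : Multiset ℕ => (((s ::ₘ M).count s : ℕ) : ℤ)) =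
      fun M => (M.count s : ℤ) + 1 := by
    funext M
    simp
  rw [h1, h2, partGF_add] at h
  have h3 : partGF (fun _ => 0) = 0 := by ext; simp [partGF]
  unfold countGF
  rw [h3] at h
  linear_combination h

theorem partGeGF_one : partGeGF 1 = partGF fun _ => 1 := by
  ext n
  simp only [partGeGF, partGF, coeff_mk]
  exact sum_congr rfl fun p _ => if_pos fun i hi => p.parts_pos hi

theorem prod_mul_partGF_one (N : ℕ) :
    (∏ i ∈ range N, (1 - X ^ (i + 1) : ℤ⟦X⟧)) * (partGF fun _ => 1) = partGeGF (N + 1) := by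
  induction N with
  | zero => simp [partGeGF_one]
  | succ N ih =>
    rw [prod_range_succ, ← partGeGF_succ (by omega : 1 ≤ N + 1), ← ih]
    ring

theorem coeff_partGeGF {n N : ℕ} (h : n < N) : coeff n (partGeGF N) = if n = 0 then 1 else 0 := by
  simp only [partGeGF, partGF, coeff_mk]
  split_ifs with h0
  · subst h0
    simp
  · refine sum_eq_zero fun p _ => if_neg fun hp => ?_
    obtain ⟨i, hi⟩ : ∃ i, i ∈ p.parts := by
      by_contra hne
      push Not at hne
      have h1 := Multiset.eq_zero_of_forall_notMem hne
      have h2 := p.parts_sum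
      rw [h1] at h2
      simp at h2
      omega
    have h1 := hp i hi
    have h2 := p.le_of_mem_parts hi
    omega

/-- Euler: the pentagonal series is the inverse of the partition generating function. -/
theorem pentagonalSeries_mul_partGF : pentagonalSeries ℤ * (partGF fun _ => 1) = 1 := by
  ext n
  have h1 : ∀ᶠ s : Finset ℕ in Filter.atTop, ∀ k ∈ range (n + 1),
      coeff k (∏ n ∈ s, (1 - X ^ (n + 1) : ℤ⟦X⟧)) = coeff k (pentagonalSeries ℤ) :=
    (Filter.eventually_all_finset _).2 fun k _ => coeff_prod_one_sub_X_pow_eventually_eq ℤ k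
  obtain ⟨N, hN, hnN⟩ := ((Filter.tendsto_finset_range.eventually h1).and
    (Filter.eventually_ge_atTop n)).exists
  have h2 := congrArg (coeff n) (prod_mul_partGF_one N)
  rw [coeff_partGeGF (by omega), coeff_mul] at h2
  rw [coeff_mul, coeff_one, ← h2]
  refine sum_congr rfl fun x hx => ?_
  rw [hN x.1 (mem_range.2 (Nat.lt_succ_of_le (Finset.HasAntidiagonal.mem_antidiagonal.1 hx ▸ Nat.le_add_right _ _)))]

theorem pentagonalSeries_mul_partGeGF (N : ℕ) :
    pentagonalSeries ℤ * partGeGF (N + 1) = ∏ i ∈ range N, (1 - X ^ (i + 1) : ℤ⟦X⟧) := by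
  rw [← prod_mul_partGF_one]
  linear_combination (∏ i ∈ range N, (1 - X ^ (i + 1) : ℤ⟦X⟧)) * pentagonalSeries_mul_partGF

theorem coeff_partGF_eq_zero {s n : ℕ} (h : n < s) (w : Multiset ℕ → ℤ)
    (hw : ∀ M, s ∉ M → w M = 0) : coeff n (partGF w) = 0 := by
  simp only [partGF, coeff_mk]
  exact sum_eq_zero fun p _ => hw _ fun hs => absurd (p.le_of_mem_parts hs) (by omega)

theorem adicFinite_of_X_pow_dvd {F : ℕ → ℤ⟦X⟧} (h : ∀ s n, n < s → coeff n (F s) = 0) :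
    AdicFinite F := fun N =>
  (Set.finite_lt_nat N).subset fun s hs => by
    by_contra hN
    exact hs (X_pow_dvd_iff.2 fun m hm => h s m (hm.trans_le (not_lt.1 hN)))

theorem coeff_smallestGF {s n : ℕ} (h : n < s) : coeff n (smallestGF s) = 0 :=
  coeff_partGF_eq_zero h _ fun M hM => by simp [Multiset.count_eq_zero_of_notMem hM]

theorem coeff_countGF {s n : ℕ} (h : n < s) : coeff n (countGF s) = 0 :=
  coeff_partGF_eq_zero h _ fun M hM => by simp [Multiset.count_eq_zero_of_notMem hM]

theorem adicFinite_smallestGF : AdicFinite fun s => smallestGF (s + 1) :=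
  adicFinite_of_X_pow_dvd fun s n h => coeff_smallestGF (by omega)

/-- The generating function of `spt`. -/
noncomputable def sptGF : ℤ⟦X⟧ := PowerSeries.mk fun n => (spt n : ℤ)

theorem coeff_tsum_nat {F : ℕ → ℤ⟦X⟧} (h : ∀ s n, n < s + 1 → coeff n (F s) = 0) (n : ℕ) :
    coeff n (∑' s, F s) = ∑ s ∈ range n, coeff n (F s) := by
  rw [coeff_tsum (adicFinite_of_X_pow_dvd fun s n hs => h s n (by omega)).summable]
  refine tsum_eq_sum fun s hs => h s n ?_
  simp at hs
  omega

theorem sptGF_eq : sptGF = ∑' s, smallestGF (s + 1) := by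
  ext n
  rw [coeff_tsum_nat fun s n hs => coeff_smallestGF hs]
  simp only [sptGF, coeff_mk, smallestGF, partGF, spt]
  rw [sum_comm]
  push_cast
  refine sum_congr rfl fun p _ => ?_
  have h1 : ∀ a ∈ p.parts.filter (fun j => ∀ i ∈ p.parts, j ≤ i), a ∈ range (n + 1) := by
    intro a ha
    have := p.le_of_mem_parts (Multiset.mem_of_mem_filter ha)
    simp; omega
  rw [← Multiset.sum_count_eq_card h1, sum_range_succ']
  have h0 : 0 ∉ p.parts := fun h => absurd (p.parts_pos h) (by simp)
  simp [Multiset.count_filter, Multiset.count_eq_zero_of_notMem h0]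

theorem qD_partGF_one : qD (partGF fun _ => 1) = ∑' s : ℕ, ((s + 1 : ℕ) : ℤ⟦X⟧) * countGF (s + 1) := by
  ext n
  have h (s : ℕ) : ((s + 1 : ℕ) : ℤ⟦X⟧) = C ((s + 1 : ℕ) : ℤ) := by simp
  simp only [h]
  rw [coeff_tsum_nat fun s n hs => by rw [coeff_C_mul, coeff_countGF hs, mul_zero]]
  simp only [coeff_qD, partGF, coeff_C_mul, countGF, coeff_mk, mul_sum]
  rw [sum_comm]
  refine sum_congr rfl fun p _ => ?_
  have h1 : p.parts.toFinset ⊆ range (n + 1) := by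
    intro a ha
    have := p.le_of_mem_parts (Multiset.mem_toFinset.1 ha)
    simp; omega
  have h2 := Finset.sum_multiset_count_of_subset p.parts _ h1
  rw [p.parts_sum, sum_range_succ'] at h2
  conv_lhs => rw [h2]
  push_cast
  simp [mul_comm]

end SptCongruence

namespace SptCongruence

open PowerSeries PowerSeries.WithPiTopology

/-- The power series of `1 / (1 - X ^ s)`. -/
noncomputable def geo (s : ℕ) : ℤ⟦X⟧ := invOfUnit (1 - X ^ s) 1

theorem one_sub_mul_geo {s : ℕ} (hs : 1 ≤ s) : (1 - X ^ s) * geo s = 1 :=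
  mul_invOfUnit _ _ (by simp [show s ≠ 0 by omega])

theorem adicFinite_X_pow_mul {d : ℕ} (hd : 1 ≤ d) : AdicFinite fun m => (X : ℤ⟦X⟧) ^ (d * m) :=
  adicFinite_X_pow fun N => (Set.finite_lt_nat N).subset fun m (hm : d * m < N) =>
    show m < N by nlinarith

theorem tsum_X_pow_mul {d : ℕ} (hd : 1 ≤ d) : ∑' m, (X : ℤ⟦X⟧) ^ (d * m) = geo d := by
  have h := (adicFinite_X_pow_mul hd).summable.tsum_eq_zero_add
  have h2 : ∑' m, (X : ℤ⟦X⟧) ^ (d * (m + 1)) = X ^ d * ∑' m, (X : ℤ⟦X⟧) ^ (d * m) := by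
    rw [← (adicFinite_X_pow_mul hd).summable.tsum_mul_left]
    exact tsum_congr fun m => by ring
  rw [h2] at h
  simp only [mul_zero, pow_zero] at h
  linear_combination geo d * h - (∑' m, (X : ℤ⟦X⟧) ^ (d * m)) * one_sub_mul_geo hd

theorem tsum_natCast_mul_X_pow_mul {d : ℕ} (hd : 1 ≤ d) :
    ∑' m : ℕ, (m : ℤ⟦X⟧) * X ^ (d * m) = X ^ d * geo d ^ 2 := by
  have hs := ((adicFinite_X_pow_mul hd).mul_left fun m => (m : ℤ⟦X⟧)).summable
  have h := hs.tsum_eq_zero_add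
  have h2 : ∑' m : ℕ, ((m + 1 : ℕ) : ℤ⟦X⟧) * X ^ (d * (m + 1)) =
      X ^ d * ∑' m : ℕ, (m : ℤ⟦X⟧) * X ^ (d * m) + X ^ d * geo d := by
    rw [← hs.tsum_mul_left, ← tsum_X_pow_mul hd,
      ← (adicFinite_X_pow_mul hd).summable.tsum_mul_left, ← Summable.tsum_add]
    · exact tsum_congr fun m => by push_cast; ring
    · exact hs.mul_left _
    · exact (adicFinite_X_pow_mul hd).summable.mul_left _
  rw [h2] at h
  simp only [Nat.cast_zero, zero_mul, zero_add] at h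
  linear_combination geo d * h - (∑' m : ℕ, (m : ℤ⟦X⟧) * X ^ (d * m)) * one_sub_mul_geo hd

theorem tsum_odd_mul_X_pow_mul {d : ℕ} (hd : 1 ≤ d) :
    ∑' m : ℕ, ((2 * m + 1 : ℕ) : ℤ⟦X⟧) * X ^ (d * m) = (1 + X ^ d) * geo d ^ 2 := by
  have hs := ((adicFinite_X_pow_mul hd).mul_left fun m => (m : ℤ⟦X⟧)).summable
  have h : ∑' m : ℕ, ((2 * m + 1 : ℕ) : ℤ⟦X⟧) * X ^ (d * m) =
      2 * (X ^ d * geo d ^ 2) + geo d := by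
    rw [← tsum_natCast_mul_X_pow_mul hd, ← hs.tsum_mul_left, ← tsum_X_pow_mul hd,
      ← Summable.tsum_add]
    · exact tsum_congr fun m => by push_cast; ring
    · exact hs.mul_left _
    · exact (adicFinite_X_pow_mul hd).summable
  rw [h]
  linear_combination -geo d * one_sub_mul_geo hd

/-- The series `∑ σ₁(n) Xⁿ`, as a double sum. -/
noncomputable def sigmaGF : ℤ⟦X⟧ :=
  ∑' p : ℕ × ℕ, ((p.1 + 1 : ℕ) : ℤ⟦X⟧) * X ^ ((p.1 + 1) * (p.2 + 1))

theorem adicFinite_lambert :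
    AdicFinite fun p : ℕ × ℕ => (X : ℤ⟦X⟧) ^ ((p.1 + 1) * (p.2 + 1)) :=
  adicFinite_X_pow fun N => ((Set.finite_lt_nat N).prod (Set.finite_lt_nat N)).subset
    fun p (hp : (p.1 + 1) * (p.2 + 1) < N) => ⟨show p.1 < N by nlinarith, show p.2 < N by nlinarith⟩

theorem sigmaGF_eq_tsum_mul_geo :
    sigmaGF = ∑' s : ℕ, ((s + 1 : ℕ) : ℤ⟦X⟧) * (X ^ (s + 1) * geo (s + 1)) := by
  have hs := (adicFinite_lambert.mul_left fun p => ((p.1 + 1 : ℕ) : ℤ⟦X⟧)).summable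
  rw [sigmaGF, hs.tsum_prod' fun b => hs.comp_injective (Prod.mk_right_injective b)]
  refine tsum_congr fun s => ?_
  have hX := (adicFinite_X_pow_mul (by omega : 1 ≤ s + 1)).summable
  rw [← tsum_X_pow_mul (by omega : 1 ≤ s + 1), ← hX.tsum_mul_left, ← (hX.mul_left _).tsum_mul_left]
  exact tsum_congr fun m => by ring

theorem sigmaGF_eq_tsum_geo_sq :
    sigmaGF = ∑' s : ℕ, X ^ (s + 1) * geo (s + 1) ^ 2 := by
  have hs := (adicFinite_lambert.mul_left fun p => ((p.2 + 1 : ℕ) : ℤ⟦X⟧)).summable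
  have h1 : sigmaGF = ∑' p : ℕ × ℕ, ((p.2 + 1 : ℕ) : ℤ⟦X⟧) * X ^ ((p.1 + 1) * (p.2 + 1)) := by
    rw [sigmaGF, ← (Equiv.prodComm ℕ ℕ).tsum_eq]
    exact tsum_congr fun p => by simp [mul_comm]
  rw [h1, hs.tsum_prod' fun b => hs.comp_injective (Prod.mk_right_injective b)]
  refine tsum_congr fun s => ?_
  have h2 := ((adicFinite_X_pow_mul (by omega : 1 ≤ s + 1)).mul_left
    fun m => (m : ℤ⟦X⟧)).summable
  rw [← tsum_natCast_mul_X_pow_mul (by omega : 1 ≤ s + 1), h2.tsum_eq_zero_add]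
  simp

/-- The Eisenstein series of weight two. -/
noncomputable def eisP : ℤ⟦X⟧ := 1 - 24 * sigmaGF

theorem qD_partGF : qD (partGF fun _ => 1) = sigmaGF * partGF fun _ => 1 := by
  have hs : AdicFinite fun s : ℕ => ((s + 1 : ℕ) : ℤ⟦X⟧) * (X ^ (s + 1) * geo (s + 1)) :=
    ((adicFinite_X_pow fun N => (Set.finite_lt_nat N).subset fun s (h : s + 1 < N) =>
      show s < N by omega).mul_right _).mul_left _
  rw [qD_partGF_one, sigmaGF_eq_tsum_mul_geo, ← hs.summable.tsum_mul_right]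
  refine tsum_congr fun s => ?_
  linear_combination (s + 1 : ℕ) * (geo (s + 1) * countGF_eq (by omega : 1 ≤ s + 1) -
    countGF (s + 1) * one_sub_mul_geo (by omega : 1 ≤ s + 1))

theorem qD_pentagonalSeries : 24 * qD (pentagonalSeries ℤ) = (eisP - 1) * pentagonalSeries ℤ := by
  have h := congrArg qD pentagonalSeries_mul_partGF
  rw [qD_mul, qD_partGF, Derivation.map_one_eq_zero] at h
  rw [eisP]
  linear_combination 24 * pentagonalSeries ℤ * h - 24 * (qD (pentagonalSeries ℤ) +
    sigmaGF * pentagonalSeries ℤ) * pentagonalSeries_mul_partGF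

end SptCongruence

namespace SptCongruence

open PowerSeries PowerSeries.WithPiTopology

/-- The product of `1 - X ^ i` for `1 ≤ i ≤ n`. -/
noncomputable def poch (n : ℕ) : ℤ⟦X⟧ := ∏ i ∈ range n, (1 - X ^ (i + 1))

/-- The inverse of `poch n`. -/
noncomputable def pochInv (n : ℕ) : ℤ⟦X⟧ := ∏ i ∈ range n, geo (i + 1)

theorem poch_succ (n : ℕ) : poch (n + 1) = poch n * (1 - X ^ (n + 1)) := prod_range_succ _ _

theorem poch_mul_pochInv (n : ℕ) : poch n * pochInv n = 1 := by
  rw [poch, pochInv, ← prod_mul_distrib]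
  exact prod_eq_one fun i _ => one_sub_mul_geo (by omega)

theorem one_sub_mul_pochInv (n : ℕ) : (1 - X ^ (n + 1)) * pochInv (n + 1) = pochInv n := by
  rw [pochInv, prod_range_succ, ← pochInv]
  linear_combination pochInv n * one_sub_mul_geo (by omega : 1 ≤ n + 1)

theorem poch_mul_pochInv_succ (n : ℕ) : poch n * pochInv (n + 1) = geo (n + 1) := by
  rw [pochInv, prod_range_succ, ← pochInv]
  linear_combination geo (n + 1) * poch_mul_pochInv n

theorem X_pow_dvd_poch_sub (m k : ℕ) : X ^ (m + 1) ∣ poch (m + k) - poch m := by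
  induction k with
  | zero => simp
  | succ k ih =>
    rw [← add_assoc, poch_succ]
    have : poch (m + k) * (1 - X ^ (m + k + 1)) - poch m =
        (poch (m + k) - poch m) - X ^ (m + 1) * (X ^ k * poch (m + k)) := by ring
    rw [this]
    exact dvd_sub ih (dvd_mul_right _ _)

/-- The exponents in the finite pentagonal number identity. -/
def pentExp (ρ : ℕ) : ℕ := (ρ + 1) * (3 * ρ + 2) / 2

theorem pentExp_succ (ρ : ℕ) : pentExp (ρ + 1) = pentExp ρ + 3 * ρ + 4 := by
  rw [pentExp, pentExp, show (ρ + 1 + 1) * (3 * (ρ + 1) + 2) =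
    (ρ + 1) * (3 * ρ + 2) + (3 * ρ + 4) * 2 by ring, Nat.add_mul_div_right _ _ (by norm_num)]
  omega

/-- A finite form of the pentagonal number identity. -/
theorem pochInv_sq_add_sum (n : ℕ) :
    pochInv n ^ 2 + ∑ ρ ∈ range n, (-1) ^ (ρ + 1) * X ^ pentExp ρ * (1 + X ^ (ρ + 1)) *
      (pochInv (n - (ρ + 1)) * pochInv (n + (ρ + 1))) = pochInv n := by
  induction n with
  | zero => simp [pochInv]
  | succ n ih =>
    set G : ℕ → ℤ⟦X⟧ := fun ρ => (-1) ^ (ρ + 1) * X ^ (pentExp ρ + (n - ρ)) *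
      (pochInv (n - ρ) * pochInv (n + 1 + ρ)) with hG
    have key (ρ : ℕ) (hρ : ρ ∈ range n) :
        (1 - X ^ (n + 1)) * ((-1) ^ (ρ + 1) * X ^ pentExp ρ * (1 + X ^ (ρ + 1)) *
          (pochInv (n + 1 - (ρ + 1)) * pochInv (n + 1 + (ρ + 1)))) =
        (-1) ^ (ρ + 1) * X ^ pentExp ρ * (1 + X ^ (ρ + 1)) *
          (pochInv (n - (ρ + 1)) * pochInv (n + (ρ + 1))) + (G ρ - G (ρ + 1)) := by
      obtain ⟨k, rfl⟩ : ∃ k, n = k + 1 + ρ := ⟨n - ρ - 1, by simp at hρ; omega⟩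
      simp only [hG, pentExp_succ]
      rw [show k + 1 + ρ + 1 - (ρ + 1) = k + 1 by omega, show k + 1 + ρ - ρ = k + 1 by omega,
        show k + 1 + ρ - (ρ + 1) = k by omega, ← one_sub_mul_pochInv k,
        show k + 1 + ρ + (ρ + 1) = k + 1 + ρ + 1 + ρ by ring,
        show k + 1 + ρ + 1 + (ρ + 1) = k + 1 + ρ + 1 + ρ + 1 by ring,
        ← one_sub_mul_pochInv (k + 1 + ρ + 1 + ρ)]
      ring
    have hsum : (1 - X ^ (n + 1)) * ∑ ρ ∈ range n, ((-1) ^ (ρ + 1) * X ^ pentExp ρ *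
        (1 + X ^ (ρ + 1)) * (pochInv (n + 1 - (ρ + 1)) * pochInv (n + 1 + (ρ + 1)))) =
        (pochInv n - pochInv n ^ 2) + (G 0 - G n) := by
      rw [mul_sum, sum_congr rfl key, sum_add_distrib, sum_range_sub']
      linear_combination ih
    have hGn : (1 - X ^ (n + 1)) * ((-1) ^ (n + 1) * X ^ pentExp n * (1 + X ^ (n + 1)) *
        (pochInv (n + 1 - (n + 1)) * pochInv (n + 1 + (n + 1)))) = G n := by
      simp only [hG, Nat.sub_self]
      rw [← one_sub_mul_pochInv (n + 1 + n)]
      ring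
    have hG0 : G 0 = -X ^ n * X * (pochInv n * pochInv (n + 1)) := by
      simp only [hG, show pentExp 0 = 1 from rfl, Nat.sub_zero, add_zero, zero_add]
      ring_nf
    have hgeo := one_sub_mul_geo (by omega : 1 ≤ n + 1)
    rw [sum_range_succ]
    have hfin : (1 - X ^ (n + 1)) * (pochInv (n + 1) ^ 2 + (∑ ρ ∈ range n, ((-1) ^ (ρ + 1) *
        X ^ pentExp ρ * (1 + X ^ (ρ + 1)) * (pochInv (n + 1 - (ρ + 1)) *
        pochInv (n + 1 + (ρ + 1)))) + (-1) ^ (n + 1) * X ^ pentExp n * (1 + X ^ (n + 1)) *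
        (pochInv (n + 1 - (n + 1)) * pochInv (n + 1 + (n + 1))))) =
        (1 - X ^ (n + 1)) * pochInv (n + 1) := by
      rw [mul_add, mul_add, hsum, hGn, hG0, ← one_sub_mul_pochInv n]
      ring
    linear_combination geo (n + 1) * hfin - (pochInv (n + 1) ^ 2 + (∑ ρ ∈ range n, ((-1) ^ (ρ + 1) *
        X ^ pentExp ρ * (1 + X ^ (ρ + 1)) * (pochInv (n + 1 - (ρ + 1)) *
        pochInv (n + 1 + (ρ + 1)))) + (-1) ^ (n + 1) * X ^ pentExp n * (1 + X ^ (n + 1)) *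
        (pochInv (n + 1 - (n + 1)) * pochInv (n + 1 + (n + 1)))) - pochInv (n + 1)) * hgeo

theorem sum_poch_sq (ρ M : ℕ) :
    (1 - X ^ (ρ + 1)) ^ 2 * ∑ m ∈ range (M + 1), poch (m + ρ) ^ 2 * X ^ m *
      (pochInv m * pochInv (m + 2 * ρ + 2)) =
    poch (M + (ρ + 1)) ^ 2 * (pochInv M * pochInv (M + 2 * ρ + 2)) := by
  induction M with
  | zero => rw [zero_add, sum_range_one, zero_add, zero_add, zero_add, poch_succ]; ring
  | succ M ih =>
    rw [sum_range_succ, mul_add, ih, ← one_sub_mul_pochInv M,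
      show M + 1 + 2 * ρ + 2 = M + 2 * ρ + 2 + 1 by ring, ← one_sub_mul_pochInv (M + 2 * ρ + 2),
      show M + 1 + (ρ + 1) = M + 1 + ρ + 1 by ring, poch_succ,
      show M + (ρ + 1) = M + 1 + ρ by ring]
    ring

theorem X_pow_dvd_poch_mul_pochInv_sub_one (m k : ℕ) :
    X ^ (m + 1) ∣ poch (m + k) * pochInv m - 1 := by
  rw [← poch_mul_pochInv m, ← sub_mul]
  exact (X_pow_dvd_poch_sub m k).mul_right _

theorem tsum_poch_sq (ρ : ℕ) :
    ∑' m, poch (m + ρ) ^ 2 * X ^ m * (pochInv m * pochInv (m + 2 * ρ + 2)) =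
      geo (ρ + 1) ^ 2 := by
  set F : ℕ → ℤ⟦X⟧ := fun m => poch (m + ρ) ^ 2 * X ^ m *
    (pochInv m * pochInv (m + 2 * ρ + 2)) with hF
  have hdvd (m : ℕ) : X ^ m ∣ F m := ⟨poch (m + ρ) ^ 2 * (pochInv m * pochInv (m + 2 * ρ + 2)),
    by simp only [hF]; ring⟩
  have hA : AdicFinite F := adicFinite_of_X_pow_dvd fun s n h => X_pow_dvd_iff.1 (hdvd s) n h
  have key : (1 - X ^ (ρ + 1)) ^ 2 * ∑' m, F m = 1 := by
    ext n
    have h1 : X ^ (n + 1) ∣ ∑' m, F m - ∑ m ∈ range (n + 1), F m := by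
      rw [X_pow_dvd_iff]
      intro m hm
      rw [map_sub, coeff_tsum hA.summable, map_sum, sub_eq_zero]
      refine tsum_eq_sum fun s hs => X_pow_dvd_iff.1 (hdvd s) m ?_
      simp at hs
      omega
    have h2 : X ^ (n + 1) ∣ poch (n + (ρ + 1)) ^ 2 * (pochInv n * pochInv (n + 2 * ρ + 2)) - 1 := by
      have ha := X_pow_dvd_poch_mul_pochInv_sub_one n (ρ + 1)
      have hb : X ^ (n + 1) ∣ poch (n + (ρ + 1)) * pochInv (n + 2 * ρ + 2) - 1 := by
        rw [← poch_mul_pochInv (n + 2 * ρ + 2), ← sub_mul, ← neg_sub, neg_mul, dvd_neg]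
        refine ((pow_dvd_pow X (by omega : n + 1 ≤ n + (ρ + 1) + 1)).trans ?_).mul_right _
        · simpa [show n + (ρ + 1) + (ρ + 1) = n + 2 * ρ + 2 by ring] using
            X_pow_dvd_poch_sub (n + (ρ + 1)) (ρ + 1)
      have := dvd_add (ha.mul_right (poch (n + (ρ + 1)) * pochInv (n + 2 * ρ + 2))) hb
      refine this.trans (dvd_of_eq ?_)
      ring
    have h3 := dvd_add (h1.mul_left ((1 - X ^ (ρ + 1)) ^ 2)) h2
    rw [← sum_poch_sq] at h3
    have h4 := X_pow_dvd_iff.1 h3 n (Nat.lt_succ_self n)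
    rw [show (1 - X ^ (ρ + 1)) ^ 2 * (∑' m, F m - ∑ m ∈ range (n + 1), F m) +
      ((1 - X ^ (ρ + 1)) ^ 2 * ∑ m ∈ range (n + 1), F m - 1) =
      (1 - X ^ (ρ + 1)) ^ 2 * ∑' m, F m - 1 by ring, map_sub, sub_eq_zero] at h4
    exact h4
  have hg := one_sub_mul_geo (by omega : 1 ≤ ρ + 1)
  linear_combination geo (ρ + 1) ^ 2 * key - (∑' m, F m) *
    (1 + (1 - X ^ (ρ + 1)) * geo (ρ + 1)) * hg

/-- The Lerch-type sum in the generating function of `spt`. -/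
noncomputable def lerch (j : ℕ) : ℤ⟦X⟧ :=
  ∑' p : ℕ × ℕ, (-1) ^ (p.1 + 1) * ((2 * p.2 + 1 : ℕ) : ℤ⟦X⟧) ^ j *
    X ^ (pentExp p.1 + (p.1 + 1) * (p.2 + 1))

theorem le_pentExp (ρ : ℕ) : ρ + 1 ≤ pentExp ρ := by
  rw [pentExp, Nat.le_div_iff_mul_le (by norm_num)]
  nlinarith

theorem adicFinite_lerchExp :
    AdicFinite fun p : ℕ × ℕ => (X : ℤ⟦X⟧) ^ (pentExp p.1 + (p.1 + 1) * (p.2 + 1)) :=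
  adicFinite_X_pow fun N => ((Set.finite_lt_nat N).prod (Set.finite_lt_nat N)).subset
    fun p (hp : pentExp p.1 + (p.1 + 1) * (p.2 + 1) < N) =>
      ⟨show p.1 < N by nlinarith [le_pentExp p.1], show p.2 < N by nlinarith⟩

theorem lerch_one : lerch 1 = ∑' ρ : ℕ, (-1) ^ (ρ + 1) * X ^ (pentExp ρ + (ρ + 1)) *
    ((1 + X ^ (ρ + 1)) * geo (ρ + 1) ^ 2) := by
  have hs := (adicFinite_lerchExp.mul_left fun p =>
    (-1) ^ (p.1 + 1) * ((2 * p.2 + 1 : ℕ) : ℤ⟦X⟧) ^ 1).summable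
  rw [lerch, hs.tsum_prod' fun b => hs.comp_injective (Prod.mk_right_injective b)]
  refine tsum_congr fun ρ => ?_
  have h2 := ((adicFinite_X_pow_mul (by omega : 1 ≤ ρ + 1)).mul_left
    fun m => ((2 * m + 1 : ℕ) : ℤ⟦X⟧)).summable
  rw [← tsum_odd_mul_X_pow_mul (by omega : 1 ≤ ρ + 1), ← h2.tsum_mul_left]
  exact tsum_congr fun m => by ring

theorem tsum_sum_antidiagonal {T : ℕ × ℕ → ℤ⟦X⟧} (hT : Summable T) :
    (Summable fun s => ∑ c ∈ antidiagonal s, T c) ∧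
      ∑' s, ∑ c ∈ antidiagonal s, T c = ∑' p, T p := by
  have hs : Summable fun c : Σ s : ℕ, antidiagonal s => T c.2 :=
    (Finset.HasAntidiagonal.sigmaAntidiagonalEquivProd.summable_iff (f := T)).2 hT
  have h (s : ℕ) : ∑' c : antidiagonal s, T c = ∑ c ∈ antidiagonal s, T c := by
    rw [tsum_fintype, Finset.univ_eq_attach, Finset.sum_attach _ T]
  constructor
  · simpa only [h] using hs.sigma' fun s => Summable.of_finite
  · simp only [← h]
    rw [← hs.tsum_sigma' fun s => Summable.of_finite]
    exact Finset.HasAntidiagonal.sigmaAntidiagonalEquivProd.tsum_eq T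

/-- The summands in the double series expressing the generating function of `spt`. -/
noncomputable def sptTerm (ρ m : ℕ) : ℤ⟦X⟧ :=
  (-1) ^ (ρ + 1) * X ^ (pentExp ρ + (ρ + 1)) * (1 + X ^ (ρ + 1)) * (poch (m + ρ) ^ 2 * X ^ m *
    (pochInv m * pochInv (m + 2 * ρ + 2)))

theorem adicFinite_sptTerm : AdicFinite fun p : ℕ × ℕ => sptTerm p.1 p.2 := by
  have : AdicFinite fun p : ℕ × ℕ => (X : ℤ⟦X⟧) ^ (p.1 + p.2) :=
    adicFinite_X_pow fun N => ((Set.finite_lt_nat N).prod (Set.finite_lt_nat N)).subset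
      fun p (hp : p.1 + p.2 < N) => ⟨show p.1 < N by omega, show p.2 < N by omega⟩
  refine this.of_imp fun N p h => h.trans ⟨(-1) ^ (p.1 + 1) * X ^ (pentExp p.1 + 1) *
    (1 + X ^ (p.1 + 1)) * (poch (p.2 + p.1) ^ 2 *
    (pochInv p.2 * pochInv (p.2 + 2 * p.1 + 2))), ?_⟩
  rw [sptTerm]
  ring

theorem tsum_sptTerm (ρ : ℕ) : ∑' m, sptTerm ρ m =
    (-1) ^ (ρ + 1) * X ^ (pentExp ρ + (ρ + 1)) * ((1 + X ^ (ρ + 1)) * geo (ρ + 1) ^ 2) := by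
  have hF : Summable fun m => poch (m + ρ) ^ 2 * X ^ m *
      (pochInv m * pochInv (m + 2 * ρ + 2)) := by
    have : AdicFinite fun m => (X : ℤ⟦X⟧) ^ m := adicFinite_X_pow fun N => Set.finite_lt_nat N
    exact ((this.mul_left _).mul_right _).summable
  simp only [sptTerm]
  rw [hF.tsum_mul_left, tsum_poch_sq]
  ring

theorem pentagonalSeries_mul_smallestGF (s : ℕ) : pentagonalSeries ℤ * smallestGF (s + 1) =
    X ^ (s + 1) * geo (s + 1) ^ 2 + ∑ c ∈ antidiagonal s, sptTerm c.1 c.2 := by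
  have hc : pentagonalSeries ℤ * smallestGF (s + 1) = X ^ (s + 1) * geo (s + 1) * poch s := by
    have ha := smallestGF_eq (by omega : 1 ≤ s + 1)
    have hb := pentagonalSeries_mul_partGeGF s
    have hg := one_sub_mul_geo (by omega : 1 ≤ s + 1)
    rw [← poch] at hb
    linear_combination pentagonalSeries ℤ * geo (s + 1) * ha + X ^ (s + 1) * geo (s + 1) * hb -
      pentagonalSeries ℤ * smallestGF (s + 1) * hg
  rw [hc, ← poch_mul_pochInv_succ, Nat.sum_antidiagonal_eq_sum_range_succ sptTerm]
  conv_lhs => rw [← pochInv_sq_add_sum (s + 1)]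
  rw [mul_add, mul_add, add_mul, mul_sum, mul_sum, sum_mul]
  refine congrArg₂ (· + ·) ?_ (sum_congr rfl ?_)
  · ring
  · intro ρ hρ
    obtain ⟨m, rfl⟩ : ∃ m, s = m + ρ := ⟨s - ρ, by simp at hρ; omega⟩
    simp only [sptTerm, show m + ρ + 1 - (ρ + 1) = m by omega, Nat.add_sub_cancel,
      show m + ρ + 1 + (ρ + 1) = m + 2 * ρ + 2 by ring]
    ring

theorem pentagonalSeries_mul_sptGF : pentagonalSeries ℤ * sptGF = sigmaGF + lerch 1 := by
  have hSs : Summable fun s : ℕ => (X : ℤ⟦X⟧) ^ (s + 1) * geo (s + 1) ^ 2 :=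
    ((adicFinite_X_pow fun N => (Set.finite_lt_nat N).subset fun s (h : s + 1 < N) =>
      show s < N by omega).mul_right _).summable
  have hT := adicFinite_sptTerm.summable
  have h := tsum_sum_antidiagonal hT
  rw [sptGF_eq, ← adicFinite_smallestGF.summable.tsum_mul_left,
    tsum_congr pentagonalSeries_mul_smallestGF, Summable.tsum_add hSs h.1, h.2,
    sigmaGF_eq_tsum_geo_sq, lerch_one,
    hT.tsum_prod' fun b => hT.comp_injective (Prod.mk_right_injective b)]
  simp only [tsum_sptTerm]

end SptCongruence

namespace SptCongruence

open PowerSeries PowerSeries.WithPiTopology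

/-- The sign `(-1) ^ j`. -/
def sgn (j : ℤ) : ℤ := (j.negOnePow : ℤˣ)

theorem sgn_zero : sgn 0 = 1 := by simp [sgn]

theorem sgn_add_one (j : ℤ) : sgn (j + 1) = -sgn j := by simp [sgn, Int.negOnePow_succ]

theorem sgn_neg (j : ℤ) : sgn (-j) = sgn j := by simp [sgn, Int.negOnePow_neg]

theorem sgn_neg_one_sub (j : ℤ) : sgn (-1 - j) = -sgn j := by
  rw [show -1 - j = -(j + 1) by ring, sgn_neg, sgn_add_one]

/-- The triangular number `j (j + 1) / 2`. -/
def tri (j : ℤ) : ℕ := (j * (j + 1) / 2).toNat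

theorem two_mul_tri (j : ℤ) : 2 * (tri j : ℤ) = j * (j + 1) := by
  have h := Int.even_mul_succ_self j
  have h0 : 0 ≤ j * (j + 1) := by
    rcases le_or_gt 0 j with hj | hj <;> nlinarith
  obtain ⟨k, hk⟩ := h
  rw [tri, hk, Int.toNat_of_nonneg] <;> omega

theorem tri_sub_one (j : ℤ) : (tri (j - 1) : ℤ) = tri j - j := by
  have h1 := two_mul_tri j
  have h2 := two_mul_tri (j - 1)
  linarith

theorem tri_neg_one_sub (j : ℤ) : tri (-1 - j) = tri j := by
  have h1 := two_mul_tri j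
  have h2 := two_mul_tri (-1 - j)
  have : (tri (-1 - j) : ℤ) = tri j := by linarith
  exact_mod_cast this

theorem adicFinite_X_pow_tri {R : Type*} [CommRing R] :
    AdicFinite fun j : ℤ => (X : R⟦X⟧) ^ tri j :=
  adicFinite_X_pow fun N => (Set.finite_Icc (-(2 * N : ℤ)) (2 * N)).subset fun j hj => by
    have h1 := two_mul_tri j
    have h2 : (tri j : ℤ) < N := by exact_mod_cast hj
    constructor <;> nlinarith

theorem AdicFinite.tsum {R ι κ : Type*} [CommRing R] [TopologicalSpace R] [T2Space R]
    {F : ι × κ → R⟦X⟧} (hF : AdicFinite F) : AdicFinite fun i => ∑' k, F (i, k) := fun N =>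
  ((hF N).image Prod.fst).subset fun i hi => by
    by_contra h
    refine hi (X_pow_dvd_iff.2 fun n hn => ?_)
    rw [coeff_tsum (hF.comp (Prod.mk_right_injective i)).summable]
    refine (tsum_congr fun k => ?_).trans tsum_zero
    by_contra hk
    exact h ⟨(i, k), fun hd => hk (X_pow_dvd_iff.1 hd n hn), rfl⟩

/-- The convolution with the coefficients of a theta series. -/
noncomputable def theta (y : ℤ → ℤ⟦X⟧) (m : ℤ) : ℤ⟦X⟧ :=
  ∑' j : ℤ, X ^ tri j * ((sgn j : ℤ⟦X⟧) * y (m - j))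

theorem summable_tri (y : ℤ → ℤ⟦X⟧) : Summable fun j : ℤ => X ^ tri j * y j :=
  (adicFinite_X_pow_tri.mul_right _).summable

theorem theta_sub (y z : ℤ → ℤ⟦X⟧) (m : ℤ) :
    theta (fun k => y k - z k) m = theta y m - theta z m := by
  rw [theta, theta, theta, ← Summable.tsum_sub (summable_tri _) (summable_tri _)]
  exact tsum_congr fun j => by ring

theorem theta_comp_sub_one (y : ℤ → ℤ⟦X⟧) (m : ℤ) :
    theta (fun k => y (k - 1)) m = theta y (m - 1) := by
  rw [theta, theta]
  exact tsum_congr fun j => by rw [show m - j - 1 = m - 1 - j by ring]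

theorem tsum_sgn_tri : ∑' j : ℤ, X ^ tri j * (sgn j : ℤ⟦X⟧) = 0 := by
  have h := (Equiv.subLeft (-1 : ℤ)).tsum_eq fun j => X ^ tri j * (sgn j : ℤ⟦X⟧)
  simp only [Equiv.subLeft_apply, tri_neg_one_sub, sgn_neg_one_sub, Int.cast_neg, mul_neg,
    tsum_neg] at h
  have h2 : (2 : ℤ⟦X⟧) * ∑' j : ℤ, X ^ tri j * (sgn j : ℤ⟦X⟧) = 0 := by linear_combination -h
  exact (mul_eq_zero.1 h2).resolve_left (by
    rw [show (2 : ℤ⟦X⟧) = C 2 from (map_ofNat C 2).symm, ← map_zero C]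
    exact fun h => absurd (C_injective h) (by norm_num))

/-- The moments of the signed triangular series. -/
noncomputable def triMoment (i : ℕ) : ℤ⟦X⟧ :=
  ∑' j : ℤ, X ^ tri j * ((sgn j : ℤ⟦X⟧) * (j : ℤ⟦X⟧) ^ i)

theorem theta_quadratic (a b c : ℤ⟦X⟧) (m : ℤ) :
    theta (fun k => a * (k : ℤ⟦X⟧) ^ 2 + b * (k : ℤ⟦X⟧) + c) m =
      0 * (m : ℤ⟦X⟧) ^ 2 + -(2 * a * triMoment 1) * (m : ℤ⟦X⟧) +
        (a * triMoment 2 - b * triMoment 1) := by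
  have hs := fun y : ℤ → ℤ⟦X⟧ => summable_tri y
  have : theta (fun k => a * (k : ℤ⟦X⟧) ^ 2 + b * (k : ℤ⟦X⟧) + c) m =
      (a * (m : ℤ⟦X⟧) ^ 2 + b * (m : ℤ⟦X⟧) + c) * (∑' j : ℤ, X ^ tri j * (sgn j : ℤ⟦X⟧)) -
      (2 * a * (m : ℤ⟦X⟧) + b) * triMoment 1 + a * triMoment 2 := by
    rw [triMoment, triMoment, ← (hs _).tsum_mul_left, ← (hs _).tsum_mul_left,
      ← (hs _).tsum_mul_left, ← Summable.tsum_sub ((hs _).mul_left _) ((hs _).mul_left _),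
      ← Summable.tsum_add (((hs _).mul_left _).sub ((hs _).mul_left _)) ((hs _).mul_left _), theta]
    refine tsum_congr fun j => ?_
    push_cast
    ring
  rw [this, tsum_sgn_tri]
  ring

theorem theta_theta_theta_quadratic (a b c : ℤ⟦X⟧) (m : ℤ) :
    theta (theta (theta fun k => a * (k : ℤ⟦X⟧) ^ 2 + b * (k : ℤ⟦X⟧) + c)) m = 0 := by
  rw [funext (theta_quadratic a b c), funext (theta_quadratic _ _ _), theta_quadratic]
  ring

/-- The coefficients of a power series, extended by zero to negative indices. -/
noncomputable def coeffZ (f : ℤ⟦X⟧) (N : ℤ) : ℤ := if 0 ≤ N then coeff N.toNat f else 0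

theorem coeffZ_X_pow_mul (k : ℕ) (f : ℤ⟦X⟧) (N : ℤ) :
    coeffZ (X ^ k * f) N = coeffZ f (N - k) := by
  unfold coeffZ
  split_ifs with h1 h2 h2
  · rw [coeff_X_pow_mul', if_pos (by omega), show (N - k).toNat = N.toNat - k by omega]
  · rw [coeff_X_pow_mul', if_neg (by omega)]
  · omega
  · rfl

theorem coeffZ_intCast_mul (c : ℤ) (f : ℤ⟦X⟧) (N : ℤ) :
    coeffZ ((c : ℤ⟦X⟧) * f) N = c * coeffZ f N := by
  unfold coeffZ
  rw [show (c : ℤ⟦X⟧) = C c by simp]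
  split_ifs
  · rw [coeff_C_mul]
  · rw [mul_zero]

theorem coeffZ_neg (f : ℤ⟦X⟧) (N : ℤ) : coeffZ (-f) N = -coeffZ f N := by
  unfold coeffZ
  split_ifs <;> simp

theorem coeffZ_tsum {ι : Type*} {F : ι → ℤ⟦X⟧} (hF : Summable F) (N : ℤ) :
    coeffZ (∑' i, F i) N = ∑' i, coeffZ (F i) N := by
  unfold coeffZ
  split_ifs
  · exact coeff_tsum hF _
  · simp

theorem coeffZ_theta {y z : ℤ → ℤ⟦X⟧} {s κ c : ℤ}
    (h : ∀ m N, coeffZ (z m) N = c * coeffZ (y (m + s)) (N - m - κ)) (m N : ℤ) :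
    coeffZ (theta z m) N = -c * coeffZ (theta y (m + (s - 1))) (N - m - κ) := by
  rw [← coeffZ_intCast_mul, theta, theta, ← (summable_tri _).tsum_mul_left,
    coeffZ_tsum (summable_tri _), coeffZ_tsum ((summable_tri _).mul_left _),
    ← (Equiv.addRight (1 : ℤ)).tsum_eq]
  refine tsum_congr fun j => ?_
  have ht := tri_sub_one (j + 1)
  rw [add_sub_cancel_right] at ht
  rw [Equiv.coe_addRight, coeffZ_intCast_mul, coeffZ_X_pow_mul, coeffZ_X_pow_mul,
    coeffZ_intCast_mul, coeffZ_intCast_mul, h, sgn_add_one, ht, show m - (j + 1) + s = m + (s - 1) - j by ring,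
    show N - (tri (j + 1) : ℤ) - (m - (j + 1)) - κ = N - m - κ - (tri (j + 1) - (j + 1)) by ring]
  ring

theorem coeffZ_eq_zero_of_neg {f : ℤ⟦X⟧} {N : ℤ} (h : N < 0) : coeffZ f N = 0 := by
  rw [coeffZ, if_neg (by omega)]

theorem eq_zero_of_coeffZ_sub {f : ℤ⟦X⟧} {k : ℤ} (hk : k ≠ 0)
    (h : ∀ N, coeffZ f N = coeffZ f (N - k)) : f = 0 := by
  have h1 : ∀ (n : ℕ) (N : ℤ), coeffZ f N = coeffZ f (N - n * k) := by
    intro n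
    induction n with
    | zero => simp
    | succ n ih => exact fun N => by rw [ih, h]; congr 1; push_cast; ring
  ext n
  have hn : coeff n f = coeffZ f n := by simp [coeffZ]
  rw [hn, map_zero]
  rcases lt_or_gt_of_ne hk with hk | hk
  · have := h1 (n + 1) (n + (n + 1 : ℕ) * k)
    rw [add_sub_cancel_right] at this
    rw [← this]
    exact coeffZ_eq_zero_of_neg (by push_cast; nlinarith)
  · rw [h1 (n + 1)]
    exact coeffZ_eq_zero_of_neg (by push_cast; nlinarith)

end SptCongruence

namespace SptCongruence

open PowerSeries PowerSeries.WithPiTopology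

theorem pentagonal_natCast_add_one (k : ℕ) : pentagonal ((k : ℤ) + 1) = pentExp k := by
  rw [pentagonal_def, pentExp, show ((k : ℤ) + 1) * (3 * ((k : ℤ) + 1) - 1) / 2 =
    (((k + 1) * (3 * k + 2) / 2 : ℕ) : ℤ) by push_cast; ring_nf, Int.toNat_natCast]

theorem pentagonal_neg_natCast_add_one (k : ℕ) :
    pentagonal (-((k : ℤ) + 1)) = pentExp k + (k + 1) := by
  have h1 := two_mul_natCast_pentagonal_neg ((k : ℤ) + 1)
  have h2 := two_mul_natCast_pentagonal ((k : ℤ) + 1)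
  rw [pentagonal_natCast_add_one] at h2
  have : (pentagonal (-((k : ℤ) + 1)) : ℤ) = ((pentExp k + (k + 1) : ℕ) : ℤ) := by
    push_cast; linarith
  exact_mod_cast this

/-- The quadratic function `(2 m + 1) ^ 2 - P`. -/
noncomputable def quadP (m : ℤ) : ℤ⟦X⟧ := (2 * (m : ℤ⟦X⟧) + 1) ^ 2 - eisP

/-- The rapidly decreasing part of the Appell-type coefficients. -/
noncomputable def appellTail (m : ℕ) : ℤ⟦X⟧ :=
  ∑' ρ : ℕ, X ^ (pentExp ρ + (ρ + 1) * (m + 1)) *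
    ((-1) ^ (ρ + 1) * quadP ((m + 3 * ρ + 3 : ℕ) : ℤ))

theorem adicFinite_appellTail (m : ℕ) :
    AdicFinite fun ρ : ℕ => (X : ℤ⟦X⟧) ^ (pentExp ρ + (ρ + 1) * (m + 1)) :=
  adicFinite_lerchExp.comp (e := fun ρ => (ρ, m)) fun _ _ h => (Prod.ext_iff.1 h).1

theorem appellTail_eq (m : ℕ) :
    appellTail m = -X ^ (m + 2) * (quadP ((m + 3 : ℕ) : ℤ) + appellTail (m + 3)) := by
  rw [appellTail, ((adicFinite_appellTail m).mul_right _).summable.tsum_eq_zero_add, mul_add (-X ^ (m + 2)),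
    appellTail, ← ((adicFinite_appellTail (m + 3)).mul_right _).summable.tsum_mul_left]
  refine congrArg₂ (· + ·) ?_ (tsum_congr fun ρ => ?_)
  · rw [show pentExp 0 = 1 from rfl]
    ring_nf
  · rw [pentExp_succ, show m + 3 * (ρ + 1) + 3 = m + 3 + 3 * ρ + 3 by ring]
    ring

theorem quadP_zero_add_appellTail :
    quadP 0 + appellTail 0 = X * (quadP 2 + appellTail 2) := by
  set f : ℕ → ℤ⟦X⟧ := fun k => X ^ pentagonal (-(k : ℤ)) * ((-1) ^ k * quadP ((3 * k : ℕ) : ℤ))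
    with hf
  set g : ℕ → ℤ⟦X⟧ := fun k => X ^ pentagonal ((k : ℤ) + 1) *
    ((-1) ^ k * quadP ((3 * k + 2 : ℕ) : ℤ)) with hg
  have hb : AdicFinite fun k : ℕ => (X : ℤ⟦X⟧) ^ pentagonal ((k : ℤ) + 1) :=
    adicFinite_X_pow fun N => (Set.finite_lt_nat N).subset fun k (h : _ < N) => by
      rw [pentagonal_natCast_add_one] at h
      exact (by have := le_pentExp k; omega : k < N)
  have ha : AdicFinite fun k : ℕ => (X : ℤ⟦X⟧) ^ pentagonal (-(k : ℤ)) :=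
    adicFinite_X_pow fun N => (Set.finite_lt_nat N).subset fun k (h : _ < N) => by
      show k < N
      rcases k with - | k
      · omega
      · rw [Nat.cast_succ, pentagonal_neg_natCast_add_one] at h
        omega
  have hfs : Summable f := (ha.mul_right _).summable
  have hgs : Summable g := (hb.mul_right _).summable
  have e1 : ∑' k, f k = quadP 0 + appellTail 0 := by
    rw [hfs.tsum_eq_zero_add, appellTail]
    refine congrArg₂ (· + ·) (by simp [hf, pentagonal_def]) (tsum_congr fun ρ => ?_)
    simp only [hf, Nat.cast_succ]
    rw [pentagonal_neg_natCast_add_one]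
    push_cast
    ring_nf
  have e2 : ∑' k, g k = X * (quadP 2 + appellTail 2) := by
    rw [hgs.tsum_eq_zero_add, appellTail, mul_add,
      ← ((adicFinite_appellTail 2).mul_right _).summable.tsum_mul_left]
    refine congrArg₂ (· + ·) ?_ (tsum_congr fun ρ => ?_)
    · simp only [hg]
      rw [pentagonal_natCast_add_one]
      simp [pentExp]
    · simp only [hg]
      rw [pentagonal_natCast_add_one, pentExp_succ]
      ring_nf
  have hP : 24 * qD (pentagonalSeries ℤ) + (1 - eisP) * pentagonalSeries ℤ = 0 := by
    linear_combination qD_pentagonalSeries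
  have hA : AdicFinite fun k : ℕ => (-1 : ℤ⟦X⟧) ^ k * (X ^ pentagonal (-(k : ℤ)) -
      X ^ pentagonal ((k : ℤ) + 1)) := (ha.sub hb).mul_left _
  rw [pentagonalSeries_eq_tsum_pow_pentagonal_sub, qD_tsum hA] at hP
  have hD : AdicFinite fun k : ℕ => qD ((-1 : ℤ⟦X⟧) ^ k * (X ^ pentagonal (-(k : ℤ)) -
      X ^ pentagonal ((k : ℤ) + 1))) := hA.of_imp fun N i h => by
    obtain ⟨c, hc⟩ := h
    rw [hc, qD_mul, qD_pow]
    refine dvd_add (dvd_mul_right _ _) ?_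
    rcases N with - | N
    · simp
    · exact ⟨c * ((N + 1 : ℕ) : ℤ⟦X⟧), by simp [qD]; ring⟩
  rw [← hD.summable.tsum_mul_left, ← hA.summable.tsum_mul_left,
    ← Summable.tsum_add (hD.summable.mul_left _) (hA.summable.mul_left _)] at hP
  rw [← e1, ← e2, ← sub_eq_zero, ← Summable.tsum_sub hfs hgs, ← hP]
  refine tsum_congr fun k => ?_
  have hq (d : ℕ) : qD ((X : ℤ⟦X⟧) ^ d) = (d : ℤ⟦X⟧) * X ^ d := by
    simpa using qD_X_pow_mul_intCast (R := ℤ) d 1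
  have hs : qD ((-1 : ℤ⟦X⟧) ^ k) = 0 := by
    rw [qD_pow, map_neg, Derivation.map_one_eq_zero]; simp
  have c1 : (24 : ℤ⟦X⟧) * ((pentagonal (-(k : ℤ)) : ℕ) : ℤ⟦X⟧) + 1 =
      (2 * ((3 * k : ℕ) : ℤ⟦X⟧) + 1) ^ 2 := by
    have h := two_mul_natCast_pentagonal_neg (k : ℤ)
    have : (24 * (pentagonal (-(k : ℤ)) : ℤ) + 1) = (2 * ((3 * k : ℕ) : ℤ) + 1) ^ 2 := by
      push_cast; linear_combination 12 * h
    exact_mod_cast congrArg (Int.cast : ℤ → ℤ⟦X⟧) this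
  have c2 : (24 : ℤ⟦X⟧) * ((pentagonal ((k : ℤ) + 1) : ℕ) : ℤ⟦X⟧) + 1 =
      (2 * ((3 * k + 2 : ℕ) : ℤ⟦X⟧) + 1) ^ 2 := by
    have h := two_mul_natCast_pentagonal ((k : ℤ) + 1)
    have : (24 * (pentagonal ((k : ℤ) + 1) : ℤ) + 1) = (2 * ((3 * k + 2 : ℕ) : ℤ) + 1) ^ 2 := by
      push_cast; linear_combination 12 * h
    exact_mod_cast congrArg (Int.cast : ℤ → ℤ⟦X⟧) this
  simp only [hf, hg, quadP, qD_mul, map_sub, hq, hs, Int.cast_natCast]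
  rw [← c1, ← c2]
  ring

/-- The Appell-type coefficients. -/
noncomputable def appell : ℤ → ℤ⟦X⟧
  | Int.ofNat m => quadP m + appellTail m
  | Int.negSucc m => -appellTail m

theorem appell_natCast (m : ℕ) : appell m = quadP m + appellTail m := rfl

theorem appell_neg_one_sub (m : ℤ) : appell (-1 - m) = quadP m - appell m := by
  rcases m with m | m
  · rw [show (-1 - Int.ofNat m) = Int.negSucc m by simp [Int.negSucc_eq]; ring]
    simp [appell]
  · rw [show (-1 - Int.negSucc m) = Int.ofNat m by simp [Int.negSucc_eq]]
    simp only [appell, quadP, Int.negSucc_eq]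
    push_cast
    ring

theorem coeffZ_quadP_sub_appell (m N : ℤ) :
    coeffZ (quadP m - appell m) N = coeffZ (appell (m + 3)) (N - m - 2) := by
  have h1 (k : ℕ) : quadP k - appell k = X ^ (k + 2) * appell (k + 3) := by
    rw [show (k : ℤ) + 3 = ((k + 3 : ℕ) : ℤ) by push_cast; ring, appell_natCast, appell_natCast,
      appellTail_eq]
    ring
  have h2 : appell 0 = X * appell 2 := quadP_zero_add_appellTail
  rcases lt_or_ge m 0 with hm | hm
  · rcases (by omega : m = -1 ∨ m = -2 ∨ m = -3 ∨ m ≤ -4) with rfl | rfl | rfl | hm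
    · rw [← appell_neg_one_sub, show (-1 - -1 : ℤ) = 0 by norm_num, h2, ← pow_one X,
        coeffZ_X_pow_mul, show (-1 + 3 : ℤ) = 2 by norm_num]
      congr 1
      push_cast
      ring
    · rw [← appell_neg_one_sub]
      norm_num
    · rw [← appell_neg_one_sub, show (-3 + 3 : ℤ) = 0 by norm_num, h2, ← pow_one X,
        coeffZ_X_pow_mul, show (-1 - -3 : ℤ) = 2 by norm_num]
      congr 1
      push_cast
      ring
    · obtain ⟨k, rfl⟩ : ∃ k : ℕ, m = -4 - k := ⟨(-4 - m).toNat, by omega⟩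
      have h := h1 k
      rw [← appell_neg_one_sub] at h ⊢
      rw [show -4 - (k : ℤ) + 3 = -1 - k by ring, h, coeffZ_X_pow_mul,
        show -1 - (-4 - (k : ℤ)) = k + 3 by ring]
      congr 1
      push_cast
      ring
  · obtain ⟨k, rfl⟩ := Int.eq_ofNat_of_zero_le hm
    rw [h1, coeffZ_X_pow_mul]
    congr 1
    push_cast
    ring

theorem theta_theta_theta_appell {m : ℤ} (hm : m ≠ -2) : theta (theta (theta appell)) m = 0 := by
  have hz : theta (theta (theta fun k => quadP k - appell k)) =
      fun k => 0 - theta (theta (theta appell)) k := by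
    rw [funext (theta_sub quadP appell), funext (theta_sub (theta quadP) (theta appell)),
      funext (theta_sub (theta (theta quadP)) (theta (theta appell)))]
    funext k
    congr 1
    rw [← theta_theta_theta_quadratic 4 4 (1 - eisP) k]
    congr 3
    funext j
    rw [quadP]
    ring
  have h := coeffZ_theta (coeffZ_theta (coeffZ_theta (z := fun k => quadP k - appell k)
    (y := appell) (s := 3) (κ := 2) (c := 1) fun m N => by
      rw [one_mul, coeffZ_quadP_sub_appell])) m
  rw [hz] at h
  refine eq_zero_of_coeffZ_sub (k := m + 2) (by omega) fun N => ?_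
  have h2 := h N
  beta_reduce at h2
  rw [zero_sub, coeffZ_neg, show m + (3 - 1 - 1 - 1) = m by ring] at h2
  rw [show N - (m + 2) = N - m - 2 by ring]
  linarith

end SptCongruence

namespace SptCongruence

open PowerSeries PowerSeries.WithPiTopology

theorem AdicFinite.map {R S ι : Type*} [CommRing R] [CommRing S] {F : ι → R⟦X⟧} (φ : R →+* S)
    (hF : AdicFinite F) : AdicFinite fun i => PowerSeries.map φ (F i) := fun N =>
  (hF N).subset fun i hi hd => hi (by simpa using map_dvd (PowerSeries.map φ) hd)

theorem map_tsum_of_adicFinite {R S ι : Type*} [CommRing R] [CommRing S] [TopologicalSpace R]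
    [T2Space R] [TopologicalSpace S] [T2Space S] {F : ι → R⟦X⟧} (φ : R →+* S)
    (hF : AdicFinite F) : PowerSeries.map φ (∑' i, F i) = ∑' i, PowerSeries.map φ (F i) := by
  ext n
  rw [coeff_map, coeff_tsum hF.summable, coeff_tsum (hF.map φ).summable,
    tsum_eq_finsum (hF.finite_coeff n), tsum_eq_finsum ((hF.map φ).finite_coeff n)]
  simp only [coeff_map]
  exact (φ : R →+ S).map_finsum (hF.finite_coeff n)

theorem AdicFinite.theta {y : ℤ → ℤ⟦X⟧} (hy : AdicFinite y) :
    AdicFinite fun p : ℤ × ℤ => X ^ tri p.2 * ((sgn p.2 : ℤ⟦X⟧) * y (p.1 - p.2)) := by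
  have h := (adicFinite_X_pow_tri (R := ℤ)).prod hy
  have h2 := (h.comp (e := fun p : ℤ × ℤ => (p.2, p.1 - p.2)) fun p q hpq => by
    have h1 := (Prod.ext_iff.1 hpq).1
    have h2 := (Prod.ext_iff.1 hpq).2
    simp only at h1 h2
    exact Prod.ext (by omega) h1).mul_left fun p => (sgn p.2 : ℤ⟦X⟧)
  refine h2.of_imp fun N p hd => hd.trans (dvd_of_eq ?_)
  ring

theorem tsum_comm_of_adicFinite {R ι κ : Type*} [CommRing R] [TopologicalSpace R] [T2Space R]
    [IsTopologicalRing R] {H : ι → κ → R⟦X⟧} (hH : AdicFinite fun p : ι × κ => H p.1 p.2) :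
    ∑' i, ∑' k, H i k = ∑' k, ∑' i, H i k :=
  (Summable.tsum_comm' (f := H) hH.summable
    (fun i => (hH.comp (Prod.mk_right_injective i)).summable)
    fun k => (hH.comp (Prod.mk_left_injective k)).summable).symm

/-- The backward difference. -/
def backDiff (y : ℤ → ℤ⟦X⟧) (m : ℤ) : ℤ⟦X⟧ := y m - y (m - 1)

theorem AdicFinite.backDiff {y : ℤ → ℤ⟦X⟧} (hy : AdicFinite y) : AdicFinite (backDiff y) :=
  hy.sub (hy.comp (sub_left_injective (b := (1 : ℤ))))

theorem theta_backDiff (y : ℤ → ℤ⟦X⟧) : theta (backDiff y) = backDiff (theta y) := by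
  funext m
  have : backDiff y = fun m => y m - y (m - 1) := rfl
  rw [this, theta_sub, theta_comp_sub_one, backDiff]

section GeneratingFunction

set_option linter.unusedSectionVars false

variable {A : Type*} [CommRing A] [TopologicalSpace A] [IsTopologicalRing A] [T2Space A] (w : Aˣ)

/-- The base change of integral power series. -/
noncomputable abbrev baseChange (A : Type*) [CommRing A] : ℤ⟦X⟧ →+* A⟦X⟧ :=
  PowerSeries.map (Int.castRingHom A)

/-- An integral power of the unit `w`, as a constant power series. -/
noncomputable def unitPow (k : ℤ) : A⟦X⟧ := C ((w ^ k : Aˣ) : A)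

theorem unitPow_add (j k : ℤ) : unitPow w (j + k) = unitPow w j * unitPow w k := by
  simp [unitPow, zpow_add]

theorem unitPow_zero : unitPow w 0 = 1 := by simp [unitPow]

/-- The two-sided generating function. -/
noncomputable def biGen (y : ℤ → ℤ⟦X⟧) : A⟦X⟧ := ∑' m : ℤ, baseChange A (y m) * unitPow w (2 * m)

theorem summable_biGen {y : ℤ → ℤ⟦X⟧} (hy : AdicFinite y) :
    Summable fun m : ℤ => baseChange A (y m) * unitPow w (2 * m) :=
  ((hy.map _).mul_right _).summable

theorem biGen_add {y z : ℤ → ℤ⟦X⟧} (hy : AdicFinite y) (hz : AdicFinite z) :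
    biGen w (fun m => y m + z m) = biGen w y + biGen w z := by
  rw [biGen, biGen, biGen, ← Summable.tsum_add (summable_biGen w hy) (summable_biGen w hz)]
  exact tsum_congr fun m => by rw [map_add, add_mul]

theorem biGen_backDiff {y : ℤ → ℤ⟦X⟧} (hy : AdicFinite y) :
    biGen w (backDiff y) = (1 - unitPow w 2) * biGen w y := by
  have h : ∑' m : ℤ, baseChange A (y (m - 1)) * unitPow w (2 * m) = unitPow w 2 * biGen w y := by
    rw [biGen, ← (summable_biGen w hy).tsum_mul_left, ← (Equiv.addRight (1 : ℤ)).tsum_eq]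
    refine tsum_congr fun m => ?_
    rw [Equiv.coe_addRight, add_sub_cancel_right, mul_add, mul_one, unitPow_add]
    ring
  have hs : Summable fun m : ℤ => baseChange A (y (m - 1)) * unitPow w (2 * m) :=
    (((hy.comp (sub_left_injective (b := (1 : ℤ)))).map _).mul_right _).summable
  rw [sub_mul, one_mul, ← h, biGen, biGen, ← Summable.tsum_sub (summable_biGen w hy) hs]
  exact tsum_congr fun m => by rw [backDiff, map_sub, sub_mul]

/-- The two-sided theta series attached to `w`. -/
noncomputable def biTheta : A⟦X⟧ :=
  ∑' j : ℤ, X ^ tri j * (((sgn j : ℤ) : A⟦X⟧) * unitPow w (2 * j + 1))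

theorem summable_biTheta : Summable fun j : ℤ => (X : A⟦X⟧) ^ tri j *
    (((sgn j : ℤ) : A⟦X⟧) * unitPow w (2 * j + 1)) := (adicFinite_X_pow_tri.mul_right _).summable

theorem biGen_theta {y : ℤ → ℤ⟦X⟧} (hy : AdicFinite y) :
    biGen w (theta y) = unitPow w (-1) * biTheta w * biGen w y := by
  have h1 : biGen w (theta y) = ∑' m : ℤ, ∑' j : ℤ, baseChange A (X ^ tri j *
      ((sgn j : ℤ⟦X⟧) * y (m - j))) * unitPow w (2 * m) := by
    rw [biGen]
    refine tsum_congr fun m => ?_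
    have hm : AdicFinite fun j : ℤ => X ^ tri j * ((sgn j : ℤ⟦X⟧) * y (m - j)) :=
      adicFinite_X_pow_tri.mul_right _
    have hs := (hm.map (Int.castRingHom A)).summable
    rw [theta, baseChange, map_tsum_of_adicFinite _ hm, ← hs.tsum_mul_right]
  have h2 : AdicFinite fun p : ℤ × ℤ => baseChange A (X ^ tri p.2 *
      ((sgn p.2 : ℤ⟦X⟧) * y (p.1 - p.2))) * unitPow w (2 * p.1) :=
    (hy.theta.map (Int.castRingHom A)).mul_right fun p => unitPow w (2 * p.1)
  rw [h1, tsum_comm_of_adicFinite (H := fun m j : ℤ => baseChange A (X ^ tri j *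
      ((sgn j : ℤ⟦X⟧) * y (m - j))) * unitPow w (2 * m)) h2, biTheta, mul_assoc,
    ← (summable_biTheta w).tsum_mul_right, ← ((summable_biTheta w).mul_right _).tsum_mul_left]
  refine tsum_congr fun j => ?_
  rw [← (Equiv.addRight j).tsum_eq, biGen, ← (summable_biGen w hy).tsum_mul_left,
    ← ((summable_biGen w hy).mul_left _).tsum_mul_left]
  refine tsum_congr fun m => ?_
  simp only [Equiv.coe_addRight, add_sub_cancel_right, map_mul, map_pow, map_intCast, map_X,
    mul_add, unitPow_add]
  have : unitPow w (-1) * unitPow w 1 = 1 := by rw [← unitPow_add, neg_add_cancel, unitPow_zero]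
  linear_combination -(X ^ tri j * ((sgn j : ℤ) : A⟦X⟧) * baseChange A (y m) *
    unitPow w (2 * m) * unitPow w (2 * j)) * this

end GeneratingFunction

end SptCongruence

namespace SptCongruence

open PowerSeries PowerSeries.WithPiTopology

/-- The polynomial part of the Appell-type coefficients. -/
noncomputable def appellHead (m : ℤ) : ℤ⟦X⟧ := if 0 ≤ m then quadP m else 0

/-- The antisymmetric extension of a sequence, with respect to `m ↦ -1 - m`. -/
def antiExt (F : ℕ → ℤ⟦X⟧) : ℤ → ℤ⟦X⟧
  | Int.ofNat m => F m
  | Int.negSucc m => -F m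

theorem appell_eq (m : ℤ) : appell m = appellHead m + antiExt appellTail m := by
  rcases m with m | m
  · simp [appell, appellHead, antiExt]
  · simp [appell, appellHead, antiExt]

theorem antiExt_natCast (F : ℕ → ℤ⟦X⟧) (m : ℕ) : antiExt F m = F m := rfl

theorem antiExt_neg_natCast_add_one (F : ℕ → ℤ⟦X⟧) (m : ℕ) : antiExt F (-((m : ℤ) + 1)) = -F m := by
  rw [← Int.negSucc_eq]; rfl

theorem AdicFinite.antiExt {F : ℕ → ℤ⟦X⟧} (hF : AdicFinite F) : AdicFinite (antiExt F) := fun N =>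
  (((hF N).image fun m : ℕ => (m : ℤ)).union ((hF N).image Int.negSucc)).subset fun m hm => by
    rcases m with m | m
    · exact Or.inl ⟨m, hm, rfl⟩
    · exact Or.inr ⟨m, fun h => hm ((dvd_neg).2 h), rfl⟩

theorem adicFinite_appellTail_fun : AdicFinite appellTail :=
  ((adicFinite_lerchExp).mul_right fun p : ℕ × ℕ => (-1) ^ (p.1 + 1) *
    quadP ((p.2 + 3 * p.1 + 3 : ℕ) : ℤ)).comp Prod.swap_injective |>.tsum

theorem support_backDiff_appellHead {m : ℤ} (h : m < 0 ∨ 2 < m) :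
    backDiff (backDiff (backDiff appellHead)) m = 0 := by
  unfold backDiff appellHead
  rcases h with h | h
  · rw [if_neg (by omega), if_neg (by omega), if_neg (by omega), if_neg (by omega)]
    ring
  · rw [if_pos (by omega), if_pos (by omega), if_pos (by omega), if_pos (by omega)]
    unfold quadP
    push_cast
    ring

theorem backDiff_appellHead :
    backDiff (backDiff (backDiff appellHead)) 0 = 1 - eisP ∧
    backDiff (backDiff (backDiff appellHead)) 1 = 6 + 2 * eisP ∧
    backDiff (backDiff (backDiff appellHead)) 2 = 1 - eisP := by
  unfold backDiff appellHead quadP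
  norm_num
  ring

section GeneratingFunction

variable {A : Type*} [CommRing A] [TopologicalSpace A] [IsTopologicalRing A] [T2Space A] (w : Aˣ)

theorem biGen_backDiff_appellHead :
    biGen w (backDiff (backDiff (backDiff appellHead))) = unitPow w 1 ^ 2 *
      ((1 - baseChange A eisP) * (unitPow w 1 - unitPow w (-1)) ^ 2 + 8) := by
  obtain ⟨h0, h1, h2⟩ := backDiff_appellHead
  have ha : unitPow w (-1) * unitPow w 1 = 1 := by rw [← unitPow_add, neg_add_cancel, unitPow_zero]
  rw [biGen, tsum_eq_sum (s := {0, 1, 2})]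
  · rw [sum_insert (by decide), sum_insert (by decide), sum_singleton, h0, h1, h2, mul_zero,
      unitPow_zero, show (2 : ℤ) * 1 = 1 + 1 by norm_num, show (2 : ℤ) * 2 = 1 + 1 + (1 + 1) by norm_num]
    simp only [unitPow_add, map_sub, map_add, map_mul, map_one, map_ofNat]
    linear_combination (2 * unitPow w 1 ^ 2 * (1 - baseChange A eisP) -
      (1 + unitPow w (-1) * unitPow w 1) * (1 - baseChange A eisP)) * ha
  · intro m hm
    rw [support_backDiff_appellHead, map_zero, zero_mul]
    simp only [mem_insert, mem_singleton, not_or] at hm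
    omega

theorem AdicFinite.theta_fun {y : ℤ → ℤ⟦X⟧} (hy : AdicFinite y) : AdicFinite (SptCongruence.theta y) :=
  hy.theta.tsum

theorem biGen_identity :
    (8 + (1 - baseChange A eisP) * (unitPow w 1 - unitPow w (-1)) ^ 2 -
      (unitPow w 1 - unitPow w (-1)) ^ 3 * (unitPow w 1 * biGen w (antiExt appellTail))) *
        biTheta w ^ 3 =
      -(unitPow w 1 - unitPow w (-1)) ^ 3 * baseChange A (theta (theta (theta appell)) (-2)) := by
  have ha : unitPow w (-1) * unitPow w 1 = 1 := by rw [← unitPow_add, neg_add_cancel, unitPow_zero]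
  have ht := adicFinite_appellTail_fun.antiExt
  have hh : AdicFinite (backDiff (backDiff (backDiff appellHead))) :=
    adicFinite_of_finite_support ((Set.finite_Icc (0 : ℤ) 2).subset fun m hm => by
      by_contra h
      refine hm (support_backDiff_appellHead ?_)
      rw [Set.mem_Icc] at h
      omega)
  have hsplit : backDiff (backDiff (backDiff appell)) = fun m =>
      backDiff (backDiff (backDiff appellHead)) m +
        backDiff (backDiff (backDiff (antiExt appellTail))) m := by
    funext m
    simp only [backDiff, appell_eq]
    ring
  have hsum := hh.add ht.backDiff.backDiff.backDiff
  have hx : AdicFinite (theta (theta (theta appell))) :=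
    adicFinite_of_finite_support ((Set.finite_singleton (-2 : ℤ)).subset fun m hm => by
      by_contra h
      exact hm (theta_theta_theta_appell h))
  have e1 : biGen w (theta (theta (theta (backDiff (backDiff (backDiff appell)))))) =
      (1 - unitPow w 2) ^ 3 * (baseChange A (theta (theta (theta appell)) (-2)) *
        unitPow w (2 * (-2))) := by
    simp only [theta_backDiff]
    rw [biGen_backDiff w hx.backDiff.backDiff, biGen_backDiff w hx.backDiff, biGen_backDiff w hx,
      biGen, tsum_eq_single (-2)]
    · ring
    · intro m hm
      rw [theta_theta_theta_appell hm, map_zero, zero_mul]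
  have e2 : biGen w (theta (theta (theta (backDiff (backDiff (backDiff appell)))))) =
      (unitPow w (-1) * biTheta w) ^ 3 * (unitPow w 1 ^ 2 *
      ((1 - baseChange A eisP) * (unitPow w 1 - unitPow w (-1)) ^ 2 + 8) +
        (1 - unitPow w 2) ^ 3 * biGen w (antiExt appellTail)) := by
    rw [hsplit, biGen_theta w hsum.theta_fun.theta_fun, biGen_theta w hsum.theta_fun,
      biGen_theta w hsum, biGen_add w hh ht.backDiff.backDiff.backDiff, biGen_backDiff_appellHead,
      biGen_backDiff w ht.backDiff.backDiff, biGen_backDiff w ht.backDiff, biGen_backDiff w ht]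
    ring
  generalize theta (theta (theta appell)) (-2) = x at e1 ⊢
  rw [e1, show (2 : ℤ) = 1 + 1 by norm_num, show (1 + 1 : ℤ) * (-(1 + 1)) = -1 + -1 + (-1 + -1) by norm_num] at e2
  simp only [unitPow_add] at e2
  have h1 : 1 - unitPow w 1 * unitPow w 1 = -unitPow w 1 * (unitPow w 1 - unitPow w (-1)) := by
    linear_combination -ha
  rw [h1] at e2
  have h3 : (unitPow w (-1) * unitPow w 1) ^ 3 = 1 := by rw [ha, one_pow]
  have h4 : (unitPow w (-1) * unitPow w 1) ^ 4 = 1 := by rw [ha, one_pow]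
  linear_combination -unitPow w 1 * e2 - ((8 + (1 - baseChange A eisP) *
    (unitPow w 1 - unitPow w (-1)) ^ 2 - (unitPow w 1 - unitPow w (-1)) ^ 3 *
    (unitPow w 1 * biGen w (antiExt appellTail))) * biTheta w ^ 3) * h3 -
    (unitPow w 1 - unitPow w (-1)) ^ 3 * baseChange A x * h4

end GeneratingFunction

end SptCongruence

namespace SptCongruence

open PowerSeries PowerSeries.WithPiTopology

/-- Interchanging the two variables of an iterated power series. -/
noncomputable def swapVar {R : Type*} [CommRing R] : R⟦X⟧⟦X⟧ →+* R⟦X⟧⟦X⟧ where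
  toFun f := mk fun i => mk fun n => coeff i (coeff n f)
  map_one' := by
    ext i n
    simp only [coeff_mk, coeff_one]
    split_ifs <;> simp_all [coeff_one]
  map_mul' f g := by
    ext i n
    simp only [coeff_mk, coeff_mul, map_sum]
    rw [sum_comm]
  map_zero' := by
    ext i n
    simp
  map_add' f g := by
    ext i n
    simp

theorem coeff_coeff_swapVar {R : Type*} [CommRing R] (f : R⟦X⟧⟦X⟧) (i n : ℕ) :
    coeff n (coeff i (swapVar f)) = coeff i (coeff n f) := by
  simp [swapVar]

/-- The power series `exp (u / 2)` as a unit. -/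
noncomputable def halfExp : ℚ⟦X⟧ˣ where
  val := rescale (1 / 2) (exp ℚ)
  inv := rescale (-(1 / 2)) (exp ℚ)
  val_inv := by rw [exp_mul_exp_eq_exp_add]; simp
  inv_val := by rw [exp_mul_exp_eq_exp_add]; simp

theorem halfExp_pow (k : ℕ) : ((halfExp ^ k : ℚ⟦X⟧ˣ) : ℚ⟦X⟧) = rescale (k / 2 : ℚ) (exp ℚ) := by
  induction k with
  | zero => simp
  | succ k ih =>
    rw [pow_succ, Units.val_mul, ih, halfExp, exp_mul_exp_eq_exp_add]
    congr 2
    push_cast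
    ring

theorem inv_halfExp_pow (k : ℕ) :
    (((halfExp⁻¹) ^ k : ℚ⟦X⟧ˣ) : ℚ⟦X⟧) = rescale (-(k / 2) : ℚ) (exp ℚ) := by
  induction k with
  | zero => simp
  | succ k ih =>
    rw [pow_succ, Units.val_mul, ih, halfExp, Units.inv_mk, exp_mul_exp_eq_exp_add]
    congr 2
    push_cast
    ring

theorem coeff_halfExp_zpow_sub (k i : ℕ) :
    coeff i (((halfExp ^ (k : ℤ) : ℚ⟦X⟧ˣ) : ℚ⟦X⟧) - ((halfExp ^ (-(k : ℤ)) : ℚ⟦X⟧ˣ) : ℚ⟦X⟧)) =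
      (1 - (-1) ^ i) * (k / 2 : ℚ) ^ i / i.factorial := by
  rw [zpow_natCast, zpow_neg, zpow_natCast, ← inv_pow, halfExp_pow, inv_halfExp_pow, map_sub,
    coeff_rescale, coeff_rescale, coeff_exp, neg_pow]
  simp only [Algebra.algebraMap_self, RingHom.id_apply]
  ring

/-- The moments of a sequence of power series at odd integers. -/
noncomputable def oddMoment (F : ℕ → ℤ⟦X⟧) (p : ℕ) : ℤ⟦X⟧ :=
  ∑' m : ℕ, F m * ((2 * m + 1 : ℕ) : ℤ⟦X⟧) ^ p

/-- The normalized generating function of the odd moments. -/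
noncomputable def oddSeries (F : ℕ → ℤ⟦X⟧) : ℚ⟦X⟧⟦X⟧ :=
  mk fun i => C (1 / (4 ^ i * (2 * i + 1).factorial) : ℚ) * baseChange ℚ (oddMoment F (2 * i + 1))

theorem coeff_mul_natCast {R : Type*} [CommRing R] (f : R⟦X⟧) (k n : ℕ) :
    coeff n (f * (k : R⟦X⟧)) = coeff n f * k := by
  rw [show (k : R⟦X⟧) = C (k : R) by simp, coeff_mul_C]

theorem swapVar_tsum {F : ℕ → ℤ⟦X⟧} (hF : AdicFinite F) :
    swapVar (∑' m : ℕ, baseChange ℚ⟦X⟧ (F m) *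
      (unitPow halfExp (2 * m + 1) - unitPow halfExp (-(2 * m + 1)))) =
      X * expand 2 two_ne_zero (oddSeries F) := by
  ext i n
  have h1 : AdicFinite fun m : ℕ => baseChange ℚ⟦X⟧ (F m) *
      (unitPow halfExp (2 * m + 1) - unitPow halfExp (-(2 * m + 1))) := (hF.map _).mul_right _
  have h2 : ∀ p : ℕ, AdicFinite fun m : ℕ => F m * ((2 * m + 1 : ℕ) : ℤ⟦X⟧) ^ p := fun p =>
    hF.mul_right _
  set s := (hF.finite_coeff n).toFinset with hs
  have h0 : ∀ m ∉ s, coeff n (F m) = 0 := fun m hm => by simpa [hs] using hm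
  have e1 : ∀ m : ℕ, coeff n (baseChange ℚ⟦X⟧ (F m) *
      (unitPow halfExp (2 * m + 1) - unitPow halfExp (-(2 * m + 1)))) =
      ((coeff n (F m) : ℤ) : ℚ⟦X⟧) * (((halfExp ^ ((2 * m + 1 : ℕ) : ℤ) : ℚ⟦X⟧ˣ) : ℚ⟦X⟧) -
        ((halfExp ^ (-((2 * m + 1 : ℕ) : ℤ)) : ℚ⟦X⟧ˣ) : ℚ⟦X⟧)) := fun m => by
    rw [unitPow, unitPow, ← map_sub, coeff_mul_C, coeff_map]
    push_cast
    rfl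
  rw [coeff_coeff_swapVar, coeff_tsum h1.summable, tsum_eq_sum (s := s), map_sum]
  · rcases Nat.even_or_odd' i with ⟨j, rfl | rfl⟩
    · have : coeff (2 * j) (X * expand 2 two_ne_zero (oddSeries F)) = 0 := by
        rcases j with - | j
        · simp
        · rw [show 2 * (j + 1) = 2 * j + 1 + 1 by ring, coeff_succ_X_mul,
            coeff_expand_of_not_dvd _ _ _ (by omega)]
      rw [this, map_zero]
      refine sum_eq_zero fun m _ => ?_
      rw [e1, show ((coeff n (F m) : ℤ) : ℚ⟦X⟧) = C ((coeff n (F m) : ℤ) : ℚ) by simp, coeff_C_mul,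
        coeff_halfExp_zpow_sub]
      simp
    · rw [coeff_succ_X_mul, coeff_expand_mul, oddSeries, coeff_mk, coeff_C_mul, coeff_map, oddMoment,
        coeff_tsum (h2 _).summable, tsum_eq_sum (s := s), map_sum, mul_sum]
      · refine sum_congr rfl fun m _ => ?_
        rw [e1, show ((coeff n (F m) : ℤ) : ℚ⟦X⟧) = C ((coeff n (F m) : ℤ) : ℚ) by simp, coeff_C_mul,
          coeff_halfExp_zpow_sub, ← Nat.cast_pow, coeff_mul_natCast]
        have : (4 : ℚ) ^ j * 2 = 2 ^ (2 * j + 1) := by rw [pow_succ, pow_mul]; norm_num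
        rw [pow_succ (-1 : ℚ), pow_mul, div_pow, ← this]
        simp only [eq_intCast]
        push_cast
        field_simp
        norm_num
      · intro m hm
        rw [← Nat.cast_pow, coeff_mul_natCast, h0 m hm, zero_mul]
  · intro m hm
    rw [e1, h0 m hm, Int.cast_zero, zero_mul]

/-- The coefficients of Jacobi's series. -/
noncomputable def jacobiTerm (n : ℕ) : ℤ⟦X⟧ := X ^ tri n * (sgn n : ℤ⟦X⟧)

theorem adicFinite_jacobiTerm : AdicFinite jacobiTerm :=
  (adicFinite_X_pow_tri.comp (e := fun n : ℕ => (n : ℤ)) Nat.cast_injective).mul_right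
    fun n : ℕ => (sgn n : ℤ⟦X⟧)

theorem swapVar_map {f : ℤ⟦X⟧} : swapVar (baseChange ℚ⟦X⟧ f) = C (baseChange ℚ f) := by
  ext i n
  rw [coeff_coeff_swapVar, coeff_map, coeff_C]
  split_ifs with h
  · simp [h]
  · rw [eq_intCast, show ((coeff n f : ℤ) : ℚ⟦X⟧) = C ((coeff n f : ℤ) : ℚ) by simp, coeff_C, if_neg h]
    simp

theorem tsum_int_eq_tsum_nat {A : Type*} [CommRing A] [TopologicalSpace A] [IsTopologicalRing A]
    [T2Space A] {F : ℤ → A⟦X⟧} (hF : AdicFinite F) :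
    ∑' m, F m = ∑' m : ℕ, (F m + F (-((m : ℤ) + 1))) := by
  have h1 : Summable fun m : ℕ => F m := (hF.comp Nat.cast_injective).summable
  have h2 : Summable fun m : ℕ => F (-((m : ℤ) + 1)) :=
    (hF.comp (e := fun m : ℕ => -((m : ℤ) + 1)) fun a b h => by
      simp only at h; omega).summable
  rw [tsum_of_nat_of_neg_add_one h1 h2, h1.tsum_add h2]

/-- `2 sinh (u / 2) / u` as a series in `t = u ^ 2`. -/
noncomputable def sinhSer : ℚ⟦X⟧⟦X⟧ := mk fun i => C (1 / (4 ^ i * (2 * i + 1).factorial) : ℚ)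

theorem swapVar_sinh :
    swapVar (unitPow halfExp 1 - unitPow halfExp (-1)) = X * expand 2 two_ne_zero sinhSer := by
  have hF : AdicFinite fun m : ℕ => if m = 0 then (1 : ℤ⟦X⟧) else 0 :=
    adicFinite_of_finite_support ((Set.finite_singleton 0).subset fun m hm => by
      by_contra h
      exact hm (if_neg h))
  have h := swapVar_tsum hF
  rw [tsum_eq_single 0 (fun m hm => by rw [if_neg hm, map_zero, zero_mul])] at h
  simp only [if_true, map_one, one_mul, Nat.cast_zero, mul_zero, zero_add] at h
  rw [h]
  congr 2
  ext1 i
  rw [oddSeries, sinhSer, coeff_mk, coeff_mk, oddMoment,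
    tsum_eq_single 0 (fun m hm => by rw [if_neg hm, zero_mul])]
  simp

theorem swapVar_biTheta :
    swapVar (biTheta halfExp) = X * expand 2 two_ne_zero (oddSeries jacobiTerm) := by
  rw [← swapVar_tsum adicFinite_jacobiTerm, biTheta,
    tsum_int_eq_tsum_nat (adicFinite_X_pow_tri.mul_right _)]
  refine congrArg _ (tsum_congr fun m => ?_)
  rw [show -((m : ℤ) + 1) = -1 - m by ring, tri_neg_one_sub, sgn_neg_one_sub, jacobiTerm,
    show 2 * (-1 - (m : ℤ)) + 1 = -(2 * m + 1) by ring]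
  simp only [map_mul, map_pow, map_X, map_intCast, Int.cast_neg]
  ring

theorem swapVar_biGen {F : ℕ → ℤ⟦X⟧} (hF : AdicFinite F) :
    swapVar (unitPow halfExp 1 * biGen halfExp (antiExt F)) =
      X * expand 2 two_ne_zero (oddSeries F) := by
  rw [← swapVar_tsum hF, biGen, ← (summable_biGen halfExp hF.antiExt).tsum_mul_left,
    tsum_int_eq_tsum_nat (((hF.antiExt.map _).mul_right _).mul_left _)]
  refine congrArg _ (tsum_congr fun m => ?_)
  rw [antiExt_natCast, antiExt_neg_natCast_add_one, unitPow_add,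
    show -(2 * (m : ℤ) + 1) = 1 + 2 * -((m : ℤ) + 1) by ring, unitPow_add]
  simp only [map_neg]
  ring

theorem expand_injective {R : Type*} [CommRing R] :
    Function.Injective (expand 2 two_ne_zero : R⟦X⟧ →ₐ[R] R⟦X⟧) := fun f g h => by
  ext i
  rw [← coeff_expand_mul 2 two_ne_zero f i, h, coeff_expand_mul]

theorem oddSeries_identity :
    (8 + X * C (1 - baseChange ℚ eisP) * sinhSer ^ 2 - X ^ 2 * sinhSer ^ 3 * oddSeries appellTail) *
        oddSeries jacobiTerm ^ 3 =
      -sinhSer ^ 3 * C (baseChange ℚ (theta (theta (theta appell)) (-2))) := by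
  have h := biGen_identity halfExp
  have hS := swapVar_sinh
  have hT := swapVar_biTheta
  have hE := swapVar_biGen adicFinite_appellTail_fun
  have hP := swapVar_map (f := eisP)
  have hx := swapVar_map (f := theta (theta (theta appell)) (-2))
  generalize unitPow halfExp 1 - unitPow halfExp (-1) = S at h hS
  generalize biTheta halfExp = T at h hT
  generalize unitPow halfExp 1 * biGen halfExp (antiExt appellTail) = E at h hE
  generalize baseChange ℚ⟦X⟧ eisP = P at h hP
  generalize baseChange ℚ⟦X⟧ (theta (theta (theta appell)) (-2)) = x at h hx
  have h2 := congrArg swapVar h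
  simp only [map_mul, map_pow, map_neg, map_add, map_one, map_ofNat, map_sub, hS, hT, hE, hP,
    hx] at h2
  apply expand_injective
  have h3 : (X : ℚ⟦X⟧⟦X⟧) ^ 3 ≠ 0 := pow_ne_zero _ X_ne_zero
  apply mul_left_cancel₀ h3
  simp only [map_mul, map_pow, map_neg, map_add, map_one, map_ofNat, map_sub, expand_X, expand_C]
  linear_combination h2

end SptCongruence

namespace SptCongruence

open PowerSeries PowerSeries.WithPiTopology

theorem two_mul_pentExp (ρ : ℕ) : 2 * pentExp ρ = (ρ + 1) * (3 * ρ + 2) := by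
  induction ρ with
  | zero => rfl
  | succ ρ ih =>
    rw [pentExp_succ]
    linarith

theorem oddMoment_appellTail (p : ℕ) :
    oddMoment appellTail p = 24 * qD (lerch p) - eisP * lerch p + lerch (p + 2) := by
  have hl : ∀ j : ℕ, AdicFinite fun p : ℕ × ℕ => (-1) ^ (p.1 + 1) *
      ((2 * p.2 + 1 : ℕ) : ℤ⟦X⟧) ^ j * X ^ (pentExp p.1 + (p.1 + 1) * (p.2 + 1)) := fun j =>
    adicFinite_lerchExp.mul_left _
  have h1 : qD (lerch p) = ∑' a : ℕ × ℕ, ((pentExp a.1 + (a.1 + 1) * (a.2 + 1) : ℕ) : ℤ⟦X⟧) *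
      ((-1) ^ (a.1 + 1) * ((2 * a.2 + 1 : ℕ) : ℤ⟦X⟧) ^ p *
        X ^ (pentExp a.1 + (a.1 + 1) * (a.2 + 1))) := by
    rw [lerch, qD_tsum (hl p)]
    refine tsum_congr fun a => ?_
    have h := qD_X_pow_mul_intCast (R := ℤ) (pentExp a.1 + (a.1 + 1) * (a.2 + 1))
      ((-1) ^ (a.1 + 1) * ((2 * a.2 + 1 : ℕ) : ℤ) ^ p)
    push_cast at h ⊢
    rw [mul_comm, h]
  have h2 : oddMoment appellTail p = ∑' m : ℕ, ∑' ρ : ℕ, X ^ (pentExp ρ + (ρ + 1) * (m + 1)) *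
      ((-1) ^ (ρ + 1) * quadP ((m + 3 * ρ + 3 : ℕ) : ℤ)) * ((2 * m + 1 : ℕ) : ℤ⟦X⟧) ^ p := by
    rw [oddMoment]
    refine tsum_congr fun m => ?_
    rw [appellTail, ← ((adicFinite_appellTail m).mul_right _).summable.tsum_mul_right]
  have h3 : AdicFinite fun a : ℕ × ℕ => X ^ (pentExp a.1 + (a.1 + 1) * (a.2 + 1)) *
      ((-1) ^ (a.1 + 1) * quadP ((a.2 + 3 * a.1 + 3 : ℕ) : ℤ)) *
        ((2 * a.2 + 1 : ℕ) : ℤ⟦X⟧) ^ p := (adicFinite_lerchExp.mul_right _).mul_right _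
  rw [h2, ← tsum_comm_of_adicFinite (H := fun ρ m : ℕ => X ^ (pentExp ρ + (ρ + 1) * (m + 1)) *
      ((-1) ^ (ρ + 1) * quadP ((m + 3 * ρ + 3 : ℕ) : ℤ)) * ((2 * m + 1 : ℕ) : ℤ⟦X⟧) ^ p) h3,
    ← h3.summable.tsum_prod' fun ρ => (h3.comp (Prod.mk_right_injective ρ)).summable, h1, lerch, lerch,
    ← ((hl p).mul_left _).summable.tsum_mul_left, ← (hl p).summable.tsum_mul_left,
    ← ((((hl p).mul_left _).mul_left _).summable).tsum_sub ((hl p).mul_left _).summable,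
    ← (((((hl p).mul_left _).mul_left _).sub ((hl p).mul_left _)).summable).tsum_add
      (hl (p + 2)).summable]
  refine tsum_congr fun a => ?_
  have h4 : 24 * ((pentExp a.1 + (a.1 + 1) * (a.2 + 1) : ℕ) : ℤ⟦X⟧) +
      ((2 * a.2 + 1 : ℕ) : ℤ⟦X⟧) ^ 2 = (2 * ((a.2 + 3 * a.1 + 3 : ℕ) : ℤ⟦X⟧) + 1) ^ 2 := by
    have h5 : 2 * pentExp a.1 = (a.1 + 1) * (3 * a.1 + 2) := two_mul_pentExp _
    have h6 : 24 * (pentExp a.1 + (a.1 + 1) * (a.2 + 1)) + (2 * a.2 + 1) ^ 2 =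
      (2 * (a.2 + 3 * a.1 + 3) + 1) ^ 2 := by nlinarith
    exact_mod_cast congrArg (Nat.cast : ℕ → ℤ⟦X⟧) h6
  rw [quadP, Int.cast_natCast, pow_add _ p 2]
  linear_combination -(-1) ^ (a.1 + 1) * ((2 * a.2 + 1 : ℕ) : ℤ⟦X⟧) ^ p *
        X ^ (pentExp a.1 + (a.1 + 1) * (a.2 + 1)) * h4

theorem qD_oddMoment_jacobiTerm (p : ℕ) :
    8 * qD (oddMoment jacobiTerm p) + oddMoment jacobiTerm p = oddMoment jacobiTerm (p + 2) := by
  have hF : ∀ p, AdicFinite fun m : ℕ => jacobiTerm m * ((2 * m + 1 : ℕ) : ℤ⟦X⟧) ^ p := fun p =>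
    adicFinite_jacobiTerm.mul_right _
  have hq : ∀ m : ℕ, qD (jacobiTerm m * ((2 * m + 1 : ℕ) : ℤ⟦X⟧) ^ p) =
      (tri m : ℤ⟦X⟧) * (jacobiTerm m * ((2 * m + 1 : ℕ) : ℤ⟦X⟧) ^ p) := fun m => by
    have h := qD_X_pow_mul_intCast (R := ℤ) (tri m) (sgn m * ((2 * m + 1 : ℕ) : ℤ) ^ p)
    rw [jacobiTerm]
    push_cast at h ⊢
    rw [mul_assoc, h]
  have hF2 : AdicFinite fun m : ℕ => (tri m : ℤ⟦X⟧) *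
      (jacobiTerm m * ((2 * m + 1 : ℕ) : ℤ⟦X⟧) ^ p) := (hF p).mul_left _
  rw [oddMoment, qD_tsum (hF p), tsum_congr hq, ← hF2.summable.tsum_mul_left,
    ← Summable.tsum_add (hF2.mul_left fun _ => 8).summable (hF p).summable]
  refine tsum_congr fun m => ?_
  have h := two_mul_tri m
  have h2 : 8 * (tri m : ℤ⟦X⟧) + 1 = ((2 * m + 1 : ℕ) : ℤ⟦X⟧) ^ 2 := by
    have h3 : 8 * tri m + 1 = (2 * m + 1) ^ 2 := by zify; linarith
    exact_mod_cast congrArg (Nat.cast : ℕ → ℤ⟦X⟧) h3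
  rw [pow_add, ← h2]
  ring

theorem constantCoeff_oddMoment_jacobiTerm (p : ℕ) :
    constantCoeff (oddMoment jacobiTerm p) = 1 := by
  have hF : AdicFinite fun m : ℕ => jacobiTerm m * ((2 * m + 1 : ℕ) : ℤ⟦X⟧) ^ p :=
    adicFinite_jacobiTerm.mul_right _
  rw [← coeff_zero_eq_constantCoeff_apply, oddMoment, coeff_tsum hF.summable, tsum_eq_single 0]
  · simp [jacobiTerm, sgn_zero, tri]
  · intro m hm
    have h1 : tri m ≠ 0 := fun h => by
      have := two_mul_tri m
      rw [h, Nat.cast_zero, mul_zero] at this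
      have h4 : (0 : ℤ) < m := by omega
      nlinarith
    rw [coeff_zero_eq_constantCoeff_apply, jacobiTerm, map_mul, map_mul, map_pow, constantCoeff_X,
      zero_pow h1]
    ring

end SptCongruence

namespace SptCongruence

open PowerSeries PowerSeries.WithPiTopology

section Hyperbolic

/-- `2 sinh (u / 2) / u` as a series in `t = u ^ 2` with rational coefficients. -/
noncomputable def sinhQ : ℚ⟦X⟧ := mk fun i => 1 / (4 ^ i * (2 * i + 1).factorial)

/-- `cosh (u / 2)` as a series in `t = u ^ 2`. -/
noncomputable def coshQ : ℚ⟦X⟧ := mk fun i => 1 / (4 ^ i * (2 * i).factorial)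

theorem qD_sinhQ : 2 * qD sinhQ + sinhQ = coshQ := by
  ext i
  have h2 : (2 : ℚ⟦X⟧) = C 2 := (map_ofNat C 2).symm
  rw [map_add, h2, coeff_C_mul, coeff_qD, sinhQ, coshQ, coeff_mk, coeff_mk, Nat.factorial_succ]
  push_cast
  have : (2 * (i : ℚ) + 1) ≠ 0 := by positivity
  field_simp

theorem qD_coshQ : 8 * qD coshQ = X * sinhQ := by
  ext i
  have h2 : (8 : ℚ⟦X⟧) = C 8 := (map_ofNat C 8).symm
  rw [h2, coeff_C_mul, coeff_qD, coshQ, coeff_mk]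
  rcases i with - | i
  · simp
  · rw [coeff_succ_X_mul, sinhQ, coeff_mk, show 2 * (i + 1) = 2 * i + 1 + 1 by ring,
      Nat.factorial_succ (2 * i + 1)]
    push_cast
    have : (2 * (i : ℚ) + 1 + 1) ≠ 0 := by positivity
    field_simp
    ring

theorem constantCoeff_sinhQ : constantCoeff sinhQ = 1 := by
  rw [← coeff_zero_eq_constantCoeff_apply, sinhQ, coeff_mk]; simp

theorem constantCoeff_coshQ : constantCoeff coshQ = 1 := by
  rw [← coeff_zero_eq_constantCoeff_apply, coshQ, coeff_mk]; simp

theorem eq_C_of_qD_eq_zero {f : ℚ⟦X⟧} (h : qD f = 0) : f = C (constantCoeff f) := by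
  ext i
  rw [coeff_C]
  split_ifs with hi
  · rw [hi, coeff_zero_eq_constantCoeff_apply]
  · have := coeff_qD f i
    rw [h, map_zero] at this
    rcases mul_eq_zero.1 this.symm with h' | h'
    · exact absurd (Nat.cast_eq_zero.1 h') hi
    · exact h'

theorem qD_X {R : Type*} [CommRing R] : qD (X : R⟦X⟧) = X := by
  simp [qD]

theorem qD_natCast {R : Type*} [CommRing R] (n : ℕ) : qD (n : R⟦X⟧) = 0 := by
  simp

theorem coshQ_sq : 4 * coshQ ^ 2 = 4 + X * sinhQ ^ 2 := by
  have h4 : qD (4 : ℚ⟦X⟧) = 0 := by simpa using qD_natCast (R := ℚ) 4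
  have h : qD (4 * coshQ ^ 2 - X * sinhQ ^ 2) = 0 := by
    rw [map_sub, qD_mul, qD_mul, qD_X, qD_pow, qD_pow, h4]
    have h1 := qD_sinhQ
    have h2 := qD_coshQ
    push_cast
    linear_combination coshQ * h2 - X * sinhQ * h1
  have hsub := eq_C_of_qD_eq_zero h
  have : constantCoeff (4 * coshQ ^ 2 - X * sinhQ ^ 2) = 4 := by
    simp [constantCoeff_coshQ, map_ofNat constantCoeff 4]
  rw [this] at hsub
  rw [map_ofNat C 4] at hsub
  linear_combination hsub

/-- The negative reciprocal of `sinhQ`. -/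
noncomputable def cschQ : ℚ⟦X⟧ := -sinhQ⁻¹

theorem sinhQ_mul_cschQ : sinhQ * cschQ = -1 := by
  rw [cschQ, mul_neg, PowerSeries.mul_inv_cancel _ (by rw [constantCoeff_sinhQ]; exact one_ne_zero)]

theorem cschQ_ode :
    16 * qD (qD cschQ) - 24 * qD cschQ + 8 * cschQ = 8 * cschQ ^ 3 + X * cschQ := by
  have h1 := sinhQ_mul_cschQ
  have h2 : 2 * qD cschQ = coshQ * cschQ ^ 2 + cschQ := by
    have h := congrArg qD h1
    rw [map_neg, qD_mul, show qD (1 : ℚ⟦X⟧) = 0 by simp] at h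
    linear_combination -2 * cschQ * h + 2 * qD cschQ * h1 + cschQ ^ 2 * qD_sinhQ - cschQ * h1
  have h3 := congrArg qD h2
  rw [map_add, qD_mul, qD_mul, qD_pow, show qD (2 : ℚ⟦X⟧) = 0 by simpa using qD_natCast (R := ℚ) 2]
    at h3
  push_cast at h3
  linear_combination 8 * h3 + (8 * coshQ * cschQ - 8) * h2 + cschQ ^ 2 * qD_coshQ +
    X * cschQ * h1 + 2 * cschQ ^ 3 * coshQ_sq + 2 * X * cschQ * (sinhQ * cschQ - 1) * h1

end Hyperbolic

end SptCongruence

namespace SptCongruence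

open PowerSeries PowerSeries.WithPiTopology

section CoefficientDerivation

variable {R : Type*} [CommRing R]

/-- The derivation `q d/dq` acting on the coefficients of a power series in a second variable. -/
noncomputable def cD : Derivation R R⟦X⟧⟦X⟧ R⟦X⟧⟦X⟧ :=
  Derivation.mk'
    { toFun := fun f => mk fun i => qD (coeff i f)
      map_add' := fun f g => by ext1 i; simp
      map_smul' := fun r f => by
        ext1 i
        simp only [coeff_mk, coeff_smul, RingHom.id_apply]
        exact Derivation.map_smul _ _ _ }
    fun f g => by
      ext1 i
      simp only [LinearMap.coe_mk, AddHom.coe_mk, coeff_mk, coeff_mul, map_sum, map_add,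
        Derivation.leibniz, smul_eq_mul, sum_add_distrib]
      refine congrArg₂ (· + ·) rfl ?_
      rw [← Finset.Nat.sum_antidiagonal_swap]
      rfl

theorem coeff_cD (f : R⟦X⟧⟦X⟧) (i : ℕ) : coeff i (cD f) = qD (coeff i f) := by
  rw [show cD f = mk fun i => qD (coeff i f) from rfl, coeff_mk]

theorem cD_C (f : R⟦X⟧) : cD (C f) = C (qD f) := by
  ext1 i
  rw [coeff_cD, coeff_C, coeff_C]
  split_ifs <;> simp

theorem cD_X : cD (X : R⟦X⟧⟦X⟧) = 0 := by
  ext1 i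
  rw [coeff_cD, coeff_X]
  split_ifs <;> simp

theorem cD_map_C (f : R⟦X⟧) : cD (PowerSeries.map (C : R →+* R⟦X⟧) f) = 0 := by
  ext1 i
  rw [coeff_cD, coeff_map, map_zero]
  have h : (C (coeff i f) : R⟦X⟧) = (coeff i f) • 1 := by rw [smul_eq_C_mul, mul_one]
  rw [h, Derivation.map_smul]
  simp

theorem cD_mul (f g : R⟦X⟧⟦X⟧) : cD (f * g) = f * cD g + g * cD f := by
  simp [Derivation.leibniz]

theorem qD_C {S : Type*} [CommRing S] (a : S) : qD (C a : S⟦X⟧) = 0 := by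
  have h : (C a : S⟦X⟧) = a • 1 := by rw [smul_eq_C_mul, mul_one]
  rw [h, Derivation.map_smul]
  simp

end CoefficientDerivation

/-- The quasimodular Eisenstein series with rational coefficients. -/
noncomputable def eisPQ : ℚ⟦X⟧ := baseChange ℚ eisP

/-- `lerch` with rational coefficients. -/
noncomputable def lerchQ (p : ℕ) : ℚ⟦X⟧ := baseChange ℚ (lerch p)

/-- The theta moments with rational coefficients. -/
noncomputable def thetaQ (p : ℕ) : ℚ⟦X⟧ := baseChange ℚ (oddMoment jacobiTerm p)

/-- The quotient of a theta moment by the first one. -/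
noncomputable def thetaQuot (i : ℕ) : ℚ⟦X⟧ := thetaQ (2 * i + 1) * (thetaQ 1)⁻¹

theorem thetaQ_mul_inv : thetaQ 1 * (thetaQ 1)⁻¹ = 1 := by
  refine PowerSeries.mul_inv_cancel _ ?_
  rw [thetaQ, ← coeff_zero_eq_constantCoeff_apply, coeff_map, coeff_zero_eq_constantCoeff_apply,
    constantCoeff_oddMoment_jacobiTerm]
  simp

/-- The coefficients `1 / (4 ^ i (2 i + 1)!)`. -/
noncomputable def sinhCoeff (i : ℕ) : ℚ := 1 / (4 ^ i * (2 * i + 1).factorial)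

theorem sinhCoeff_succ (i : ℕ) :
    4 * (2 * (i + 1) + 1) * (2 * (i + 1)) * sinhCoeff (i + 1) = sinhCoeff i := by
  rw [sinhCoeff, sinhCoeff, show 2 * (i + 1) + 1 = 2 * i + 1 + 1 + 1 by ring,
    Nat.factorial_succ (2 * i + 1 + 1), Nat.factorial_succ (2 * i + 1)]
  have h1 : (2 * (i : ℚ) + 1 + 1) ≠ 0 := by positivity
  have h2 : (2 * (i : ℚ) + 1 + 1 + 1) ≠ 0 := by positivity
  push_cast
  field_simp
  ring

/-- The normalized theta moments. -/
noncomputable def ySer : ℚ⟦X⟧⟦X⟧ := mk fun i => C (sinhCoeff i) * thetaQuot i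

/-- The generating function of the series `lerchQ`. -/
noncomputable def lerchSer : ℚ⟦X⟧⟦X⟧ := mk fun i => C (sinhCoeff i) * lerchQ (2 * i + 1)

/-- `cschQ` with coefficients viewed as constant power series. -/
noncomputable def cschSer : ℚ⟦X⟧⟦X⟧ := PowerSeries.map C cschQ

/-- The generating function of quasi-mock Eisenstein series. -/
noncomputable def alphaSer : ℚ⟦X⟧⟦X⟧ := cschSer + X * lerchSer

/-- The modular companion of `alphaSer`. -/
noncomputable def betaSer : ℚ⟦X⟧⟦X⟧ :=
  8 * cschSer ^ 3 + X * C (1 - eisPQ) * cschSer + X ^ 2 * oddSeries appellTail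

theorem sinhSer_eq : sinhSer = PowerSeries.map C sinhQ := by
  ext1 i
  rw [sinhSer, sinhQ, coeff_map, coeff_mk, coeff_mk]

theorem sinhSer_mul_cschSer : sinhSer * cschSer = -1 := by
  rw [sinhSer_eq, cschSer, ← map_mul, sinhQ_mul_cschQ, map_neg, map_one]

theorem oddSeries_jacobiTerm : oddSeries jacobiTerm = ySer * C (thetaQ 1) := by
  ext1 i
  rw [coeff_mul_C, oddSeries, ySer, coeff_mk, coeff_mk, thetaQuot, sinhCoeff, ← thetaQ]
  linear_combination -C (1 / (4 ^ i * ((2 * i + 1).factorial : ℚ))) * thetaQ (2 * i + 1) * thetaQ_mul_inv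

theorem constantCoeff_ySer : constantCoeff ySer = 1 := by
  rw [← coeff_zero_eq_constantCoeff_apply, ySer, coeff_mk, thetaQuot, mul_zero, zero_add,
    thetaQ_mul_inv]
  simp [sinhCoeff]

theorem thetaQ_ne_zero : thetaQ 1 ≠ 0 := fun h => by
  have := thetaQ_mul_inv
  rw [h, zero_mul] at this
  exact zero_ne_one this

theorem betaSer_mul_ySer_pow : betaSer * ySer ^ 3 = -8 := by
  have h := oddSeries_identity
  rw [oddSeries_jacobiTerm] at h
  have hs := sinhSer_mul_cschSer
  have hx : C (baseChange ℚ (theta (theta (theta appell)) (-2))) = -8 * C (thetaQ 1) ^ 3 := by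
    have h0 := congrArg constantCoeff h
    have h1 : constantCoeff sinhSer = 1 := by
      rw [← coeff_zero_eq_constantCoeff_apply, sinhSer, coeff_mk]
      simp
    simp only [map_mul, map_add, map_sub, map_pow, map_neg, constantCoeff_X, constantCoeff_C, h1,
      constantCoeff_ySer, map_ofNat constantCoeff 8] at h0
    rw [← map_pow, show (-8 : ℚ⟦X⟧⟦X⟧) = C (-8) by rw [map_neg, map_ofNat], ← map_mul]
    congr 1
    linear_combination h0
  rw [hx] at h
  have h3 : C (thetaQ 1) ^ 3 ≠ 0 := pow_ne_zero _ fun h => thetaQ_ne_zero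
    ((map_eq_zero_iff C (C_injective)).1 h)
  apply mul_right_cancel₀ h3
  rw [betaSer]
  have hP : C (1 - baseChange ℚ eisP) = C (1 - eisPQ) := rfl
  rw [hP] at h
  have hs2 : sinhSer ^ 2 * cschSer ^ 3 = cschSer := by
    linear_combination cschSer * (sinhSer * cschSer - 1) * hs
  have hs3 : sinhSer ^ 3 * cschSer ^ 3 = -1 := by
    linear_combination ((sinhSer * cschSer) ^ 2 - sinhSer * cschSer + 1) * hs
  linear_combination cschSer ^ 3 * h + (-(X * C (1 - eisPQ) * hs2) +
    (X ^ 2 * oddSeries appellTail) * hs3) * (ySer * C (thetaQ 1)) ^ 3 + 8 * C (thetaQ 1) ^ 3 * hs3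

theorem cschSer_ode :
    16 * qD (qD cschSer) - 24 * qD cschSer + 8 * cschSer = 8 * cschSer ^ 3 + X * cschSer := by
  have h := congrArg (PowerSeries.map (C : ℚ →+* ℚ⟦X⟧)) cschQ_ode
  simp only [map_add, map_sub, map_mul, map_pow, map_ofNat, map_X, map_qD] at h
  exact h

theorem oddSeries_appellTail :
    X * oddSeries appellTail = X * (24 * cD lerchSer - C eisPQ * lerchSer) +
      (16 * qD (qD lerchSer) + 8 * qD lerchSer) := by
  ext1 i
  have h24 : (24 : ℚ⟦X⟧⟦X⟧) = C 24 := (map_ofNat C 24).symm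
  have h16 : (16 : ℚ⟦X⟧⟦X⟧) = C 16 := (map_ofNat C 16).symm
  have h8 : (8 : ℚ⟦X⟧⟦X⟧) = C 8 := (map_ofNat C 8).symm
  rw [h24, h16, h8]
  rcases i with - | i
  · simp only [map_add, coeff_C_mul, coeff_qD, coeff_zero_X_mul]
    simp
  · simp only [map_add, map_sub, coeff_C_mul, coeff_qD, coeff_succ_X_mul, coeff_cD]
    rw [lerchSer, coeff_mk, coeff_mk, oddSeries, coeff_mk, oddMoment_appellTail, qD_mul, qD_C,
      ← sinhCoeff, ← sinhCoeff_succ i]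
    simp only [map_add, map_sub, map_mul, map_ofNat, map_qD, map_one, map_natCast]
    rw [← lerchQ, ← lerchQ, ← eisPQ]
    push_cast
    rw [show 2 * (i + 1) + 1 = 2 * i + 1 + 2 by ring]
    ring

theorem betaSer_eq :
    betaSer = 16 * qD (qD alphaSer) - 24 * qD alphaSer + 8 * alphaSer +
      X * (24 * cD alphaSer - C eisPQ * alphaSer) := by
  have h0 : cD cschSer = 0 := cD_map_C _
  rw [betaSer, alphaSer]
  simp only [map_add, qD_mul, cD_mul, qD_X, cD_X, h0, map_sub, map_one]
  linear_combination -cschSer_ode + X * oddSeries_appellTail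

theorem thetaQ_ode (p : ℕ) : 8 * qD (thetaQ p) + thetaQ p = thetaQ (p + 2) := by
  have h := congrArg (baseChange ℚ) (qD_oddMoment_jacobiTerm p)
  simp only [map_add, map_mul, map_ofNat, map_qD] at h
  exact h

theorem thetaQuot_succ (i : ℕ) :
    thetaQuot (i + 1) = 8 * qD (thetaQuot i) + thetaQuot 1 * thetaQuot i := by
  have h1 := thetaQ_mul_inv
  have h2 := congrArg qD h1
  rw [qD_mul, show qD (1 : ℚ⟦X⟧) = 0 by simp] at h2
  have e1 := thetaQ_ode 1
  have e2 := thetaQ_ode (2 * i + 1)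
  rw [thetaQuot, thetaQuot, thetaQuot, show 2 * (i + 1) + 1 = 2 * i + 1 + 2 by ring, ← e2,
    show 2 * 1 + 1 = 1 + 2 by ring, ← e1, qD_mul]
  generalize thetaQ 1 = h at *
  generalize thetaQ (2 * i + 1) = g at *
  linear_combination (-8 * g * h⁻¹) * h2 + (8 * g * qD h⁻¹ - g * h⁻¹) * h1

theorem thetaQuot_one : thetaQuot 1 = eisPQ := by
  have h := congrArg (coeff 1) betaSer_mul_ySer_pow
  have hc0 : constantCoeff cschSer = -1 := by
    have h0 := congrArg constantCoeff sinhSer_mul_cschSer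
    rw [sinhSer_eq, map_mul, ← coeff_zero_eq_constantCoeff_apply, coeff_map,
      coeff_zero_eq_constantCoeff_apply, constantCoeff_sinhQ] at h0
    simpa using h0
  have ha0 : constantCoeff alphaSer = -1 := by
    rw [alphaSer]
    simp [hc0]
  have hb0 : constantCoeff betaSer = -8 := by
    rw [betaSer]
    have h8 : constantCoeff (8 : ℚ⟦X⟧⟦X⟧) = 8 := map_ofNat _ 8
    simp [hc0, h8]
    norm_num
  have hb1 : coeff 1 betaSer = eisPQ := by
    rw [betaSer_eq]
    have h24 : (24 : ℚ⟦X⟧⟦X⟧) = C 24 := (map_ofNat C 24).symm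
    have h16 : (16 : ℚ⟦X⟧⟦X⟧) = C 16 := (map_ofNat C 16).symm
    have h8 : (8 : ℚ⟦X⟧⟦X⟧) = C 8 := (map_ofNat C 8).symm
    rw [h24, h16, h8, show 1 = 0 + 1 from rfl, map_add, coeff_succ_X_mul]
    simp only [map_add, map_sub, coeff_C_mul, coeff_qD, coeff_cD]
    rw [coeff_zero_eq_constantCoeff_apply, ha0]
    simp
    ring
  rw [coeff_one_mul, coeff_one_pow, hb0, hb1, map_pow, constantCoeff_ySer] at h
  have h8 : coeff 1 (-8 : ℚ⟦X⟧⟦X⟧) = 0 := by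
    rw [map_neg, ← map_ofNat C 8, coeff_C, if_neg one_ne_zero, neg_zero]
  have hy : coeff 1 ySer = C (1 / 24) * thetaQuot 1 := by
    rw [ySer, coeff_mk, sinhCoeff]
    norm_num [Nat.factorial]
  have h24 : (C (1 / 24 : ℚ) : ℚ⟦X⟧) * 24 = 1 := by
    rw [← map_ofNat C 24, ← map_mul]; norm_num
  rw [h8, hy] at h
  push_cast at h
  linear_combination -h - thetaQuot 1 * h24

end SptCongruence

namespace SptCongruence

open PowerSeries PowerSeries.WithPiTopology

section Exponential

/-- The exponential series `exp (a t)`. -/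
noncomputable def expSer (a : ℚ⟦X⟧) : ℚ⟦X⟧⟦X⟧ := rescale a (exp ℚ⟦X⟧)

theorem coeff_expSer (a : ℚ⟦X⟧) (n : ℕ) : coeff n (expSer a) = C (1 / (n.factorial : ℚ)) * a ^ n := by
  rw [expSer, coeff_rescale, coeff_exp, mul_comm]
  rfl

theorem expSer_mul_neg (a : ℚ⟦X⟧) : expSer a * expSer (-a) = 1 := by
  rw [expSer, expSer, exp_mul_exp_eq_exp_add, add_neg_cancel]
  simp

theorem expSer_pow (a : ℚ⟦X⟧) (n : ℕ) : expSer a ^ n = expSer (n * a) := by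
  rw [expSer, expSer, ← map_pow, exp_pow_eq_rescale_exp, rescale_rescale]

theorem qD_expSer (a : ℚ⟦X⟧) : qD (expSer a) = C a * X * expSer a := by
  ext1 n
  rw [coeff_qD, coeff_expSer, mul_assoc, coeff_C_mul]
  rcases n with - | n
  · simp
  · rw [coeff_succ_X_mul, coeff_expSer, ← map_natCast (C (R := ℚ)), Nat.factorial_succ, ← mul_assoc,
      ← map_mul, pow_succ']
    have : ((n + 1 : ℕ) : ℚ) * (1 / ((n + 1) * n.factorial : ℕ)) = 1 / (n.factorial : ℚ) := by
      push_cast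
      field_simp
    rw [this]
    ring

theorem cD_expSer (a : ℚ⟦X⟧) : cD (expSer a) = C (qD a) * X * expSer a := by
  ext1 n
  rw [coeff_cD, coeff_expSer, mul_assoc, coeff_C_mul, qD_mul, qD_C, qD_pow]
  rcases n with - | n
  · simp
  · rw [coeff_succ_X_mul, coeff_expSer, ← map_natCast (C (R := ℚ)), Nat.factorial_succ,
      Nat.add_sub_cancel]
    have : (C ((n + 1 : ℕ) : ℚ) : ℚ⟦X⟧) * C (1 / (((n + 1) * n.factorial : ℕ) : ℚ)) =
        C (1 / (n.factorial : ℚ)) := by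
      rw [← map_mul]
      congr 1
      push_cast
      field_simp
    linear_combination a ^ n * qD a * this

end Exponential

/-- The Serre-type operator `24 D - P`. -/
noncomputable def thetaOp (f : ℚ⟦X⟧) : ℚ⟦X⟧ := 24 * qD f - eisPQ * f

/-- The modified generating function of the spt-coefficients. -/
noncomputable def phiQ : ℚ⟦X⟧ := C (3 / 2) * eisPQ - C (1 / 2) - 12 * lerchQ 1

/-- The generating function of the iterates of `thetaOp` on `phiQ`. -/
noncomputable def iterSer : ℚ⟦X⟧⟦X⟧ := mk fun n => C ((-1) ^ n * sinhCoeff n) * thetaOp^[n] phiQ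

/-- The combined generating function. -/
noncomputable def wSer : ℚ⟦X⟧⟦X⟧ := X * iterSer + 12 * alphaSer

theorem ofNat_eq_C {R : Type*} [CommRing R] (n : ℕ) [n.AtLeastTwo] :
    (OfNat.ofNat n : R⟦X⟧) = C (OfNat.ofNat n) := (map_ofNat C n).symm

theorem qD_ofNat {R : Type*} [CommRing R] (n : ℕ) [n.AtLeastTwo] :
    qD (OfNat.ofNat n : R⟦X⟧) = 0 := by
  rw [ofNat_eq_C, qD_C]

theorem ySer_ode :
    16 * qD (qD ySer) + 8 * qD ySer = X * (8 * cD ySer + C eisPQ * ySer) := by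
  ext1 i
  rw [ofNat_eq_C 8, ofNat_eq_C 16]
  rcases i with - | i
  · simp only [map_add, coeff_C_mul, coeff_qD, coeff_zero_X_mul]
    simp
  · simp only [map_add, coeff_C_mul, coeff_qD, coeff_succ_X_mul, coeff_cD]
    rw [ySer, coeff_mk, coeff_mk, qD_mul, qD_C, thetaQuot_succ, thetaQuot_one, ← sinhCoeff_succ i]
    simp only [map_add, map_mul, map_ofNat, map_one, map_natCast]
    push_cast
    ring

theorem iterSer_ode :
    16 * qD (qD iterSer) + 8 * qD iterSer = -X * (24 * cD iterSer - C eisPQ * iterSer) := by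
  ext1 i
  rw [ofNat_eq_C 8, ofNat_eq_C 16, ofNat_eq_C 24, neg_mul, map_neg]
  rcases i with - | i
  · simp only [map_add, coeff_C_mul, coeff_qD, coeff_zero_X_mul]
    simp
  · simp only [map_add, map_sub, coeff_C_mul, coeff_qD, coeff_succ_X_mul, coeff_cD]
    rw [iterSer, coeff_mk, coeff_mk, qD_mul, qD_C, ← sinhCoeff_succ i, Function.iterate_succ_apply',
      thetaOp]
    simp only [map_add, map_mul, map_ofNat, map_one, map_natCast, map_pow, map_neg]
    push_cast
    ring

theorem wSer_ode :
    16 * qD (qD wSer) - 24 * qD wSer + 8 * wSer + X * (24 * cD wSer - C eisPQ * wSer) =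
      12 * betaSer := by
  have h12 : cD (12 : ℚ⟦X⟧⟦X⟧) = 0 := by rw [ofNat_eq_C, cD_C, qD_ofNat, map_zero]
  rw [betaSer_eq, wSer]
  have h12' : qD (12 : ℚ⟦X⟧⟦X⟧) = 0 := qD_ofNat 12
  simp only [map_add, qD_mul, cD_mul, qD_X, cD_X, h12, h12', mul_zero, add_zero]
  linear_combination X * iterSer_ode

theorem constantCoeff_cschQ : constantCoeff cschQ = -1 := by
  have h := congrArg constantCoeff sinhQ_mul_cschQ
  simpa [constantCoeff_sinhQ] using h

theorem coeff_one_cschQ : coeff 1 cschQ = 1 / 24 := by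
  have h := congrArg (coeff 1) sinhQ_mul_cschQ
  rw [coeff_one_mul, constantCoeff_sinhQ, constantCoeff_cschQ, sinhQ, coeff_mk, map_neg, coeff_one,
    if_neg one_ne_zero] at h
  norm_num [Nat.factorial] at h
  linarith

theorem constantCoeff_wSer : constantCoeff wSer = -12 := by
  have h1 : constantCoeff (12 : ℚ⟦X⟧⟦X⟧) = 12 := map_ofNat _ 12
  have h2 : constantCoeff cschSer = -1 := by
    rw [cschSer, ← coeff_zero_eq_constantCoeff_apply, coeff_map, coeff_zero_eq_constantCoeff_apply,
      constantCoeff_cschQ, map_neg, map_one]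
  rw [wSer, alphaSer]
  simp [h1, h2]

theorem coeff_one_wSer : coeff 1 wSer = C (3 / 2) * eisPQ := by
  have h1 : coeff 1 (X * iterSer) = phiQ := by
    rw [show 1 = 0 + 1 from rfl, coeff_succ_X_mul, iterSer, coeff_mk]
    simp [sinhCoeff]
  have h2 : coeff 1 (X * lerchSer) = lerchQ 1 := by
    rw [show 1 = 0 + 1 from rfl, coeff_succ_X_mul, lerchSer, coeff_mk]
    simp [sinhCoeff]
  rw [wSer, alphaSer, map_add, h1, ofNat_eq_C 12, coeff_C_mul, map_add, h2, cschSer, coeff_map,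
    coeff_one_cschQ, phiQ]
  have h3 : (C (1 / 2 : ℚ) : ℚ⟦X⟧) = 12 * C (1 / 24) := by
    rw [ofNat_eq_C, ← map_mul]; norm_num
  linear_combination -h3

/-- The Eisenstein series of weight four. -/
noncomputable def eisQ : ℤ⟦X⟧ := eisP ^ 2 - 12 * qD eisP

/-- The Eisenstein series of weight four, with rational coefficients. -/
noncomputable def eisQQ : ℚ⟦X⟧ := baseChange ℚ eisQ

theorem qD_eisPQ : 12 * qD eisPQ = eisPQ ^ 2 - eisQQ := by
  rw [eisQQ, eisQ, eisPQ, map_sub, map_mul, map_qD, map_pow, map_ofNat]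
  ring

/-- The modular correction of `ySer`. -/
noncomputable def yHat : ℚ⟦X⟧⟦X⟧ := expSer (-(C (1 / 24) * eisPQ)) * ySer

/-- The modular correction of `betaSer`. -/
noncomputable def betaHat : ℚ⟦X⟧⟦X⟧ := expSer (C (1 / 8) * eisPQ) * betaSer

/-- The modular correction of `wSer`. -/
noncomputable def wHat : ℚ⟦X⟧⟦X⟧ := expSer (C (1 / 8) * eisPQ) * wSer

theorem betaHat_mul_yHat_pow : betaHat * yHat ^ 3 = -8 := by
  have h : ((3 : ℕ) : ℚ⟦X⟧) * -(C (1 / 24) * eisPQ) = -(C (1 / 8) * eisPQ) := by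
    have : (C (1 / 8 : ℚ) : ℚ⟦X⟧) = 3 * C (1 / 24) := by
      rw [ofNat_eq_C, ← map_mul]; norm_num
    rw [this]
    push_cast
    ring
  rw [betaHat, yHat, mul_pow, expSer_pow, h]
  linear_combination betaSer * ySer ^ 3 * expSer_mul_neg (C (1 / 8) * eisPQ) + betaSer_mul_ySer_pow

theorem eisPQ_eq : eisPQ = 24 * (C (1 / 24) * eisPQ) := by
  rw [ofNat_eq_C, ← mul_assoc, ← map_mul]
  norm_num

theorem yHat_ode :
    36 * (16 * qD (qD yHat) + 8 * qD yHat) =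
      X * (288 * cD yHat - 48 * C eisPQ * qD yHat) - X ^ 2 * C eisQQ * yHat := by
  have hP := congrArg (C : ℚ⟦X⟧ →+* ℚ⟦X⟧⟦X⟧) qD_eisPQ
  have hy := ySer_ode
  have h0 := eisPQ_eq
  have h24 : qD (24 : ℚ⟦X⟧) = 0 := qD_ofNat 24
  rw [yHat]
  generalize C (1 / 24 : ℚ) * eisPQ = a at *
  have hG := qD_expSer (-a)
  have hG2 := cD_expSer (-a)
  generalize expSer (-a) = G at *
  rw [h0] at hy hP ⊢
  simp only [map_neg, map_mul, qD_mul, map_sub, map_pow, map_ofNat, h24, mul_zero, map_zero,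
    map_add] at hG hG2 hP hy
  simp only [qD_mul, cD_mul, hG, hG2, map_add, qD_X, qD_C, map_neg, map_mul, map_ofNat]
  linear_combination 36 * G * hy + X ^ 2 * G * ySer * hP

theorem wHat_ode :
    16 * qD (qD wHat) - 24 * qD wHat + 8 * wHat + X * (24 * cD wHat - 4 * C eisPQ * qD wHat) +
      X ^ 2 * C (C (1 / 4) * eisQQ) * wHat = 12 * betaHat := by
  have hP := congrArg (C : ℚ⟦X⟧ →+* ℚ⟦X⟧⟦X⟧) qD_eisPQ
  have hy := wSer_ode
  have h0 := eisPQ_eq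
  have h24 : qD (24 : ℚ⟦X⟧) = 0 := qD_ofNat 24
  have h8 : C (1 / 8) * eisPQ = 3 * (C (1 / 24) * eisPQ) := by
    rw [ofNat_eq_C, ← mul_assoc, ← map_mul]
    norm_num
  have hQ : eisQQ = 4 * (C (1 / 4) * eisQQ) := by
    rw [ofNat_eq_C, ← mul_assoc, ← map_mul]
    norm_num
  rw [wHat, betaHat, h8]
  generalize C (1 / 24 : ℚ) * eisPQ = a at *
  generalize C (1 / 4 : ℚ) * eisQQ = b at *
  have hG := qD_expSer (3 * a)
  have hG2 := cD_expSer (3 * a)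
  generalize expSer (3 * a) = G at *
  have h3 : qD (3 : ℚ⟦X⟧) = 0 := qD_ofNat 3
  rw [hQ] at hP
  rw [h0] at hy hP ⊢
  have h3' : qD (3 : ℚ⟦X⟧⟦X⟧) = 0 := qD_ofNat 3
  simp only [map_mul, qD_mul, map_sub, map_pow, map_ofNat, h24, h3, mul_zero,
    add_zero] at hG hG2 hP hy
  simp only [qD_mul, cD_mul, hG, hG2, map_add, qD_X, qD_C, map_mul, map_ofNat, h3']
  have hk : 4 * (C (C (1 / 4 : ℚ)) : ℚ⟦X⟧⟦X⟧) = 1 := by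
    rw [ofNat_eq_C, ofNat_eq_C, ← map_mul, ← map_mul]
    norm_num
  generalize C (C (1 / 4 : ℚ)) = k at hk
  linear_combination G * hy + X ^ 2 * G * wSer * (k * hP -
    (72 * C (qD a) - 144 * C a ^ 2 + C b) * hk)

end SptCongruence

namespace SptCongruence

open PowerSeries UpperHalfPlane EisensteinSeries ModularForm Derivative MatrixGroups
open scoped Manifold

section QExpansion

/-- The function `f` on the upper half plane has `q`-expansion `c`. -/
def HasQExp (f : ℍ → ℂ) (c : ℂ⟦X⟧) : Prop :=
  ∀ τ : ℍ, HasSum (fun m : ℕ => coeff m c * Function.Periodic.qParam 1 τ ^ m) (f τ)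

variable {f g : ℍ → ℂ} {c d : ℂ⟦X⟧}

theorem HasQExp.add (hf : HasQExp f c) (hg : HasQExp g d) : HasQExp (f + g) (c + d) := fun τ => by
  simpa only [map_add, add_mul] using! (hf τ).add (hg τ)

theorem HasQExp.const_smul (a : ℂ) (hf : HasQExp f c) : HasQExp (a • f) (C a * c) := fun τ => by
  simpa only [coeff_C_mul, mul_assoc] using! (hf τ).mul_left a

theorem HasQExp.mul (hf : HasQExp f c) (hg : HasQExp g d) : HasQExp (f * g) (c * d) := fun τ => by
  have h1 := (hf τ).summable.norm
  have h2 := (hg τ).summable.norm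
  have h3 := (summable_norm_sum_mul_antidiagonal_of_summable_norm h1 h2).of_norm.hasSum
  rw [← tsum_mul_tsum_eq_tsum_sum_antidiagonal_of_summable_norm h1 h2, (hf τ).tsum_eq,
    (hg τ).tsum_eq] at h3
  convert! h3 using 1
  ext n
  rw [coeff_mul, sum_mul]
  refine sum_congr rfl fun p hp => ?_
  rw [← mem_antidiagonal.1 hp, pow_add]
  ring

theorem HasQExp.normalizedDerivOfComplex (hf : HasQExp f c) :
    HasQExp (normalizedDerivOfComplex f) (qD c) := fun τ => by
  set F : ℕ → ℂ → ℂ := fun m w => coeff m c * Function.Periodic.qParam 1 w ^ m with hF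
  set U : Set ℂ := {w : ℂ | τ.im / 2 < w.im}
  have hτ : (0 : ℝ) < τ.im / 2 := half_pos τ.im_pos
  have hU : IsOpen U := isOpen_lt continuous_const Complex.continuous_im
  have hd : ∀ m w, HasDerivAt (F m) (2 * Real.pi * Complex.I * m * F m w) w := fun m w => by
    have h1 : HasDerivAt (Function.Periodic.qParam 1)
        (2 * Real.pi * Complex.I * Function.Periodic.qParam 1 w) w := by
      have h := ((hasDerivAt_id w).const_mul (2 * Real.pi * Complex.I)).cexp
      simp only [id, mul_one] at h
      convert! h using 1
      · ext x
        simp [Function.Periodic.qParam]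
      · simp [Function.Periodic.qParam, mul_comm]
    convert! (h1.pow m).const_mul (coeff m c) using 1
    rcases m with - | m
    · simp
    · simp only [hF, Nat.add_sub_cancel, pow_succ]
      ring
  set σ : ℍ := ⟨(τ.im / 2 : ℝ) * Complex.I, by simpa using τ.im_pos⟩ with hσ
  have hn : ∀ (m : ℕ) (w : ℂ), w ∈ U → ‖F m w‖ ≤ ‖F m σ‖ := fun m w hw => by
    simp only [hF, norm_mul, norm_pow, Function.Periodic.norm_qParam]
    refine mul_le_mul_of_nonneg_left (pow_le_pow_left₀ (Real.exp_nonneg _) ?_ _) (norm_nonneg _)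
    refine Real.exp_le_exp.2 ?_
    have : (σ : ℂ).im = τ.im / 2 := by simp [hσ]
    rw [this]
    have h2 : τ.im / 2 < w.im := hw
    have := mul_le_mul_of_nonneg_left h2.le Real.two_pi_pos.le
    simp only [div_one]
    linarith
  have hz : (τ : ℂ) ∈ U := by
    have := τ.im_pos
    simp only [U, Set.mem_ofPred_eq, UpperHalfPlane.coe_im]
    linarith
  have h := Complex.hasSum_deriv_of_summable_norm (hf σ).summable.norm
    (fun m w _ => (hd m w).differentiableAt.differentiableWithinAt) hU hn hz
  have he : (fun w : ℂ => ∑' m, F m w) =ᶠ[nhds (τ : ℂ)] f ∘ ofComplex := by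
    filter_upwards [hU.mem_nhds hz] with w hw
    have hw' : 0 < w.im := hτ.trans hw
    rw [Function.comp_apply, ofComplex_apply_of_im_pos hw', ← (hf _).tsum_eq]
  rw [he.deriv_eq] at h
  have h2 := h.mul_left (2 * Real.pi * Complex.I)⁻¹
  convert! h2 using 1
  ext m
  rw [(hd m τ).deriv, coeff_qD]
  have : (2 * Real.pi * Complex.I : ℂ) ≠ 0 := Complex.two_pi_I_ne_zero
  simp only [hF]
  field_simp

theorem HasQExp.isBoundedAtImInfty (hf : HasQExp f c) : IsBoundedAtImInfty f :=
  isBoundedAtImInfty_of_hasSum_qExpansion one_pos fun τ => by simpa using hf τ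

/-- A modular form of level one from a `q`-expansion. -/
noncomputable def modularFormOfHasQExp {k : ℤ} (hf : HasQExp f c) (hd : MDiff f)
    (hs : ∀ γ : SL(2, ℤ), f ∣[k] γ = f) : ModularForm 𝒮ℒ k where
  toFun := f
  slash_action_eq' := fun _ ⟨γ, hγ⟩ => hγ ▸ hs γ
  holo' := hd
  bdd_at_cusps' {c} hc := by
    rw [Subgroup.IsArithmetic.isCusp_iff_isCusp_SL2Z] at hc
    rw [OnePoint.isBoundedAt_iff_forall_SL2Z hc]
    intro γ _
    rw [hs γ]
    exact hf.isBoundedAtImInfty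

theorem coeff_qExpansion_modularFormOfHasQExp {k : ℤ} (hf : HasQExp f c) (hd : MDiff f)
    (hs : ∀ γ : SL(2, ℤ), f ∣[k] γ = f) : qExpansion 1 (modularFormOfHasQExp hf hd hs) = c := by
  ext m
  exact (ModularFormClass.qExpansion_coeff_unique one_pos one_mem_strictPeriods_SL
    (c := fun m => coeff m c) (fun τ => by simpa using! hf τ) m).symm

theorem eq_zero_of_weight_eight (hf : HasQExp f c) (hd : MDiff f)
    (hs : ∀ γ : SL(2, ℤ), f ∣[(8 : ℤ)] γ = f) (h0 : constantCoeff c = 0) : c = 0 := by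
  have h : modularFormOfHasQExp (k := (8 : ℕ)) hf hd hs = 0 := by
    apply ModularForm.sturm_bound_levelOne_nat
    rw [coeff_qExpansion_modularFormOfHasQExp]
    simp only [Nat.reduceDiv, Nat.cast_zero]
    refine lt_of_lt_of_le ?_ (nat_le_order c 1 fun i hi => ?_)
    · simp
    · rw [Nat.lt_one_iff.1 hi, coeff_zero_eq_constantCoeff_apply, h0]
  rw [← coeff_qExpansion_modularFormOfHasQExp (k := (8 : ℕ)) hf hd hs, h]
  exact qExpansion_zero 1

end QExpansion

/-- The Eisenstein series of weight six. -/
noncomputable def eisR : ℤ⟦X⟧ := eisP * eisQ - 3 * qD eisQ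

section Sigma

open PowerSeries.WithPiTopology

theorem coeff_sigmaGF (m : ℕ) : coeff m sigmaGF = ArithmeticFunction.sigma 1 m := by
  have hs : Summable fun p : ℕ × ℕ => ((p.1 + 1 : ℕ) : ℤ⟦X⟧) * X ^ ((p.1 + 1) * (p.2 + 1)) :=
    (adicFinite_lambert.mul_left _).summable
  set g : ℕ × ℕ → ℤ := fun p => if p ∈ m.divisorsAntidiagonal then (p.1 : ℤ) else 0 with hg
  have he : Function.Injective fun p : ℕ × ℕ => (p.1 + 1, p.2 + 1) := fun p p' h => by
    simp only [Prod.mk.injEq, add_left_inj] at h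
    exact Prod.ext h.1 h.2
  have hsupp : Function.support g ⊆ Set.range fun p : ℕ × ℕ => (p.1 + 1, p.2 + 1) := by
    rintro ⟨a, b⟩ hp
    have hab : (a, b) ∈ m.divisorsAntidiagonal := by
      by_contra h
      exact hp (if_neg h)
    rw [Nat.mem_divisorsAntidiagonal] at hab
    rcases a with - | a
    · exact absurd (by simpa using hab.1.symm) hab.2
    rcases b with - | b
    · exact absurd (by simpa using hab.1.symm) hab.2
    exact ⟨(a, b), rfl⟩
  have h1 : ∀ p : ℕ × ℕ, coeff m (((p.1 + 1 : ℕ) : ℤ⟦X⟧) * X ^ ((p.1 + 1) * (p.2 + 1))) =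
      g (p.1 + 1, p.2 + 1) := fun p => by
    rw [← map_natCast (C (R := ℤ)), coeff_C_mul, coeff_X_pow]
    simp only [hg, Nat.mem_divisorsAntidiagonal]
    by_cases h : m = (p.1 + 1) * (p.2 + 1)
    · rw [if_pos h, if_pos ⟨h.symm, by rw [h]; positivity⟩, mul_one]
    · rw [if_neg h, if_neg fun h' => h h'.1.symm, mul_zero]
  rw [sigmaGF, coeff_tsum hs, tsum_congr h1, he.tsum_eq hsupp,
    tsum_eq_sum (s := m.divisorsAntidiagonal) fun p hp => if_neg hp,
    sum_congr rfl fun p hp => if_pos hp, ArithmeticFunction.sigma_one_apply, Nat.cast_sum]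
  exact Nat.sum_divisorsAntidiagonal fun d _ => (d : ℤ)

end Sigma

theorem hasQExp_E2 : HasQExp E2 (baseChange ℂ eisP) := fun τ => by
  convert! hasSum_qExpansion_E2 (z := τ) using 1
  ext m
  rw [coeff_map, eisP, map_sub, ofNat_eq_C 24, coeff_C_mul, coeff_sigmaGF, coeff_one]
  split_ifs with h
  · simp [h, Function.Periodic.qParam]
  · simp [Function.Periodic.qParam]

/-- The Eisenstein series of weight four as a function on the upper half plane. -/
noncomputable def eisFour : ℍ → ℂ := E2 * E2 + (-12 : ℂ) • normalizedDerivOfComplex E2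

/-- The Eisenstein series of weight six as a function on the upper half plane. -/
noncomputable def eisSix : ℍ → ℂ := (-3 : ℂ) • serreDerivative (4 : ℤ) eisFour

theorem HasQExp.serreDerivative {f : ℍ → ℂ} {c : ℂ⟦X⟧} (hf : HasQExp f c) (k : ℂ) :
    HasQExp (serreDerivative k f) (qD c + C (-(k * 12⁻¹)) * (baseChange ℂ eisP * c)) := by
  convert! hf.normalizedDerivOfComplex.add ((hasQExp_E2.mul hf).const_smul (-(k * 12⁻¹))) using 1
  ext z
  simp
  ring

theorem baseChange_eisQ : baseChange ℂ eisQ =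
    baseChange ℂ eisP * baseChange ℂ eisP + C (-12) * qD (baseChange ℂ eisP) := by
  rw [eisQ, map_sub, map_mul, map_qD, map_pow, map_ofNat, map_neg, ← ofNat_eq_C]
  ring

theorem hasQExp_eisFour : HasQExp eisFour (baseChange ℂ eisQ) := by
  rw [baseChange_eisQ]
  exact (hasQExp_E2.mul hasQExp_E2).add (hasQExp_E2.normalizedDerivOfComplex.const_smul _)

theorem hasQExp_eisSix : HasQExp eisSix (baseChange ℂ eisR) := by
  have h := (hasQExp_eisFour.serreDerivative (4 : ℤ)).const_smul (-3)
  have h3 : baseChange ℂ eisR = C (-3) * (qD (baseChange ℂ eisQ) +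
      C (-(((4 : ℤ) : ℂ) * 12⁻¹)) * (baseChange ℂ eisP * baseChange ℂ eisQ)) := by
    rw [eisR, map_sub, map_mul, map_mul, map_qD, map_ofNat, mul_add, ← mul_assoc (C _) (C _),
      ← map_mul C, show (-3 : ℂ) * -(((4 : ℤ) : ℂ) * 12⁻¹) = 1 by norm_num, map_one C, map_neg,
      ← ofNat_eq_C 3]
    ring
  rw [h3]
  exact h

theorem mdifferentiable_eisFour : MDiff eisFour :=
  (E2_mdifferentiable.mul E2_mdifferentiable).add
    ((normalizedDerivOfComplex_mdifferentiable E2_mdifferentiable).const_smul _)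

theorem mdifferentiable_eisSix : MDiff eisSix :=
  (serreDerivative_mdifferentiable _ mdifferentiable_eisFour).const_smul _

theorem normalizedDerivOfComplex_D2 (γ : SL(2, ℤ)) (z : ℍ) :
    normalizedDerivOfComplex (D2 γ) z = -(γ 1 0 / denom γ z) ^ 2 := by
  have h := ((hasDerivAt_denom_zpow (γ : GL (Fin 2) ℝ) (-1) z).const_mul
    (2 * Real.pi * Complex.I * γ 1 0))
  have he : D2 γ ∘ ofComplex =ᶠ[nhds (z : ℂ)]
      fun w => 2 * Real.pi * Complex.I * γ 1 0 * denom γ w ^ (-1 : ℤ) := by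
    filter_upwards [isOpen_upperHalfPlaneSet.mem_nhds z.im_pos] with w hw
    rw [Function.comp_apply, ofComplex_apply_of_im_pos hw, D2, zpow_neg_one]
    rfl
  rw [normalizedDerivOfComplex, he.deriv_eq, h.deriv]
  have : (2 * Real.pi * Complex.I : ℂ) ≠ 0 := Complex.two_pi_I_ne_zero
  have hz := denom_ne_zero (γ : GL (Fin 2) ℝ) z
  simp
  field_simp
  rw [Complex.I_sq]
  ring

theorem mdifferentiable_D2 (γ : SL(2, ℤ)) : MDiff (D2 γ) := by
  rw [mdifferentiable_iff]
  intro w hw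
  have h := ((hasDerivAt_denom_zpow (γ : GL (Fin 2) ℝ) (-1) ⟨w, hw⟩).const_mul
    (2 * Real.pi * Complex.I * γ 1 0))
  refine (h.differentiableAt.congr_of_eventuallyEq ?_).differentiableWithinAt
  filter_upwards [isOpen_upperHalfPlaneSet.mem_nhds hw] with w hw
  rw [Function.comp_apply, ofComplex_apply_of_im_pos hw, D2, zpow_neg_one]
  rfl

theorem eisFour_slash (γ : SL(2, ℤ)) : eisFour ∣[(4 : ℤ)] γ = eisFour := by
  have h1 := normalizedDerivOfComplex_SL_slash (k := 2) E2_mdifferentiable (γ := γ)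
  have h3 := E2_slash_action γ
  rw [h3, normalizedDerivOfComplex_sub _ _ E2_mdifferentiable ((mdifferentiable_D2 γ).const_smul _),
    normalizedDerivOfComplex_smul _ _ (mdifferentiable_D2 γ)] at h1
  rw [eisFour, SlashAction.add_slash, ModularForm.SL_smul_slash, show (4 : ℤ) = 2 + 2 by norm_num,
    mul_slash_SL2, h3, ← sub_eq_zero.1 (sub_eq_zero.2 (eq_sub_iff_add_eq.1 h1))]
  ext z
  have hD : D2 γ z = 2 * Real.pi * Complex.I * (γ 1 0 / denom γ z) := mul_div_assoc _ _ _
  simp only [Pi.add_apply, Pi.mul_apply, Pi.sub_apply, Pi.smul_apply, smul_eq_mul,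
    normalizedDerivOfComplex_D2, hD, riemannZeta_two]
  have : (Real.pi : ℂ) ≠ 0 := by exact_mod_cast Real.pi_ne_zero
  have hI := Complex.I_sq
  generalize (γ 1 0 : ℂ) / denom γ z = s
  field_simp
  push_cast
  linear_combination (-24 * E2 z * Real.pi * s + 72 * Complex.I * s ^ 2) * hI

theorem eisSix_slash (γ : SL(2, ℤ)) : eisSix ∣[(6 : ℤ)] γ = eisSix := by
  rw [eisSix, ModularForm.SL_smul_slash]
  exact congrArg _ (serreDerivative_slash_invariant mdifferentiable_eisFour (eisFour_slash γ))

theorem constantCoeff_eisP : constantCoeff eisP = 1 := by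
  rw [← coeff_zero_eq_constantCoeff_apply, eisP, map_sub, ofNat_eq_C 24, coeff_C_mul,
    coeff_sigmaGF]
  simp

theorem constantCoeff_qD {R : Type*} [CommRing R] (f : R⟦X⟧) : constantCoeff (qD f) = 0 := by
  rw [← coeff_zero_eq_constantCoeff_apply, coeff_qD, Nat.cast_zero, zero_mul]

theorem constantCoeff_eisQ : constantCoeff eisQ = 1 := by
  rw [eisQ, map_sub, map_mul, constantCoeff_qD, map_pow, constantCoeff_eisP]
  norm_num

theorem constantCoeff_eisR : constantCoeff eisR = 1 := by
  rw [eisR, map_sub, map_mul, map_mul, constantCoeff_qD, constantCoeff_eisP, constantCoeff_eisQ]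
  norm_num

theorem qD_eisR : 2 * qD eisR = eisP * eisR - eisQ ^ 2 := by
  have h := eq_zero_of_weight_eight
    (((hasQExp_eisSix.serreDerivative (6 : ℤ)).const_smul 2).add
      (hasQExp_eisFour.mul hasQExp_eisFour))
    (((serreDerivative_mdifferentiable _ mdifferentiable_eisSix).const_smul _).add
      (mdifferentiable_eisFour.mul mdifferentiable_eisFour)) (fun γ => by
        rw [SlashAction.add_slash, ModularForm.SL_smul_slash]
        refine congrArg₂ (· + ·) (congrArg _ (serreDerivative_slash_invariant
          mdifferentiable_eisSix (eisSix_slash γ))) ?_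
        rw [show (8 : ℤ) = 4 + 4 by norm_num, mul_slash_SL2, eisFour_slash]) ?_
  · have hinj : Function.Injective (baseChange ℂ) := map_injective _ (RingHom.injective_int _)
    apply hinj
    simp only [map_mul, map_sub, map_qD, map_pow, map_ofNat]
    rw [mul_add, ← mul_assoc, ← map_mul] at h
    norm_num at h
    rw [← ofNat_eq_C] at h
    linear_combination h
  · have hc : ∀ f : ℤ⟦X⟧, constantCoeff (baseChange ℂ f) = ((constantCoeff f : ℤ) : ℂ) := fun f => by
      rw [← coeff_zero_eq_constantCoeff_apply, coeff_map]
      simp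
    simp only [map_add, map_mul, constantCoeff_qD, hc, constantCoeff_eisP, constantCoeff_eisQ,
      constantCoeff_eisR, constantCoeff_C]
    norm_num

end SptCongruence

namespace SptCongruence

open PowerSeries

section Forms

variable (K : Type*) [CommRing K]

/-- The isobaric polynomials of weight `k` in the Eisenstein series of weights four and six. -/
noncomputable def isobaric (k : ℕ) : Submodule K K⟦X⟧ :=
  Submodule.span K {f | ∃ a b : ℕ, 4 * a + 6 * b = k ∧
    f = baseChange K eisQ ^ a * baseChange K eisR ^ b}

variable {K}

theorem monomial_mem_isobaric {a b k : ℕ} (h : 4 * a + 6 * b = k) :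
    baseChange K eisQ ^ a * baseChange K eisR ^ b ∈ isobaric K k :=
  Submodule.subset_span ⟨a, b, h, rfl⟩

theorem one_mem_isobaric : (1 : K⟦X⟧) ∈ isobaric K 0 := by
  simpa using monomial_mem_isobaric (K := K) (a := 0) (b := 0) rfl

theorem eisQ_mem_isobaric : baseChange K eisQ ∈ isobaric K 4 := by
  simpa using monomial_mem_isobaric (K := K) (a := 1) (b := 0) rfl

theorem mul_mem_isobaric {k l : ℕ} {f g : K⟦X⟧} (hf : f ∈ isobaric K k) (hg : g ∈ isobaric K l) :
    f * g ∈ isobaric K (k + l) := by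
  have h : f * g ∈ isobaric K k * isobaric K l := Submodule.mul_mem_mul hf hg
  rw [isobaric, isobaric, Submodule.span_mul_span] at h
  refine Submodule.span_mono ?_ h
  rintro _ ⟨_, ⟨a, b, hab, rfl⟩, _, ⟨c, d, hcd, rfl⟩, rfl⟩
  exact ⟨a + c, b + d, by omega, by simp only [pow_add]; ring⟩

theorem C_mul_mem_isobaric {k : ℕ} {f : K⟦X⟧} (c : K) (hf : f ∈ isobaric K k) :
    C c * f ∈ isobaric K k := by
  rw [← smul_eq_C_mul]
  exact Submodule.smul_mem _ _ hf

theorem qD_baseChange_eisQ : 3 * qD (baseChange K eisQ) =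
    baseChange K eisP * baseChange K eisQ - baseChange K eisR := by
  have h : eisR = eisP * eisQ - 3 * qD eisQ := rfl
  rw [h, map_sub, map_mul, map_mul, map_qD, map_ofNat]
  ring

theorem qD_baseChange_eisR : 2 * qD (baseChange K eisR) =
    baseChange K eisP * baseChange K eisR - baseChange K eisQ ^ 2 := by
  have h := congrArg (baseChange K) qD_eisR
  rwa [map_sub, map_mul, map_mul, map_qD, map_ofNat, map_pow] at h

theorem serre_mem_isobaric {k : ℕ} {f : K⟦X⟧} (hf : f ∈ isobaric K k) :
    12 * qD f - (k : K⟦X⟧) * baseChange K eisP * f ∈ isobaric K (k + 2) := by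
  refine Submodule.span_induction (p := fun f _ =>
    12 * qD f - (k : K⟦X⟧) * baseChange K eisP * f ∈
    isobaric K (k + 2)) ?_ (by simp) (fun f g _ _ hf hg => ?_) (fun c f _ hf => ?_) hf
  · rintro _ ⟨a, b, rfl, rfl⟩
    have h1 := qD_baseChange_eisQ (K := K)
    have h2 := qD_baseChange_eisR (K := K)
    set P := baseChange K eisP
    set Q := baseChange K eisQ with hQ
    set R := baseChange K eisR with hR
    have h3 : (a : K⟦X⟧) * (Q ^ (a - 1) * R ^ (b + 1)) ∈ isobaric K (4 * a + 6 * b + 2) := by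
      rcases a with - | a
      · simp
      · rw [← nsmul_eq_mul]
        exact nsmul_mem (monomial_mem_isobaric (by omega)) _
    have h4 : (b : K⟦X⟧) * (Q ^ (a + 2) * R ^ (b - 1)) ∈ isobaric K (4 * a + 6 * b + 2) := by
      rcases b with - | b
      · simp
      · rw [← nsmul_eq_mul]
        exact nsmul_mem (monomial_mem_isobaric (by omega)) _
    have h5 := Submodule.add_mem _ (nsmul_mem h3 4) (nsmul_mem h4 6)
    convert Submodule.neg_mem _ h5 using 1
    have hQ' : (a : K⟦X⟧) * Q ^ a = a * Q ^ (a - 1) * Q := by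
      rcases a with - | a
      · simp
      · simp [pow_succ, mul_assoc]
    have hR' : (b : K⟦X⟧) * R ^ b = b * R ^ (b - 1) * R := by
      rcases b with - | b
      · simp
      · simp [pow_succ, mul_assoc]
    rw [qD_mul, qD_pow, qD_pow]
    push_cast
    simp only [nsmul_eq_mul, Nat.cast_ofNat]
    linear_combination 4 * a * Q ^ (a - 1) * R ^ b * h1 + 6 * b * R ^ (b - 1) * Q ^ a * h2 -
      4 * P * R ^ b * hQ' - 6 * P * Q ^ a * hR'
  · convert add_mem hf hg using 1
    rw [map_add]
    ring
  · convert Submodule.smul_mem _ c hf using 1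
    rw [Derivation.map_smul]
    simp only [smul_eq_C_mul]
    ring

theorem isobaric_eq_bot {k : ℕ} (h : ∀ a b : ℕ, 4 * a + 6 * b ≠ k) : isobaric K k = ⊥ := by
  rw [isobaric, Submodule.span_eq_bot]
  rintro _ ⟨a, b, hab, rfl⟩
  exact absurd hab (h a b)

theorem isobaric_decomposition {k a b : ℕ} (hb : b ≤ 1) (h : 4 * a + 6 * b = k) {f : K⟦X⟧}
    (hf : f ∈ isobaric K k) : ∃ (c : K) (g : K⟦X⟧), (g = 0 ∨ ∃ j, j + 12 = k ∧ g ∈ isobaric K j) ∧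
      f = C c * (baseChange K eisQ ^ a * baseChange K eisR ^ b) +
        baseChange K (eisQ ^ 3 - eisR ^ 2) * g := by
  have hadd : ∀ g g' : K⟦X⟧, (g = 0 ∨ ∃ j, j + 12 = k ∧ g ∈ isobaric K j) →
      (g' = 0 ∨ ∃ j, j + 12 = k ∧ g' ∈ isobaric K j) →
      (g + g' = 0 ∨ ∃ j, j + 12 = k ∧ g + g' ∈ isobaric K j) := by
    rintro g g' (rfl | ⟨j, hj, hg⟩) (rfl | ⟨j', hj', hg'⟩)
    · simp
    · exact .inr ⟨j', hj', by simpa⟩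
    · exact .inr ⟨j, hj, by simpa⟩
    · obtain rfl : j = j' := by omega
      exact .inr ⟨j, hj, add_mem hg hg'⟩
  induction hf using Submodule.span_induction with
  | mem f hf =>
    obtain ⟨u, v, huv, rfl⟩ := hf
    induction v using Nat.strong_induction_on generalizing u with
    | _ v ih =>
      rcases lt_or_ge v 2 with hv | hv
      · obtain rfl : b = v := by omega
        obtain rfl : a = u := by omega
        exact ⟨1, 0, .inl rfl, by simp⟩
      · obtain ⟨v, rfl⟩ := Nat.exists_eq_add_of_le' hv
        obtain ⟨c, g, hg, he⟩ := ih v (by omega) (u + 3) (by omega)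
        refine ⟨c, g + -(baseChange K eisQ ^ u * baseChange K eisR ^ v), hadd _ _ hg
          (.inr ⟨4 * u + 6 * v, by omega, neg_mem (monomial_mem_isobaric rfl)⟩), ?_⟩
        rw [map_sub, map_pow, map_pow] at he ⊢
        linear_combination he
  | zero => exact ⟨0, 0, .inl rfl, by simp⟩
  | add f f' _ _ hf hf' =>
    obtain ⟨c, g, hg, rfl⟩ := hf
    obtain ⟨c', g', hg', rfl⟩ := hf'
    exact ⟨c + c', g + g', hadd _ _ hg hg', by rw [map_add]; ring⟩
  | smul x f _ hf =>
    obtain ⟨c, g, hg, rfl⟩ := hf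
    refine ⟨x * c, x • g, hg.imp (fun h => by simp [h]) fun ⟨j, hj, hg⟩ =>
      ⟨j, hj, Submodule.smul_mem _ _ hg⟩, ?_⟩
    simp only [smul_eq_C_mul, map_mul]
    ring

end Forms

section Discriminant

theorem constantCoeff_discriminant : constantCoeff (eisQ ^ 3 - eisR ^ 2) = 0 := by
  rw [map_sub, map_pow, map_pow, constantCoeff_eisQ, constantCoeff_eisR]
  norm_num

theorem coeff_one_eisP : coeff 1 eisP = -24 := by
  rw [eisP, map_sub, ofNat_eq_C 24, coeff_C_mul, coeff_sigmaGF, coeff_one]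
  simp

theorem coeff_one_eisQ : coeff 1 eisQ = 240 := by
  have h : coeff 1 (eisP * eisP) = -48 := by
    rw [coeff_one_mul, coeff_one_eisP, constantCoeff_eisP]
    norm_num
  rw [eisQ, pow_two, map_sub, h, ofNat_eq_C 12, coeff_C_mul, coeff_qD, coeff_one_eisP]
  norm_num

theorem coeff_one_eisR : coeff 1 eisR = -504 := by
  rw [eisR, map_sub, coeff_one_mul, coeff_one_eisP, constantCoeff_eisP, coeff_one_eisQ,
    constantCoeff_eisQ, ofNat_eq_C 3, coeff_C_mul, coeff_qD, coeff_one_eisQ]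
  norm_num

theorem coeff_one_discriminant : coeff 1 (eisQ ^ 3 - eisR ^ 2) = 1728 := by
  rw [map_sub, coeff_one_pow, coeff_one_pow, coeff_one_eisQ, coeff_one_eisR, constantCoeff_eisQ,
    constantCoeff_eisR]
  norm_num

end Discriminant

end SptCongruence

namespace SptCongruence

open PowerSeries

section Algebra

variable {K : Type*} [Field K]

variable (K) in
/-- Evaluation of polynomials at the Eisenstein series, recording the weight in a further
variable. -/
noncomputable def evalEis : MvPolynomial (Fin 2) K →ₐ[K] Polynomial K⟦X⟧ :=
  MvPolynomial.aeval ![Polynomial.C (baseChange K eisQ) * Polynomial.X ^ 4,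
    Polynomial.C (baseChange K eisR) * Polynomial.X ^ 6]

/-- `F` is an isobaric polynomial of weight `k` with value `f` at the Eisenstein series. -/
def IsForm (F : MvPolynomial (Fin 2) K) (k : ℕ) (f : K⟦X⟧) : Prop :=
  evalEis K F = Polynomial.C f * Polynomial.X ^ k

theorem IsForm.mul {F G : MvPolynomial (Fin 2) K} {k l : ℕ} {f g : K⟦X⟧} (hF : IsForm F k f)
    (hG : IsForm G l g) : IsForm (F * G) (k + l) (f * g) := by
  rw [IsForm] at *
  rw [map_mul, hF, hG, map_mul, pow_add]
  ring

theorem isForm_one : IsForm (1 : MvPolynomial (Fin 2) K) 0 1 := by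
  simp [IsForm]

theorem isForm_X_zero : IsForm (MvPolynomial.X 0 : MvPolynomial (Fin 2) K) 4
    (baseChange K eisQ) := by
  simp [IsForm, evalEis]

theorem isForm_X_one : IsForm (MvPolynomial.X 1 : MvPolynomial (Fin 2) K) 6
    (baseChange K eisR) := by
  simp [IsForm, evalEis]

theorem IsForm.pow {F : MvPolynomial (Fin 2) K} {k : ℕ} {f : K⟦X⟧} (hF : IsForm F k f)
    (n : ℕ) : IsForm (F ^ n) (k * n) (f ^ n) := by
  induction n with
  | zero => simpa using isForm_one
  | succ n ih => simpa only [pow_succ, Nat.mul_succ] using ih.mul hF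

theorem IsForm.add {F G : MvPolynomial (Fin 2) K} {k : ℕ} {f g : K⟦X⟧} (hF : IsForm F k f)
    (hG : IsForm G k g) : IsForm (F + G) k (f + g) := by
  rw [IsForm] at *
  rw [map_add, hF, hG, map_add, add_mul]

theorem IsForm.smul {F : MvPolynomial (Fin 2) K} {k : ℕ} {f : K⟦X⟧} (hF : IsForm F k f) (c : K) :
    IsForm (c • F) k (c • f) := by
  rw [IsForm] at *
  rw [map_smul, hF, ← smul_mul_assoc, Polynomial.smul_C]

theorem isForm_zero (k : ℕ) : IsForm (0 : MvPolynomial (Fin 2) K) k 0 := by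
  simp [IsForm]

theorem exists_isForm {k : ℕ} {f : K⟦X⟧} (hf : f ∈ isobaric K k) :
    ∃ F : MvPolynomial (Fin 2) K, IsForm F k f := by
  induction hf using Submodule.span_induction with
  | mem f hf =>
    obtain ⟨a, b, rfl, rfl⟩ := hf
    exact ⟨_, (isForm_X_zero.pow a).mul (isForm_X_one.pow b)⟩
  | zero => exact ⟨0, isForm_zero k⟩
  | add f g _ _ hf hg =>
    obtain ⟨F, hF⟩ := hf
    obtain ⟨G, hG⟩ := hg
    exact ⟨F + G, hF.add hG⟩
  | smul c f _ hf =>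
    obtain ⟨F, hF⟩ := hf
    exact ⟨c • F, hF.smul c⟩

theorem coeff_evalEis_mem_isobaric (F : MvPolynomial (Fin 2) K) (k : ℕ) :
    (evalEis K F).coeff k ∈ isobaric K k := by
  induction F using MvPolynomial.induction_on' with
  | add F G hF hG =>
    rw [map_add, Polynomial.coeff_add]
    exact add_mem hF hG
  | monomial d c =>
    have h : IsForm (MvPolynomial.monomial d c) (4 * d 0 + 6 * d 1)
        (c • (baseChange K eisQ ^ d 0 * baseChange K eisR ^ d 1)) := by
      have := (((isForm_X_zero (K := K)).pow (d 0)).mul (isForm_X_one.pow (d 1))).smul c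
      convert this using 1
      rw [MvPolynomial.monomial_eq, Finsupp.prod_fintype _ _ fun _ => pow_zero _, Fin.prod_univ_two,
        MvPolynomial.smul_eq_C_mul]
    rw [h, Polynomial.coeff_C_mul_X_pow]
    split_ifs with hk
    · exact Submodule.smul_mem _ _ (monomial_mem_isobaric hk.symm)
    · exact zero_mem _

theorem IsForm.mem_isobaric {F : MvPolynomial (Fin 2) K} {k : ℕ} {f : K⟦X⟧} (hF : IsForm F k f) :
    f ∈ isobaric K k := by
  have h := coeff_evalEis_mem_isobaric F k
  rwa [hF, Polynomial.coeff_C_mul_X_pow, if_pos rfl] at h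

theorem constantCoeff_baseChange {A : Type*} [CommRing A] (f : ℤ⟦X⟧) :
    constantCoeff (baseChange A f) = ((constantCoeff f : ℤ) : A) := by
  rw [← coeff_zero_eq_constantCoeff_apply, coeff_map]
  simp

theorem exists_division (p : MvPolynomial (Fin 2) K) :
    ∃ (p' : MvPolynomial (Fin 2) K) (u v : Polynomial K),
      p = (MvPolynomial.X 0 ^ 3 - MvPolynomial.X 1 ^ 2) * p' +
        Polynomial.aeval (MvPolynomial.X 0) u +
        MvPolynomial.X 1 * Polynomial.aeval (MvPolynomial.X 0) v := by
  induction p using MvPolynomial.induction_on with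
  | C a => exact ⟨0, Polynomial.C a, 0, by simp [MvPolynomial.algebraMap_eq]⟩
  | add p q hp hq =>
    obtain ⟨p', u, v, hp⟩ := hp
    obtain ⟨q', u', v', hq⟩ := hq
    refine ⟨p' + q', u + u', v + v', ?_⟩
    rw [hp, hq, map_add, map_add]
    ring
  | mul_X p i hp =>
    obtain ⟨p', u, v, hp⟩ := hp
    fin_cases i
    · refine ⟨p' * MvPolynomial.X 0, u * Polynomial.X, v * Polynomial.X, ?_⟩
      rw [hp, map_mul, map_mul, Polynomial.aeval_X]
      simp only [Fin.zero_eta]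
      ring
    · refine ⟨p' * MvPolynomial.X 1 - Polynomial.aeval (MvPolynomial.X 0) v,
        v * Polynomial.X ^ 3, u, ?_⟩
      rw [hp, map_mul, map_pow, Polynomial.aeval_X]
      simp only [Fin.mk_one]
      ring

theorem discriminant_dvd_of_evalEis_eq_zero {p : MvPolynomial (Fin 2) K} (hp : evalEis K p = 0) :
    MvPolynomial.X 0 ^ 3 - MvPolynomial.X 1 ^ 2 ∣ p := by
  obtain ⟨p', u, v, h⟩ := exists_division p
  have h1 : ∀ p : MvPolynomial (Fin 2) K,
      MvPolynomial.aeval ![(Polynomial.X : Polynomial K) ^ 4, Polynomial.X ^ 6] p =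
        (evalEis K p).map constantCoeff := fun p => by
    induction p using MvPolynomial.induction_on with
    | C a => simp [evalEis, Polynomial.algebraMap_apply]
    | add p q hp hq => rw [map_add, map_add, Polynomial.map_add, hp, hq]
    | mul_X p i hp =>
      rw [map_mul, map_mul, Polynomial.map_mul, hp]
      congr 1
      fin_cases i <;>
        simp [evalEis, constantCoeff_baseChange, constantCoeff_eisQ, constantCoeff_eisR,
          -coeff_zero_eq_constantCoeff]
  have h2 : MvPolynomial.aeval ![(Polynomial.X : Polynomial K) ^ 4, Polynomial.X ^ 6] p = 0 := by
    rw [h1, hp, Polynomial.map_zero]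
  have h3 : Polynomial.expand K 4 u + Polynomial.expand K 4 v * Polynomial.X ^ 6 = 0 := by
    have he : ∀ w : Polynomial K, MvPolynomial.aeval ![(Polynomial.X : Polynomial K) ^ 4,
        Polynomial.X ^ 6] (Polynomial.aeval (MvPolynomial.X 0 : MvPolynomial (Fin 2) K) w) =
        Polynomial.expand K 4 w := fun w => by
      rw [← Polynomial.aeval_algHom_apply, Polynomial.expand_eq_comp_X_pow, Polynomial.comp,
        Polynomial.aeval_def]
      simp
    rw [h, map_add, map_add, map_mul, map_mul, he, he] at h2
    simp at h2
    linear_combination h2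
  have hu : u = 0 := by
    ext n
    have := congrArg (fun f => Polynomial.coeff f (n * 4)) h3
    simp only [Polynomial.coeff_add, Polynomial.coeff_mul_X_pow', Polynomial.coeff_zero,
      Polynomial.coeff_expand_mul (by norm_num : 0 < 4),
      Polynomial.coeff_expand (by norm_num : 0 < 4)] at this
    split_ifs at this
    · omega
    · simpa using this
    · simpa using this
  have hv : v = 0 := by
    ext n
    have := congrArg (fun f => Polynomial.coeff f (n * 4 + 6)) h3
    simp only [Polynomial.coeff_add, Polynomial.coeff_mul_X_pow, Polynomial.coeff_zero,
      Polynomial.coeff_expand_mul (by norm_num : 0 < 4),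
      Polynomial.coeff_expand (by norm_num : 0 < 4)] at this
    rwa [if_neg (by omega : ¬ 4 ∣ n * 4 + 6), zero_add] at this
  rw [h, hu, hv]
  simp

theorem isForm_discriminant :
    IsForm (MvPolynomial.X 0 ^ 3 - MvPolynomial.X 1 ^ 2 : MvPolynomial (Fin 2) K) 12
      (baseChange K (eisQ ^ 3 - eisR ^ 2)) := by
  have h := ((isForm_X_zero (K := K)).pow 3).add ((isForm_X_one.pow 2).smul (-1))
  convert h using 1
  · simp [sub_eq_add_neg]
  · simp [sub_eq_add_neg]

variable (h6 : (6 : K) ≠ 0)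

include h6 in
theorem baseChange_discriminant_ne_zero : baseChange K (eisQ ^ 3 - eisR ^ 2) ≠ 0 := fun h => by
  have h1 := congrArg (coeff 1) h
  rw [coeff_map, coeff_one_discriminant, map_zero] at h1
  have h2 : (6 : K) ^ 3 * (2 : K) ^ 3 = 0 := by
    simp at h1
    linear_combination h1
  rcases mul_eq_zero.1 h2 with h3 | h3
  · exact h6 (pow_eq_zero_iff (by norm_num) |>.1 h3)
  · exact h6 (by linear_combination 3 * (pow_eq_zero_iff (by norm_num) |>.1 h3))

include h6 in
theorem evalEis_injective : Function.Injective (evalEis K) := by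
  rw [injective_iff_map_eq_zero]
  intro p hp
  by_contra hp0
  obtain ⟨n, a, ha, rfl⟩ := WfDvdMonoid.max_power_factor' hp0
    (x := (MvPolynomial.X 0 ^ 3 - MvPolynomial.X 1 ^ 2 : MvPolynomial (Fin 2) K)) fun hu => by
      have := (hu.map (MvPolynomial.eval fun _ => (1 : K)))
      simp at this
  refine ha (discriminant_dvd_of_evalEis_eq_zero ?_)
  rw [map_mul, map_pow, isForm_discriminant] at hp
  refine (mul_eq_zero.1 hp).resolve_left (pow_ne_zero _ (mul_ne_zero ?_ ?_))
  · rw [Ne, Polynomial.C_eq_zero]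
    exact baseChange_discriminant_ne_zero h6
  · exact pow_ne_zero _ Polynomial.X_ne_zero

include h6 in
theorem IsForm.unique {F G : MvPolynomial (Fin 2) K} {k : ℕ} {f : K⟦X⟧} (hF : IsForm F k f)
    (hG : IsForm G k f) : F = G :=
  evalEis_injective h6 (hF.trans hG.symm)

include h6 in
theorem IsForm.eq_zero_of_weight_two {F : MvPolynomial (Fin 2) K} {f : K⟦X⟧}
    (hF : IsForm F 2 f) : F = 0 := by
  have h := hF.mem_isobaric
  rw [isobaric_eq_bot fun a b => by omega, Submodule.mem_bot] at h
  subst h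
  exact hF.unique h6 (isForm_zero 2)

/-- A factorization of a monomial over a domain is a factorization into monomials. -/
theorem exists_eq_C_mul_X_pow {A : Type*} [CommRing A] [IsDomain A] {p q : Polynomial A} {a : A}
    {k : ℕ} (ha : a ≠ 0) (h : p * q = Polynomial.C a * Polynomial.X ^ k) :
    ∃ b c i j, p = Polynomial.C b * Polynomial.X ^ i ∧ q = Polynomial.C c * Polynomial.X ^ j ∧
      i + j = k ∧ b * c = a := by
  have h0 : p * q ≠ 0 := h ▸ mul_ne_zero (by simpa) (pow_ne_zero _ Polynomial.X_ne_zero)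
  have hp := left_ne_zero_of_mul h0
  have hq := right_ne_zero_of_mul h0
  have h1 := Polynomial.natDegree_mul hp hq
  have h2 := Polynomial.natTrailingDegree_mul hp hq
  rw [h, Polynomial.natDegree_C_mul_X_pow _ _ ha] at h1
  rw [h, Polynomial.C_mul_X_pow_eq_monomial, Polynomial.natTrailingDegree_monomial ha] at h2
  have h3 := p.natTrailingDegree_le_natDegree
  have h4 := q.natTrailingDegree_le_natDegree
  have key : ∀ r : Polynomial A, r.natDegree ≤ r.natTrailingDegree →
      r = Polynomial.C r.leadingCoeff * Polynomial.X ^ r.natDegree := fun r hr => by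
    ext n
    rw [Polynomial.coeff_C_mul_X_pow]
    split_ifs with hn
    · rw [hn, Polynomial.leadingCoeff]
    · by_contra h
      have h5 := Polynomial.le_natDegree_of_ne_zero h
      have h6 := Polynomial.natTrailingDegree_le_of_ne_zero h
      omega
  refine ⟨_, _, _, _, key p (by omega), key q (by omega), h1.symm, ?_⟩
  rw [← Polynomial.leadingCoeff_mul, h]
  simp

theorem IsForm.exists_factors {F G H : MvPolynomial (Fin 2) K} {k : ℕ} {f : K⟦X⟧}
    (hF : IsForm F k f) (hf : f ≠ 0) (h : F = G * H) :
    ∃ b c i j, IsForm G i b ∧ IsForm H j c ∧ i + j = k ∧ b * c = f := by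
  rw [IsForm, h, map_mul] at hF
  exact exists_eq_C_mul_X_pow hf hF

variable (K) in
/-- The Serre derivative on polynomials in the Eisenstein series. -/
noncomputable def serreDer : Derivation K (MvPolynomial (Fin 2) K) (MvPolynomial (Fin 2) K) :=
  MvPolynomial.mkDerivation K ![-4 * MvPolynomial.X 1, -6 * MvPolynomial.X 0 ^ 2]

theorem coe_evalEis_serreDer (F : MvPolynomial (Fin 2) K) :
    ((evalEis K (serreDer K F) : Polynomial K⟦X⟧) : K⟦X⟧⟦X⟧) =
      X ^ 2 * (12 * cD (evalEis K F : K⟦X⟧⟦X⟧) -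
        C (baseChange K eisP) * qD (evalEis K F : K⟦X⟧⟦X⟧)) := by
  induction F using MvPolynomial.induction_on with
  | C a =>
    have h : ((evalEis K (MvPolynomial.C a) : Polynomial K⟦X⟧) : K⟦X⟧⟦X⟧) = C (C a) := by
      simp [evalEis, Polynomial.algebraMap_apply]
    rw [h, qD_C, cD_C, qD_C]
    simp [serreDer]
  | add F G hF hG =>
    simp only [map_add, Polynomial.coe_add, hF, hG]
    ring
  | mul_X F i hF =>
    have hX : ((evalEis K (serreDer K (MvPolynomial.X i)) : Polynomial K⟦X⟧) : K⟦X⟧⟦X⟧) =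
        X ^ 2 * (12 * cD (evalEis K (MvPolynomial.X i) : K⟦X⟧⟦X⟧) -
          C (baseChange K eisP) * qD (evalEis K (MvPolynomial.X i) : K⟦X⟧⟦X⟧)) := by
      have hQ : ((evalEis K (MvPolynomial.X 0) : Polynomial K⟦X⟧) : K⟦X⟧⟦X⟧) =
          C (baseChange K eisQ) * X ^ 4 := by
        rw [isForm_X_zero]
        simp only [Polynomial.coe_mul, Polynomial.coe_C, Polynomial.coe_pow, Polynomial.coe_X]
      have hR : ((evalEis K (MvPolynomial.X 1) : Polynomial K⟦X⟧) : K⟦X⟧⟦X⟧) =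
          C (baseChange K eisR) * X ^ 6 := by
        rw [isForm_X_one]
        simp only [Polynomial.coe_mul, Polynomial.coe_C, Polynomial.coe_pow, Polynomial.coe_X]
      have hn : qD (X ^ 4 : K⟦X⟧⟦X⟧) = 4 * X ^ 4 ∧
          qD (X ^ 6 : K⟦X⟧⟦X⟧) = 6 * X ^ 6 ∧ cD (X ^ 4 : K⟦X⟧⟦X⟧) = 0 ∧
          cD (X ^ 6 : K⟦X⟧⟦X⟧) = 0 := by
        simp only [Derivation.leibniz_pow, qD_X, cD_X, nsmul_eq_mul, smul_eq_mul]
        refine ⟨?_, ?_, ?_, ?_⟩ <;> push_cast <;> ring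
      obtain ⟨h1, h2, h3, h4⟩ := hn
      fin_cases i
      · have h := congrArg (C : K⟦X⟧ → K⟦X⟧⟦X⟧) (qD_baseChange_eisQ (K := K))
        have hS : ((evalEis K (serreDer K (MvPolynomial.X 0)) : Polynomial K⟦X⟧) : K⟦X⟧⟦X⟧) =
            C (-4) * ((evalEis K (MvPolynomial.X 1) : Polynomial K⟦X⟧) : K⟦X⟧⟦X⟧) := by
          rw [show serreDer K (MvPolynomial.X 0) = -4 * MvPolynomial.X 1 by simp [serreDer],
            map_mul, map_neg, map_ofNat, ← map_ofNat Polynomial.C 4, ← map_neg, Polynomial.coe_mul,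
            Polynomial.coe_C]
        simp only [map_sub, map_mul, map_ofNat] at h
        simp only [Fin.zero_eta, hS, hQ, hR, qD_mul, cD_mul,
          qD_C, cD_C, h1, h3, map_neg, map_ofNat]
        linear_combination -4 * X ^ 6 * h
      · have h := congrArg (C : K⟦X⟧ → K⟦X⟧⟦X⟧) (qD_baseChange_eisR (K := K))
        have hS : ((evalEis K (serreDer K (MvPolynomial.X 1)) : Polynomial K⟦X⟧) : K⟦X⟧⟦X⟧) =
            C (-6) * ((evalEis K (MvPolynomial.X 0) : Polynomial K⟦X⟧) : K⟦X⟧⟦X⟧) ^ 2 := by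
          rw [show serreDer K (MvPolynomial.X 1) = -6 * MvPolynomial.X 0 ^ 2 by simp [serreDer],
            map_mul, map_neg, map_ofNat, ← map_ofNat Polynomial.C 6, ← map_neg, Polynomial.coe_mul,
            Polynomial.coe_C, map_pow, Polynomial.coe_pow]
        simp only [map_sub, map_mul, map_ofNat, map_pow] at h
        simp only [Fin.mk_one, hS, hQ, hR,
          qD_mul, cD_mul, qD_C, cD_C, h2, h4, map_neg, map_ofNat]
        linear_combination -6 * X ^ 8 * h
    simp only [Derivation.leibniz, map_add, map_mul, smul_eq_mul, Polynomial.coe_add,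
      Polynomial.coe_mul, hF, hX]
    ring

theorem IsForm.serreDer {F : MvPolynomial (Fin 2) K} {k : ℕ} {f : K⟦X⟧} (hF : IsForm F k f) :
    IsForm (serreDer K F) (k + 2) (12 * qD f - (k : K⟦X⟧) * baseChange K eisP * f) := by
  have h := coe_evalEis_serreDer F
  rw [hF] at h
  rw [IsForm, ← Polynomial.coe_inj, h]
  rw [Polynomial.coe_mul, Polynomial.coe_mul, Polynomial.coe_C, Polynomial.coe_C, Polynomial.coe_pow,
    Polynomial.coe_pow, Polynomial.coe_X]
  simp only [qD_mul, cD_mul, cD_C, qD_C, qD_X, Derivation.leibniz_pow, cD_X, map_sub, map_mul, map_ofNat,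
    map_natCast]
  rcases k with - | k
  · simp
    ring
  · simp only [Nat.add_sub_cancel]
    simp
    ring

end Algebra

end SptCongruence

namespace SptCongruence

open PowerSeries

section EndGame

variable {K : Type*} [Field K] {ℓ : ℕ} [CharP K ℓ]

theorem natCast_ne_zero_of_lt {n : ℕ} (h0 : 0 < n) (h : n < ℓ) : (n : K) ≠ 0 := fun hn =>
  absurd (Nat.le_of_dvd h0 ((CharP.cast_eq_zero_iff K ℓ n).1 hn)) (by omega)

theorem natCast_series_eq_zero : (ℓ : K⟦X⟧) = 0 := by
  rw [← map_natCast (C (R := K)), CharP.cast_eq_zero, map_zero]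

theorem six_ne_zero_of_prime (hℓ : ℓ.Prime) (h5 : 5 ≤ ℓ) : (6 : K) ≠ 0 := fun h => by
  have h1 : ((6 : ℕ) : K) = 0 := by simpa using h
  have h2 := (CharP.cast_eq_zero_iff K ℓ 6).1 h1
  have h3 := Nat.le_of_dvd (by norm_num) h2
  interval_cases ℓ
  · omega
  · norm_num at hℓ

theorem dvd_of_dvd_mul_of_isRelPrime {M : Type*} [CommRing M] [IsDomain M]
    [UniqueFactorizationMonoid M] {a b g x : M} (hab : IsRelPrime a b) (ha : g ∣ x * a)
    (hb : g ∣ x * b) : g ∣ x := by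
  let _ := UniqueFactorizationMonoid.toGCDMonoid M
  have h := (gcd_mul_left' x a b).dvd_iff_dvd_right.1 (dvd_gcd ha hb)
  rwa [((gcd_isUnit_iff_isRelPrime.2 hab)).dvd_mul_right] at h

theorem qD_baseChange_eisP {A : Type*} [CommRing A] : 12 * qD (baseChange A eisP) =
    baseChange A eisP ^ 2 - baseChange A eisQ := by
  have h : eisQ = eisP ^ 2 - 12 * qD eisP := rfl
  rw [h, map_sub, map_mul, map_pow, map_qD, map_ofNat]
  ring

theorem IsForm.eq_C_of_weight_zero {F : MvPolynomial (Fin 2) K} {f : K⟦X⟧}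
    (h6 : (6 : K) ≠ 0) (hF : IsForm F 0 f) : ∃ c : K, F = MvPolynomial.C c ∧ f = C c := by
  obtain ⟨c, g, hg, h⟩ := isobaric_decomposition (a := 0) (b := 0) (by norm_num) rfl
    hF.mem_isobaric
  have hg0 : g = 0 := hg.resolve_right fun ⟨j, hj, _⟩ => by omega
  have hf : f = C c := by simpa [hg0] using h
  refine ⟨c, hF.unique h6 ?_, hf⟩
  have h := (isForm_one (K := K)).smul c
  rwa [hf, ← mul_one (MvPolynomial.C c), ← mul_one (C c), ← MvPolynomial.smul_eq_C_mul,
    ← smul_eq_C_mul]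

/-- The Hasse invariant and its Serre derivative are coprime. -/
theorem isRelPrime_serreDer (hℓ : ℓ.Prime) (h5 : 5 ≤ ℓ) {A : MvPolynomial (Fin 2) K}
    (hA : IsForm A (ℓ - 1) 1) : IsRelPrime A (serreDer K A) := by
  have h6 : (6 : K) ≠ 0 := six_ne_zero_of_prime hℓ h5
  set B := serreDer K A with hB
  have hcast : ((ℓ - 1 : ℕ) : K⟦X⟧) = -1 := by
    rw [Nat.cast_sub hℓ.one_le, natCast_series_eq_zero]
    simp
  have hBf : IsForm B (ℓ + 1) (baseChange K eisP) := by
    have h := hA.serreDer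
    rw [show ℓ - 1 + 2 = ℓ + 1 by omega, hcast] at h
    convert h using 1
    have h1 : qD (1 : K⟦X⟧) = 0 := by simp
    rw [h1]
    ring
  have hB' : serreDer K B = -(MvPolynomial.X 0 * A) := by
    have h1 := hBf.serreDer
    have h2 := ((isForm_X_zero (K := K)).mul hA).smul (-1)
    rw [neg_one_smul, neg_one_smul, show 4 + (ℓ - 1) = ℓ + 1 + 2 by omega] at h2
    refine h1.unique h6 ?_
    convert h2 using 1
    rw [qD_baseChange_eisP, Nat.cast_add, natCast_series_eq_zero]
    push_cast
    ring
  have hA0 : A ≠ 0 := by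
    rintro rfl
    rw [IsForm, map_zero, map_one, one_mul] at hA
    exact pow_ne_zero _ Polynomial.X_ne_zero hA.symm
  obtain ⟨a, b, g, hab, hga, hgb⟩ :=
    UniqueFactorizationMonoid.exists_reduced_factors A hA0 B
  obtain ⟨f, f', d, e, hg, -, hde, hff⟩ := hA.exists_factors one_ne_zero hga.symm
  have hdvd : g ∣ serreDer K g := by
    refine dvd_of_dvd_mul_of_isRelPrime hab ?_ ?_
    · have h : B = g * serreDer K a + serreDer K g * a := by
        rw [hB, ← hga, Derivation.leibniz, smul_eq_mul, smul_eq_mul]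
        ring
      refine (dvd_add_right (Dvd.intro _ rfl)).1 (h ▸ ?_ : g ∣ g * serreDer K a + _)
      exact Dvd.intro _ hgb
    · have h : serreDer K B = g * serreDer K b + serreDer K g * b := by
        rw [← hgb, Derivation.leibniz, smul_eq_mul, smul_eq_mul]
        ring
      have h2 : g ∣ serreDer K B := by
        rw [hB', dvd_neg]
        exact Dvd.dvd.mul_left (Dvd.intro _ hga) _
      rw [h] at h2
      exact (dvd_add_right (Dvd.intro _ rfl)).1 h2
  have hzero : 12 * qD f - (d : K⟦X⟧) * baseChange K eisP * f = 0 := by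
    by_contra hne
    obtain ⟨u, hu⟩ := hdvd
    obtain ⟨y, z, i, j, hgi, huj, hij, hyz⟩ := hg.serreDer.exists_factors hne hu
    have hgne : g ≠ 0 := left_ne_zero_of_mul (hga ▸ hA0)
    have hid : i = d := by
      have h1 : (evalEis K g).natDegree = i := by
        have hy : y ≠ 0 := left_ne_zero_of_mul (hyz ▸ hne)
        rw [hgi, Polynomial.natDegree_C_mul_X_pow _ _ hy]
      have hf : f ≠ 0 := left_ne_zero_of_mul (hff ▸ one_ne_zero)
      rw [← h1, hg, Polynomial.natDegree_C_mul_X_pow _ _ hf]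
    obtain rfl : j = 2 := by omega
    rw [huj.eq_zero_of_weight_two h6, mul_zero] at hu
    have h1 := hg.serreDer
    rw [hu, IsForm, map_zero] at h1
    have h2 := (mul_eq_zero.1 h1.symm).resolve_right (pow_ne_zero _ Polynomial.X_ne_zero)
    exact hne (Polynomial.C_eq_zero.1 h2)
  have hd : d = 0 := by
    by_contra hd
    have h := congrArg constantCoeff hzero
    rw [map_sub, map_mul, map_mul, map_mul, constantCoeff_qD, constantCoeff_baseChange,
      constantCoeff_eisP, map_natCast, map_zero] at h
    have hf : constantCoeff f ≠ 0 := by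
      have := congrArg constantCoeff hff
      rw [map_mul, map_one] at this
      exact left_ne_zero_of_mul (this ▸ one_ne_zero)
    have hd' : (d : K) ≠ 0 := natCast_ne_zero_of_lt (ℓ := ℓ) (by omega) (by omega)
    simp_all
  subst hd
  obtain ⟨c, hc, hfc⟩ := hg.eq_C_of_weight_zero h6
  have hunit : IsUnit g := by
    rw [hc]
    refine IsUnit.map _ (isUnit_iff_ne_zero.2 ?_)
    rintro rfl
    rw [hfc, map_zero, zero_mul] at hff
    exact zero_ne_one hff
  intro x hx hy
  rw [← hga, hunit.dvd_mul_left] at hx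
  rw [← hgb, hunit.dvd_mul_left] at hy
  exact hab hx hy

end EndGame

end SptCongruence

namespace SptCongruence

open PowerSeries

section EndGame

/-- The operator `24 q d/dq - P`. -/
noncomputable def twistedD (A : Type*) [CommRing A] (f : A⟦X⟧) : A⟦X⟧ :=
  24 * qD f - baseChange A eisP * f

variable {K : Type*} [Field K] {ℓ : ℕ} [CharP K ℓ]

theorem eq_zero_of_iterate_twistedD (hℓ : ℓ.Prime) {r : ℕ} (hr : ℓ = 2 * r + 1) (h5 : 5 ≤ ℓ)
    (h1 : (1 : K⟦X⟧) ∈ isobaric K (ℓ - 1)) {G : K⟦X⟧} (hG : G ∈ isobaric K (ℓ + 1)) {c : K}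
    (hGc : (twistedD K)^[r] G = C c * G) : G = 0 := by
  have h6 : (6 : K) ≠ 0 := six_ne_zero_of_prime hℓ h5
  obtain ⟨A, hA⟩ := exists_isForm h1
  obtain ⟨F₀, hF₀⟩ := exists_isForm hG
  have hcop := isRelPrime_serreDer hℓ h5 hA
  have hB : IsForm (serreDer K A) (ℓ + 1) (baseChange K eisP) := by
    have h := hA.serreDer
    rw [show ℓ - 1 + 2 = ℓ + 1 by omega, Nat.cast_sub hℓ.one_le, natCast_series_eq_zero] at h
    convert h using 1
    have h1 : qD (1 : K⟦X⟧) = 0 := by simp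
    rw [h1]
    simp
  obtain ⟨F, hF0, hFs⟩ : ∃ F : ℕ → MvPolynomial (Fin 2) K, F 0 = F₀ ∧ ∀ i, F (i + 1) =
      (2 : K) • (A * serreDer K (F i)) + (2 * i + 1 : K) • (serreDer K A * F i) :=
    ⟨fun n => Nat.rec F₀ (fun i f => (2 : K) • (A * serreDer K f) +
      (2 * i + 1 : K) • (serreDer K A * f)) n, rfl, fun _ => rfl⟩
  have hF : ∀ i, IsForm (F i) ((ℓ + 1) * (i + 1)) ((twistedD K)^[i] G) := fun i => by
    induction i with
    | zero =>
      rw [zero_add, mul_one, hF0]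
      exact hF₀
    | succ i ih =>
      have h2 := (hA.mul ih.serreDer).smul 2
      have h3 := (hB.mul ih).smul (2 * i + 1 : K)
      rw [show ℓ - 1 + ((ℓ + 1) * (i + 1) + 2) = (ℓ + 1) * (i + 1 + 1) by
        obtain ⟨m, rfl⟩ : ∃ m, ℓ = m + 1 := ⟨ℓ - 1, by omega⟩
        simp only [Nat.add_sub_cancel]
        ring] at h2
      rw [show ℓ + 1 + (ℓ + 1) * (i + 1) = (ℓ + 1) * (i + 1 + 1) by ring] at h3
      rw [hFs]
      convert h2.add h3 using 1
      rw [Function.iterate_succ_apply', smul_eq_C_mul, smul_eq_C_mul, Nat.cast_mul, Nat.cast_add,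
        natCast_series_eq_zero, twistedD]
      simp only [map_add, map_mul, map_natCast, map_ofNat, map_one]
      push_cast
      ring
  have hFr : F r = c • (A ^ (r + 1) * F₀) := by
    refine (hF r).unique h6 ?_
    have h := ((hA.pow (r + 1)).mul hF₀).smul c
    rw [show (ℓ - 1) * (r + 1) + (ℓ + 1) = (ℓ + 1) * (r + 1) by
      rw [hr, Nat.add_sub_cancel]
      ring] at h
    rwa [one_pow, one_mul, smul_eq_C_mul, ← hGc] at h
  have hdvd : ∀ j i, i + j = r → A ∣ F i := fun j => by
    induction j with
    | zero =>
      intro i hi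
      obtain rfl : i = r := by omega
      rw [hFr, pow_succ', mul_assoc, MvPolynomial.smul_eq_C_mul]
      exact Dvd.dvd.mul_left (dvd_mul_right _ _) _
    | succ j ih =>
      intro i hi
      have h2 : A ∣ (2 : K) • (A * serreDer K (F i)) + (2 * i + 1 : K) • (serreDer K A * F i) :=
        hFs i ▸ ih (i + 1) (by omega)
      have h3 : A ∣ (2 : K) • (A * serreDer K (F i)) := by
        rw [MvPolynomial.smul_eq_C_mul]
        exact Dvd.dvd.mul_left (dvd_mul_right _ _) _
      have h4 := (dvd_add_right h3).1 h2
      have h5 : (2 * i + 1 : K) ≠ 0 := by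
        have := natCast_ne_zero_of_lt (K := K) (ℓ := ℓ) (n := 2 * i + 1) (by omega) (by omega)
        exact_mod_cast this
      rw [MvPolynomial.smul_eq_C_mul, ((isUnit_iff_ne_zero.2 h5).map _).dvd_mul_left] at h4
      exact hcop.dvd_of_dvd_mul_left h4
  obtain ⟨H, hH⟩ := hdvd r 0 (by omega)
  have hH' : F₀ = A * H := hF0 ▸ hH
  by_contra hG0
  obtain ⟨y, z, i, j, hi, hj, hij, hyz⟩ := hF₀.exists_factors hG0 hH'
  have hid : i = ℓ - 1 := by
    have hy : y ≠ 0 := left_ne_zero_of_mul (hyz ▸ hG0)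
    rw [← Polynomial.natDegree_C_mul_X_pow i y hy, ← hi, hA,
      Polynomial.natDegree_C_mul_X_pow _ _ one_ne_zero]
  obtain rfl : j = 2 := by omega
  rw [hH', hj.eq_zero_of_weight_two h6, mul_zero, IsForm, map_zero] at hF₀
  exact hG0 (Polynomial.C_eq_zero.1
    ((mul_eq_zero.1 hF₀.symm).resolve_right (pow_ne_zero _ Polynomial.X_ne_zero)))

end EndGame

end SptCongruence

namespace SptCongruence

open PowerSeries

section Reduction

variable (K : Type*) [Field K]

/-- The graph of the reduction map from the rationals with denominator invertible in `K`. -/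
def reductionGraph : Subring (ℚ × K) where
  carrier := {p | (p.1.den : K) ≠ 0 ∧ (p.1 : K) = p.2}
  mul_mem' := by
    rintro ⟨x, a⟩ ⟨y, b⟩ ⟨hx, rfl : (x : K) = a⟩ ⟨hy, rfl : (y : K) = b⟩
    refine ⟨fun h => ?_, Rat.cast_mul_of_ne_zero hx hy⟩
    obtain ⟨c, hc⟩ := Rat.mul_den_dvd x y
    have h1 := congrArg (Nat.cast (R := K)) hc
    rw [Nat.cast_mul, Nat.cast_mul] at h1
    have h2 : (((x * y : ℚ).den : ℕ) : K) = 0 := h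
    rw [h2, zero_mul] at h1
    exact mul_ne_zero hx hy h1
  one_mem' := by simp
  add_mem' := by
    rintro ⟨x, a⟩ ⟨y, b⟩ ⟨hx, rfl : (x : K) = a⟩ ⟨hy, rfl : (y : K) = b⟩
    refine ⟨fun h => ?_, Rat.cast_add_of_ne_zero hx hy⟩
    obtain ⟨c, hc⟩ := Rat.add_den_dvd x y
    have h1 := congrArg (Nat.cast (R := K)) hc
    rw [Nat.cast_mul, Nat.cast_mul] at h1
    have h2 : (((x + y : ℚ).den : ℕ) : K) = 0 := h
    rw [h2, zero_mul] at h1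
    exact mul_ne_zero hx hy h1
  zero_mem' := by simp
  neg_mem' := by
    rintro ⟨x, a⟩ ⟨hx, rfl : (x : K) = a⟩
    exact ⟨by simpa using hx, by simp⟩

variable {K}

/-- `x` reduces to `a` in `K`. -/
def Reduces (x : ℚ) (a : K) : Prop :=
  (x, a) ∈ reductionGraph K

/-- The coefficients of `f` reduce to those of `g`. -/
def SeriesReduces (f : ℚ⟦X⟧) (g : K⟦X⟧) : Prop :=
  ∀ n, Reduces (coeff n f) (coeff n g)

namespace Reduces

variable {x y : ℚ} {a b : K}

theorem add (h : Reduces x a) (h' : Reduces y b) : Reduces (x + y) (a + b) := add_mem h h'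

theorem mul (h : Reduces x a) (h' : Reduces y b) : Reduces (x * y) (a * b) := mul_mem h h'

theorem neg (h : Reduces x a) : Reduces (-x) (-a) := (reductionGraph K).neg_mem h

theorem sub (h : Reduces x a) (h' : Reduces y b) : Reduces (x - y) (a - b) := sub_mem h h'

theorem pow (h : Reduces x a) (n : ℕ) : Reduces (x ^ n) (a ^ n) := pow_mem h n

theorem zero : Reduces (0 : ℚ) (0 : K) := zero_mem (reductionGraph K)

theorem one : Reduces (1 : ℚ) (1 : K) := one_mem (reductionGraph K)

theorem natCast (n : ℕ) : Reduces (n : ℚ) (n : K) := natCast_mem (reductionGraph K) n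

theorem intCast (n : ℤ) : Reduces (n : ℚ) (n : K) := intCast_mem (reductionGraph K) n

theorem sum {ι : Type*} {s : Finset ι} {f : ι → ℚ} {g : ι → K}
    (h : ∀ i ∈ s, Reduces (f i) (g i)) : Reduces (∑ i ∈ s, f i) (∑ i ∈ s, g i) := by
  classical
  induction s using Finset.induction_on with
  | empty => simpa using zero
  | insert i s hi ih =>
    rw [Finset.sum_insert hi, Finset.sum_insert hi]
    exact (h i (Finset.mem_insert_self i s)).add
      (ih fun j hj => h j (Finset.mem_insert_of_mem hj))

theorem unique (h : Reduces x a) (h' : Reduces x b) : a = b := h.2.symm.trans h'.2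

theorem inv (h : Reduces x a) (ha : a ≠ 0) : Reduces x⁻¹ a⁻¹ := by
  obtain ⟨hx, rfl : (x : K) = a⟩ := h
  simp only at hx ha ⊢
  have hn : (x.num : K) ≠ 0 := fun h => ha (by rw [Rat.cast_def, h, zero_div])
  have hn' : (x.num.natAbs : K) ≠ 0 := fun h => hn (by
    rcases Int.natAbs_eq x.num with h1 | h1
    · rw [h1, Int.cast_natCast, h]
    · rw [h1, Int.cast_neg, Int.cast_natCast, h, neg_zero])
  have hd : ((x⁻¹).den : K) ≠ 0 := by
    rw [Rat.den_inv]
    split_ifs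
    · simp
    · exact hn'
  refine ⟨hd, ?_⟩
  have h1 : ((x⁻¹ * x : ℚ) : K) = (x⁻¹ : ℚ) * (x : K) := Rat.cast_mul_of_ne_zero hd hx
  rw [inv_mul_cancel₀ (by rintro rfl; simp at ha), Rat.cast_one] at h1
  exact eq_inv_of_mul_eq_one_left h1.symm

theorem div (h : Reduces x a) (h' : Reduces y b) (hb : b ≠ 0) : Reduces (x / y) (a / b) := by
  rw [div_eq_mul_inv, div_eq_mul_inv]
  exact h.mul (h'.inv hb)

end Reduces

namespace SeriesReduces

variable {f f' : ℚ⟦X⟧} {g g' : K⟦X⟧}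

theorem add (h : SeriesReduces f g) (h' : SeriesReduces f' g') :
    SeriesReduces (f + f') (g + g') := fun n => by
  rw [map_add, map_add]
  exact (h n).add (h' n)

theorem neg (h : SeriesReduces f g) : SeriesReduces (-f) (-g) := fun n => by
  rw [map_neg, map_neg]
  exact (h n).neg

theorem sub (h : SeriesReduces f g) (h' : SeriesReduces f' g') :
    SeriesReduces (f - f') (g - g') := fun n => by
  rw [map_sub, map_sub]
  exact (h n).sub (h' n)

theorem mul (h : SeriesReduces f g) (h' : SeriesReduces f' g') :
    SeriesReduces (f * f') (g * g') := fun n => by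
  rw [coeff_mul, coeff_mul]
  exact Reduces.sum fun p _ => (h p.1).mul (h' p.2)

theorem const {x : ℚ} {a : K} (h : Reduces x a) :
    SeriesReduces (C x) (C a) := fun n => by
  rw [coeff_C, coeff_C]
  split_ifs
  exacts [h, Reduces.zero]

theorem ofInt (f : ℤ⟦X⟧) : SeriesReduces (baseChange ℚ f) (baseChange K f) := fun n => by
  rw [coeff_map, coeff_map]
  exact Reduces.intCast _

theorem one : SeriesReduces (1 : ℚ⟦X⟧) (1 : K⟦X⟧) := by
  simpa using const (K := K) Reduces.one

theorem zero : SeriesReduces (0 : ℚ⟦X⟧) (0 : K⟦X⟧) := by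
  simpa using const (K := K) Reduces.zero

theorem pow (h : SeriesReduces f g) (n : ℕ) : SeriesReduces (f ^ n) (g ^ n) := by
  induction n with
  | zero => simpa using one
  | succ n ih => rw [pow_succ, pow_succ]; exact ih.mul h

theorem sum {ι : Type*} {s : Finset ι} {f : ι → ℚ⟦X⟧} {g : ι → K⟦X⟧}
    (h : ∀ i ∈ s, SeriesReduces (f i) (g i)) :
    SeriesReduces (∑ i ∈ s, f i) (∑ i ∈ s, g i) := fun n => by
  rw [map_sum, map_sum]
  exact Reduces.sum fun i hi => h i hi n

theorem euler (h : SeriesReduces f g) : SeriesReduces (qD f)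
    (qD g) := fun n => by
  rw [coeff_qD, coeff_qD]
  exact (Reduces.natCast n).mul (h n)

theorem unique (h : SeriesReduces f g) (h' : SeriesReduces f g') : g = g' :=
  PowerSeries.ext fun n => (h n).unique (h' n)

theorem inv (h : SeriesReduces f g) (hg : constantCoeff g ≠ 0) :
    SeriesReduces f⁻¹ g⁻¹ := fun n => by
  have h0 : Reduces (constantCoeff f)⁻¹ (constantCoeff g)⁻¹ := by
    refine Reduces.inv ?_ hg
    simpa using h 0
  induction n using Nat.strong_induction_on with
  | _ n ih =>
    rw [coeff_inv, coeff_inv]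
    split_ifs
    · exact h0
    · refine h0.neg.mul (Reduces.sum fun p _ => ?_)
      split_ifs with hp
      · exact (h p.1).mul (ih p.2 hp)
      · exact Reduces.zero

end SeriesReduces

theorem exists_weight_pair (k : ℕ) : (∃ a b, b ≤ 1 ∧ 4 * a + 6 * b = k) ∨
    ∀ a b : ℕ, 4 * a + 6 * b ≠ k := by
  by_cases h : ∃ a b : ℕ, 4 * a + 6 * b = k
  · obtain ⟨a, b, h⟩ := h
    exact Or.inl ⟨a + 3 * (b / 2), b % 2, by omega, by omega⟩
  · push Not at h
    exact Or.inr h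

/-- Reduction preserves isobaric polynomials in the Eisenstein series. -/
theorem SeriesReduces.mem_isobaric (h6 : (6 : K) ≠ 0) {k : ℕ} {f : ℚ⟦X⟧} {g : K⟦X⟧}
    (h : SeriesReduces f g) (hf : f ∈ isobaric ℚ k) : g ∈ isobaric K k := by
  induction k using Nat.strong_induction_on generalizing f g with
  | _ k ih =>
  rcases exists_weight_pair k with ⟨a, b, hb, hab⟩ | hk
  swap
  · rw [isobaric_eq_bot hk, Submodule.mem_bot] at hf
    subst hf
    rw [h.unique SeriesReduces.zero]
    exact zero_mem _
  obtain ⟨c, u, hu, hfc⟩ := isobaric_decomposition hb hab hf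
  obtain ⟨M, hM⟩ : ∃ M : ℤ⟦X⟧, M = eisQ ^ a * eisR ^ b := ⟨_, rfl⟩
  have hMb : ∀ (A : Type) [CommRing A], baseChange A eisQ ^ a * baseChange A eisR ^ b =
      baseChange A M := fun A _ => by rw [hM, map_mul, map_pow, map_pow]
  have hMK : baseChange K eisQ ^ a * baseChange K eisR ^ b = baseChange K M := by
    rw [hM, map_mul, map_pow, map_pow]
  have hM1 : baseChange K M ∈ isobaric K k := hMK ▸ monomial_mem_isobaric hab
  have hc : Reduces c (constantCoeff g) := by
    have h1 : constantCoeff f = c := by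
      rw [hfc, hMb, map_add, map_mul, map_mul, constantCoeff_baseChange,
        constantCoeff_baseChange, constantCoeff_discriminant, hM, map_mul, map_pow, map_pow,
        constantCoeff_eisQ, constantCoeff_eisR]
      simp
    have h2 := h 0
    rwa [coeff_zero_eq_constantCoeff_apply, coeff_zero_eq_constantCoeff_apply, h1] at h2
  set g' := g - C (constantCoeff g) * baseChange K M with hg'
  have hred : SeriesReduces (baseChange ℚ (eisQ ^ 3 - eisR ^ 2) * u) g' := by
    have h1 := h.sub ((SeriesReduces.const hc).mul (SeriesReduces.ofInt M))
    rwa [hfc, hMb, add_sub_cancel_left] at h1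
  have hgg : g = C (constantCoeff g) * baseChange K M + g' := by rw [hg']; ring
  rw [hgg]
  refine add_mem (C_mul_mem_isobaric _ hM1) ?_
  rcases hu with rfl | ⟨j, hj, hu⟩
  · rw [mul_zero] at hred
    rw [hred.unique SeriesReduces.zero]
    exact zero_mem _
  obtain ⟨U, hU⟩ := X_dvd_iff.2 constantCoeff_discriminant
  have hU0 : constantCoeff U = 1728 := by
    have h1 := coeff_one_discriminant
    rwa [hU, ← zero_add 1, coeff_succ_X_mul, coeff_zero_eq_constantCoeff_apply] at h1
  have hUK : constantCoeff (baseChange K U) ≠ 0 := by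
    rw [constantCoeff_baseChange, hU0]
    have h2 : (6 : K) ^ 3 * 8 ≠ 0 := mul_ne_zero (pow_ne_zero _ h6) fun h8 => by
      have : (6 : K) ^ 3 = 8 * 27 := by norm_num
      exact pow_ne_zero 3 h6 (by rw [this, h8, zero_mul])
    norm_num at h2 ⊢
    exact h2
  have hUQ : constantCoeff (baseChange ℚ U) ≠ 0 := by
    rw [constantCoeff_baseChange, hU0]
    norm_num
  obtain ⟨w, hw⟩ : (X : K⟦X⟧) ∣ g' := by
    rw [X_dvd_iff, ← coeff_zero_eq_constantCoeff_apply]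
    refine (hred 0).unique ?_
    rw [coeff_zero_eq_constantCoeff_apply, map_mul, constantCoeff_baseChange,
      constantCoeff_discriminant, Int.cast_zero, zero_mul]
    exact Reduces.zero
  have hX : ∀ (A : Type) [CommRing A], baseChange A (X * U) = X * baseChange A U :=
    fun A _ => by rw [map_mul, map_X]
  have hred' : SeriesReduces (baseChange ℚ U * u) w := fun n => by
    have h1 := hred (n + 1)
    rwa [hU, hX, mul_assoc, hw, coeff_succ_X_mul, coeff_succ_X_mul] at h1
  have h3 := ((SeriesReduces.ofInt U).inv hUK).mul hred'
  rw [← mul_assoc, PowerSeries.inv_mul_cancel _ hUQ, one_mul] at h3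
  have h4 := mul_mem_isobaric (isForm_discriminant (K := K)).mem_isobaric
    (ih j (by omega) h3 hu)
  rw [show 12 + j = k by omega, hU, map_mul, map_X, ← mul_assoc, mul_assoc X,
    PowerSeries.mul_inv_cancel _ hUK, mul_one, ← hw] at h4
  exact h4

end Reduction

end SptCongruence

namespace SptCongruence

open PowerSeries

/-- The coefficient of `X ^ i` is isobaric of weight `2 * i`. -/
def IsGraded (F : ℚ⟦X⟧⟦X⟧) : Prop :=
  ∀ i, coeff i F ∈ isobaric ℚ (2 * i)

theorem IsGraded.mul {F G : ℚ⟦X⟧⟦X⟧} (hF : IsGraded F) (hG : IsGraded G) :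
    IsGraded (F * G) := fun i => by
  rw [coeff_mul]
  refine sum_mem fun p hp => ?_
  rw [← mem_antidiagonal.1 hp, mul_add]
  exact mul_mem_isobaric (hF _) (hG _)

theorem mem_isobaric_of_C_mul {k : ℕ} {c : ℚ} (hc : c ≠ 0) {f : ℚ⟦X⟧}
    (h : C c * f ∈ isobaric ℚ k) : f ∈ isobaric ℚ k := by
  have := C_mul_mem_isobaric c⁻¹ h
  rwa [← mul_assoc, ← map_mul, inv_mul_cancel₀ hc, map_one, one_mul] at this

theorem constantCoeff_expSer (a : ℚ⟦X⟧) : constantCoeff (expSer a) = 1 := by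
  rw [← coeff_zero_eq_constantCoeff_apply, coeff_expSer]
  simp

theorem constantCoeff_yHat : constantCoeff yHat = 1 := by
  rw [yHat, map_mul, constantCoeff_expSer, constantCoeff_ySer, one_mul]

theorem coeff_yHat_succ (i : ℕ) :
    C (36 * (16 * (i + 1) ^ 2 + 8 * (i + 1)) : ℚ) * coeff (i + 1) yHat =
      C 24 * (12 * qD (coeff i yHat) - ((2 * i : ℕ) : ℚ⟦X⟧) * eisPQ * coeff i yHat) -
        coeff i (X * (C eisQQ * yHat)) := by
  have h := congrArg (coeff (i + 1)) yHat_ode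
  rw [pow_two, mul_assoc X X, mul_assoc X (X * _), mul_assoc X, map_sub, coeff_succ_X_mul,
    coeff_succ_X_mul, map_sub, ofNat_eq_C 36, ofNat_eq_C 16, ofNat_eq_C 8, ofNat_eq_C 288,
    ofNat_eq_C 48, mul_assoc, coeff_C_mul, coeff_C_mul, coeff_C_mul, map_add, coeff_C_mul,
    coeff_C_mul, coeff_C_mul, coeff_qD, coeff_qD, coeff_qD, coeff_cD] at h
  push_cast at h ⊢
  simp only [map_mul, map_add, map_pow, map_natCast, map_ofNat, map_one]
  linear_combination h

theorem isGraded_yHat : IsGraded yHat := fun i => by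
  induction i using Nat.strong_induction_on with
  | _ i ih =>
    rcases i with - | i
    · rw [coeff_zero_eq_constantCoeff_apply, constantCoeff_yHat]
      exact one_mem_isobaric
    · refine mem_isobaric_of_C_mul (c := 36 * (16 * (i + 1) ^ 2 + 8 * (i + 1))) (by positivity) ?_
      rw [coeff_yHat_succ]
      refine sub_mem (C_mul_mem_isobaric _ (serre_mem_isobaric (ih i (by omega)))) ?_
      rcases i with - | i
      · rw [coeff_zero_X_mul]
        exact zero_mem _
      · rw [coeff_succ_X_mul, coeff_C_mul, show 2 * (i + 1 + 1) = 4 + 2 * i by ring]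
        exact mul_mem_isobaric eisQ_mem_isobaric (ih i (by omega))

theorem isGraded_betaHat : IsGraded betaHat := fun i => by
  have hZ : IsGraded (yHat ^ 3) := by
    rw [pow_succ, pow_two]
    exact (isGraded_yHat.mul isGraded_yHat).mul isGraded_yHat
  induction i using Nat.strong_induction_on with
  | _ i ih =>
    have h := congrArg (coeff i) betaHat_mul_yHat_pow
    rw [coeff_mul, Finset.Nat.sum_antidiagonal_eq_sum_range_succ_mk, Finset.sum_range_succ,
      Nat.sub_self, coeff_zero_eq_constantCoeff_apply (R := ℚ⟦X⟧) (φ := yHat ^ 3), map_pow,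
      constantCoeff_yHat, one_pow, mul_one, ofNat_eq_C 8] at h
    rw [← eq_sub_iff_add_eq'] at h
    rw [h]
    refine sub_mem ?_ (sum_mem fun j hj => ?_)
    · rw [← map_neg, coeff_C]
      split_ifs with h0
      · subst h0
        rw [ofNat_eq_C 8, ← map_neg, ← mul_one (C _)]
        exact C_mul_mem_isobaric _ one_mem_isobaric
      · exact zero_mem _
    · have hj' := Finset.mem_range.1 hj
      have := mul_mem_isobaric (ih j hj') (hZ (i - j))
      rwa [show 2 * j + 2 * (i - j) = 2 * i by omega] at this

theorem coeff_wHat_succ (i : ℕ) :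
    C (8 * (2 * (i + 1) - 1) * i : ℚ) * coeff (i + 1) wHat =
      C 12 * coeff (i + 1) betaHat -
        C 2 * (12 * qD (coeff i wHat) - ((2 * i : ℕ) : ℚ⟦X⟧) * eisPQ * coeff i wHat) -
        coeff i (X * (C (C (1 / 4) * eisQQ) * wHat)) := by
  have h := congrArg (coeff (i + 1)) wHat_ode
  rw [pow_two, mul_assoc X X, mul_assoc X (X * _), mul_assoc X (C _), map_add, map_add, map_add, map_sub,
    coeff_succ_X_mul, coeff_succ_X_mul, map_sub, ofNat_eq_C 24, ofNat_eq_C 16, ofNat_eq_C 8,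
    ofNat_eq_C 4, ofNat_eq_C 12, mul_assoc (C 4), coeff_C_mul, coeff_C_mul, coeff_C_mul,
    coeff_C_mul, coeff_C_mul, coeff_C_mul, coeff_C_mul, coeff_qD, coeff_qD, coeff_qD,
    coeff_cD] at h
  generalize coeff i (X * (C (C (1 / 4) * eisQQ) * wHat)) = z at h ⊢
  push_cast at h ⊢
  simp only [map_mul, map_add, map_sub, map_natCast, map_ofNat, map_one] at h ⊢
  linear_combination h

theorem constantCoeff_wHat : constantCoeff wHat = -12 := by
  rw [wHat, map_mul, constantCoeff_expSer, constantCoeff_wSer, one_mul]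

theorem coeff_one_wHat : coeff 1 wHat = 0 := by
  rw [wHat, coeff_one_mul, coeff_one_wSer, constantCoeff_expSer, constantCoeff_wSer,
    coeff_expSer, ofNat_eq_C 12, mul_assoc, mul_assoc]
  simp only [pow_one, Nat.factorial_one, Nat.cast_one, div_one, map_one, one_mul]
  rw [show (3 / 2 : ℚ) = 1 / 8 * 12 by norm_num, map_mul]
  ring

theorem isGraded_wHat : IsGraded wHat := fun i => by
  induction i using Nat.strong_induction_on with
  | _ i ih =>
    rcases i with - | - | i
    · rw [coeff_zero_eq_constantCoeff_apply, constantCoeff_wHat, ofNat_eq_C 12, ← map_neg,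
        ← mul_one (C _)]
      exact C_mul_mem_isobaric _ one_mem_isobaric
    · rw [zero_add, coeff_one_wHat]
      exact zero_mem _
    · have hc : (8 * (2 * ((i + 1 : ℕ) + 1) - 1) * ((i + 1 : ℕ) : ℚ)) ≠ 0 := by
        push_cast
        rw [show (2 * ((i : ℚ) + 1 + 1) - 1) = 2 * i + 3 by ring]
        positivity
      refine mem_isobaric_of_C_mul hc ?_
      rw [coeff_wHat_succ]
      refine sub_mem (sub_mem (C_mul_mem_isobaric _ (isGraded_betaHat _))
        (C_mul_mem_isobaric _ (serre_mem_isobaric (ih (i + 1) (by omega))))) ?_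
      rw [coeff_succ_X_mul, coeff_C_mul, mul_assoc, show 2 * (i + 1 + 1) = 4 + 2 * i by ring]
      exact C_mul_mem_isobaric _ (mul_mem_isobaric eisQ_mem_isobaric (ih i (by omega)))

end SptCongruence

namespace SptCongruence

open PowerSeries

theorem Reduces.ofNat {K : Type*} [Field K] (n : ℕ) [n.AtLeastTwo] :
    Reduces (OfNat.ofNat n : ℚ) (OfNat.ofNat n : K) := by
  have h := Reduces.natCast (K := K) (OfNat.ofNat n)
  rwa [Nat.cast_ofNat, Nat.cast_ofNat] at h

section Csch

variable {ℓ m : ℕ} [Fact ℓ.Prime]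

theorem Reduces.factorial_mul {x : ℚ} {a : ZMod ℓ} (h : Reduces x a) :
    Reduces ((ℓ.factorial : ℚ) * x) (0 : ZMod ℓ) := by
  have h1 := (Reduces.natCast (K := ZMod ℓ) ℓ.factorial).mul h
  have h2 : ((ℓ.factorial : ℕ) : ZMod ℓ) = 0 := by
    rw [ZMod.natCast_eq_zero_iff]
    exact Nat.dvd_factorial (Fact.out : ℓ.Prime).pos le_rfl
  rwa [h2, zero_mul] at h1

theorem natCast_factorial_ne_zero {n : ℕ} (h : n < ℓ) : (n.factorial : ZMod ℓ) ≠ 0 := by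
  rw [Ne, ZMod.natCast_eq_zero_iff, (Fact.out : ℓ.Prime).dvd_factorial]
  omega

theorem six_ne_zero_zmod (hm : ℓ = 2 * m + 5) : (6 : ZMod ℓ) ≠ 0 :=
  six_ne_zero_of_prime (ℓ := ℓ) Fact.out (by omega)

theorem two_ne_zero_zmod (hm : ℓ = 2 * m + 5) : (2 : ZMod ℓ) ≠ 0 := fun h =>
  six_ne_zero_zmod hm (by rw [show (6 : ZMod ℓ) = 2 * 3 by norm_num, h, zero_mul])

theorem four_ne_zero_zmod (hm : ℓ = 2 * m + 5) : (4 : ZMod ℓ) ≠ 0 := by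
  rw [show (4 : ZMod ℓ) = 2 * 2 by norm_num]
  exact mul_ne_zero (two_ne_zero_zmod hm) (two_ne_zero_zmod hm)

theorem eight_ne_zero_zmod (hm : ℓ = 2 * m + 5) : (8 : ZMod ℓ) ≠ 0 := by
  rw [show (8 : ZMod ℓ) = 2 * 4 by norm_num]
  exact mul_ne_zero (two_ne_zero_zmod hm) (four_ne_zero_zmod hm)

theorem twentyFour_ne_zero_zmod (hm : ℓ = 2 * m + 5) : (24 : ZMod ℓ) ≠ 0 := by
  rw [show (24 : ZMod ℓ) = 6 * 4 by norm_num]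
  exact mul_ne_zero (six_ne_zero_zmod hm) (four_ne_zero_zmod hm)

theorem four_pow_eq_one (hm : ℓ = 2 * m + 5) : (4 : ZMod ℓ) ^ (m + 2) = 1 := by
  rw [show (4 : ZMod ℓ) = 2 ^ 2 by norm_num, ← pow_mul, show 2 * (m + 2) = ℓ - 1 by omega]
  exact ZMod.pow_card_sub_one_eq_one (two_ne_zero_zmod hm)

theorem exists_reduces_sinhCoeff (hm : ℓ = 2 * m + 5) {i : ℕ} (hi : i < m + 2) :
    ∃ a : ZMod ℓ, Reduces (sinhCoeff i) a :=
  ⟨_, Reduces.one.div (((Reduces.ofNat 4).pow i).mul (Reduces.natCast _))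
    (mul_ne_zero (pow_ne_zero _ (four_ne_zero_zmod hm))
      (natCast_factorial_ne_zero (by omega)))⟩

theorem reduces_factorial_mul_sinhCoeff (hm : ℓ = 2 * m + 5) :
    Reduces ((ℓ.factorial : ℚ) * sinhCoeff (m + 2)) (1 : ZMod ℓ) := by
  have h := (Reduces.one (K := ZMod ℓ)).div ((Reduces.ofNat 4).pow (m + 2))
    (pow_ne_zero _ (four_ne_zero_zmod hm))
  rw [four_pow_eq_one hm, div_one] at h
  convert h using 1
  rw [sinhCoeff, show 2 * (m + 2) + 1 = ℓ by omega]
  have : (ℓ.factorial : ℚ) ≠ 0 := by positivity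
  field_simp

theorem reduces_factorial_mul_sinhCoeff_succ (hm : ℓ = 2 * m + 5) :
    Reduces ((ℓ.factorial : ℚ) * sinhCoeff (m + 3)) (1 / 8 : ZMod ℓ) := by
  have h0 : (4 : ZMod ℓ) ^ (m + 3) * ((ℓ + 1) * (ℓ + 2)) = 8 := by
    rw [pow_succ, four_pow_eq_one hm, CharP.cast_eq_zero]
    norm_num
  have h1 := ((Reduces.ofNat (K := ZMod ℓ) 4).pow (m + 3)).mul
    (((Reduces.natCast ℓ).add Reduces.one).mul ((Reduces.natCast ℓ).add (Reduces.ofNat 2)))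
  have h := (Reduces.one (K := ZMod ℓ)).div h1 (by rw [h0]; exact eight_ne_zero_zmod hm)
  rw [h0] at h
  convert h using 1
  rw [sinhCoeff, show 2 * (m + 3) + 1 = ℓ + 1 + 1 by omega, Nat.factorial_succ,
    Nat.factorial_succ]
  have : (ℓ.factorial : ℚ) ≠ 0 := by positivity
  push_cast
  field_simp
  ring

theorem sinhCoeff_zero : sinhCoeff 0 = 1 := by simp [sinhCoeff]

theorem coeff_cschQ_succ (k : ℕ) :
    coeff (k + 1) cschQ = -∑ p ∈ antidiagonal k, sinhCoeff (p.1 + 1) * coeff p.2 cschQ := by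
  have h := congrArg (coeff (k + 1)) sinhQ_mul_cschQ
  have hs : ∀ i, coeff i sinhQ = sinhCoeff i := fun i => by rw [sinhQ, coeff_mk, sinhCoeff]
  rw [coeff_mul, Finset.Nat.sum_antidiagonal_succ, map_neg, coeff_one, if_neg (by omega),
    neg_zero] at h
  simp only [hs, sinhCoeff_zero, one_mul] at h
  exact eq_neg_of_add_eq_zero_left h

theorem coeff_zero_cschQ : coeff 0 cschQ = -1 := by
  rw [coeff_zero_eq_constantCoeff_apply, constantCoeff_cschQ]

theorem exists_reduces_coeff_cschQ (hm : ℓ = 2 * m + 5) {k : ℕ} (hk : k < m + 2) :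
    ∃ a : ZMod ℓ, Reduces (coeff k cschQ) a := by
  induction k using Nat.strong_induction_on with
  | _ k ih =>
    rcases k with - | k
    · exact ⟨-1, by rw [coeff_zero_cschQ]; exact Reduces.one.neg⟩
    · have h : ∀ p : ℕ × ℕ, ∃ a : ZMod ℓ, p ∈ antidiagonal k →
          Reduces (sinhCoeff (p.1 + 1) * coeff p.2 cschQ) a := fun p => by
        by_cases hp : p ∈ antidiagonal k
        · have hp' := mem_antidiagonal.1 hp
          obtain ⟨a, ha⟩ := exists_reduces_sinhCoeff hm (i := p.1 + 1) (by omega)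
          obtain ⟨b, hb⟩ := ih p.2 (by omega) (by omega)
          exact ⟨a * b, fun _ => ha.mul hb⟩
        · exact ⟨0, fun h => absurd h hp⟩
      choose a ha using h
      rw [coeff_cschQ_succ]
      exact ⟨_, (Reduces.sum fun p hp => ha p hp).neg⟩

theorem Reduces.mul_factorial_mul {x y : ℚ} (hx : ∃ a : ZMod ℓ, Reduces x a)
    (hy : ∃ a : ZMod ℓ, Reduces y a) : Reduces ((ℓ.factorial : ℚ) * (x * y)) (0 : ZMod ℓ) := by
  obtain ⟨a, ha⟩ := hx
  obtain ⟨b, hb⟩ := hy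
  exact (ha.mul hb).factorial_mul

theorem reduces_factorial_mul_coeff_cschQ (hm : ℓ = 2 * m + 5) :
    Reduces ((ℓ.factorial : ℚ) * coeff (m + 2) cschQ) (1 : ZMod ℓ) := by
  rw [coeff_cschQ_succ, mul_neg, Finset.mul_sum, Finset.Nat.sum_antidiagonal_succ',
    coeff_zero_cschQ, show (1 : ZMod ℓ) = -(1 * -1 + ∑ p ∈ antidiagonal m, 0) by simp, ← mul_assoc]
  refine (((reduces_factorial_mul_sinhCoeff hm).mul Reduces.one.neg).add
    (Reduces.sum fun p hp => ?_)).neg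
  have hp' := mem_antidiagonal.1 hp
  exact Reduces.mul_factorial_mul (exists_reduces_sinhCoeff hm (by omega))
    (exists_reduces_coeff_cschQ hm (by omega))

theorem reduces_factorial_mul_coeff_cschQ_succ (hm : ℓ = 2 * m + 5) :
    Reduces ((ℓ.factorial : ℚ) * coeff (m + 3) cschQ) (1 / 24 : ZMod ℓ) := by
  have h24 : Reduces (1 / 24 : ℚ) (1 / 24 : ZMod ℓ) :=
    Reduces.one.div (Reduces.ofNat 24) (twentyFour_ne_zero_zmod hm)
  have hval : (1 / 24 : ZMod ℓ) = -(1 / 24 * 1 + (1 / 8 * -1 +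
      ∑ p ∈ antidiagonal m, if p = (m, 0) then 1 / 24 else 0)) := by
    rw [Finset.sum_ite_eq', if_pos (by simp)]
    have h1 := twentyFour_ne_zero_zmod hm
    have h2 := eight_ne_zero_zmod hm
    field_simp
    norm_num
  rw [coeff_cschQ_succ, mul_neg, Finset.mul_sum, Finset.Nat.sum_antidiagonal_succ,
    Finset.Nat.sum_antidiagonal_succ', hval]
  refine ((?_ : Reduces _ _).add ((?_ : Reduces _ _).add (Reduces.sum fun p hp => ?_))).neg
  · have h1 : sinhCoeff (0 + 1) = 1 / 24 := by norm_num [sinhCoeff, Nat.factorial]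
    rw [h1, mul_left_comm]
    exact h24.mul (reduces_factorial_mul_coeff_cschQ hm)
  · rw [coeff_zero_cschQ, ← mul_assoc]
    exact (reduces_factorial_mul_sinhCoeff_succ hm).mul Reduces.one.neg
  · have hp' := mem_antidiagonal.1 hp
    split_ifs with h
    · subst h
      rw [← mul_assoc, ← one_mul (1 / 24 : ZMod ℓ)]
      refine (reduces_factorial_mul_sinhCoeff hm).mul ?_
      rw [zero_add, coeff_one_cschQ]
      exact h24
    · have h1 : p.1 ≠ m := fun h1 => h (Prod.ext h1 (by simp; omega))
      exact Reduces.mul_factorial_mul (exists_reduces_sinhCoeff hm (by simp; omega))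
        (exists_reduces_coeff_cschQ hm (by simp; omega))

end Csch

end SptCongruence

namespace SptCongruence

open PowerSeries PowerSeries.WithPiTopology

theorem map_tsum_congr {R S ι : Type*} [CommRing R] [CommRing S] [TopologicalSpace R]
    [T2Space R] {F G : ι → R⟦X⟧} (φ : R →+* S) (hF : AdicFinite F) (hG : AdicFinite G)
    (h : ∀ i, PowerSeries.map φ (F i) = PowerSeries.map φ (G i)) :
    PowerSeries.map φ (∑' i, F i) = PowerSeries.map φ (∑' i, G i) := by
  let _ : TopologicalSpace S := ⊥
  have : DiscreteTopology S := ⟨rfl⟩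
  rw [map_tsum_of_adicFinite φ hF, map_tsum_of_adicFinite φ hG]
  exact tsum_congr h

section Fermat

variable {ℓ m : ℕ} [Fact ℓ.Prime]

theorem baseChange_natCast_pow_card (n : ℕ) :
    baseChange (ZMod ℓ) ((n : ℤ⟦X⟧) ^ ℓ) = baseChange (ZMod ℓ) ((n : ℤ⟦X⟧) ^ 1) := by
  rw [pow_one, map_pow, map_natCast, ← map_natCast (C (R := ZMod ℓ)), ← map_pow, ZMod.pow_card]

theorem baseChange_oddMoment_card :
    baseChange (ZMod ℓ) (oddMoment jacobiTerm ℓ) = baseChange (ZMod ℓ) (oddMoment jacobiTerm 1) := by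
  refine map_tsum_congr _ (adicFinite_jacobiTerm.mul_right _) (adicFinite_jacobiTerm.mul_right _)
    fun i => ?_
  rw [map_mul, map_mul, baseChange_natCast_pow_card]

theorem baseChange_lerch_card :
    baseChange (ZMod ℓ) (lerch ℓ) = baseChange (ZMod ℓ) (lerch 1) := by
  refine map_tsum_congr _ (adicFinite_lerchExp.mul_left _) (adicFinite_lerchExp.mul_left _)
    fun i => ?_
  rw [map_mul, map_mul, map_mul, map_mul, baseChange_natCast_pow_card]

theorem constantCoeff_baseChange_theta (p : ℕ) :
    constantCoeff (baseChange (ZMod ℓ) (oddMoment jacobiTerm p)) = 1 := by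
  rw [constantCoeff_baseChange, constantCoeff_oddMoment_jacobiTerm, Int.cast_one]

theorem exists_seriesReduces_thetaQuot (i : ℕ) :
    ∃ g : (ZMod ℓ)⟦X⟧, SeriesReduces (thetaQuot i) g :=
  ⟨_, (SeriesReduces.ofInt _).mul ((SeriesReduces.ofInt _).inv
    (by rw [constantCoeff_baseChange_theta]; exact one_ne_zero))⟩

theorem seriesReduces_thetaQuot (hm : ℓ = 2 * m + 5) :
    SeriesReduces (thetaQuot (m + 2)) (1 : (ZMod ℓ)⟦X⟧) := by
  have h0 : constantCoeff (baseChange (ZMod ℓ) (oddMoment jacobiTerm 1)) ≠ 0 := by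
    rw [constantCoeff_baseChange_theta]
    exact one_ne_zero
  have h := (SeriesReduces.ofInt (K := ZMod ℓ) (oddMoment jacobiTerm ℓ)).mul
    ((SeriesReduces.ofInt _).inv h0)
  rw [baseChange_oddMoment_card, PowerSeries.mul_inv_cancel _ h0] at h
  rw [thetaQuot, show 2 * (m + 2) + 1 = ℓ by omega]
  exact h

theorem SeriesReduces.factorial_mul {f : ℚ⟦X⟧} {g : (ZMod ℓ)⟦X⟧} (h : SeriesReduces f g) :
    SeriesReduces (C (ℓ.factorial : ℚ) * f) (0 : (ZMod ℓ)⟦X⟧) := fun n => by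
  rw [coeff_C_mul, map_zero]
  exact (h n).factorial_mul

theorem SeriesReduces.ofNat {K : Type*} [Field K] (n : ℕ) [n.AtLeastTwo] :
    SeriesReduces (ofNat(n) : ℚ⟦X⟧) (ofNat(n) : K⟦X⟧) := by
  have h := SeriesReduces.const (Reduces.natCast (K := K) n)
  rwa [map_natCast, map_natCast] at h

theorem SeriesReduces.expSer {a : ℚ⟦X⟧} {b : (ZMod ℓ)⟦X⟧} (h : SeriesReduces a b) {n : ℕ}
    (hn : n < ℓ) :
    SeriesReduces (coeff n (SptCongruence.expSer a)) (C (1 / (n.factorial : ZMod ℓ)) * b ^ n) := by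
  rw [coeff_expSer]
  exact (SeriesReduces.const (Reduces.one.div (Reduces.natCast _)
    (natCast_factorial_ne_zero hn))).mul (h.pow n)

theorem exists_seriesReduces_coeff_ySer (hm : ℓ = 2 * m + 5) {k : ℕ} (hk : k < m + 2) :
    ∃ g : (ZMod ℓ)⟦X⟧, SeriesReduces (coeff k ySer) g := by
  obtain ⟨a, ha⟩ := exists_reduces_sinhCoeff hm hk
  obtain ⟨b, hb⟩ := exists_seriesReduces_thetaQuot (ℓ := ℓ) k
  rw [ySer, coeff_mk]
  exact ⟨_, (SeriesReduces.const ha).mul hb⟩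

theorem SeriesReduces.factorial_mul_sum {s : Finset (ℕ × ℕ)} {e w : ℕ × ℕ → ℚ⟦X⟧}
    (he : ∀ p ∈ s, ∃ g : (ZMod ℓ)⟦X⟧, SeriesReduces (e p) g)
    (hw : ∀ p ∈ s, ∃ g : (ZMod ℓ)⟦X⟧, SeriesReduces (w p) g) :
    SeriesReduces (C (ℓ.factorial : ℚ) * ∑ p ∈ s, e p * w p) (0 : (ZMod ℓ)⟦X⟧) := by
  rw [Finset.mul_sum, show (0 : (ZMod ℓ)⟦X⟧) = ∑ p ∈ s, 0 by simp]
  refine SeriesReduces.sum fun p hp => ?_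
  obtain ⟨a, ha⟩ := he p hp
  obtain ⟨b, hb⟩ := hw p hp
  exact (ha.mul hb).factorial_mul

theorem seriesReduces_coeff_yHat (hm : ℓ = 2 * m + 5) :
    SeriesReduces (C (ℓ.factorial : ℚ) * coeff (m + 2) yHat) (1 : (ZMod ℓ)⟦X⟧) := by
  have hexp : SeriesReduces (-(C (1 / 24 : ℚ) * eisPQ))
      (-(C (1 / 24 : ZMod ℓ) * baseChange (ZMod ℓ) eisP)) :=
    ((SeriesReduces.const (Reduces.one.div (Reduces.ofNat 24)
      (twentyFour_ne_zero_zmod hm))).mul (SeriesReduces.ofInt _)).neg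
  have h0 : SeriesReduces (C (ℓ.factorial : ℚ) * coeff (m + 2) ySer) (1 : (ZMod ℓ)⟦X⟧) := by
    rw [ySer, coeff_mk, ← mul_assoc, ← map_mul]
    have h := (SeriesReduces.const (reduces_factorial_mul_sinhCoeff hm)).mul
      (seriesReduces_thetaQuot hm)
    rwa [map_one, one_mul] at h
  have h1 : coeff (m + 2) yHat = coeff (m + 2) ySer +
      ∑ p ∈ antidiagonal (m + 1), coeff (p.1 + 1) (expSer (-(C (1 / 24) * eisPQ))) *
        coeff p.2 ySer := by
    rw [yHat, coeff_mul, Finset.Nat.sum_antidiagonal_succ, coeff_zero_eq_constantCoeff_apply,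
      constantCoeff_expSer, one_mul]
  rw [h1, mul_add, ← add_zero (1 : (ZMod ℓ)⟦X⟧)]
  refine h0.add (SeriesReduces.factorial_mul_sum (fun p hp => ?_) fun p hp => ?_)
  · exact ⟨_, hexp.expSer (by have := mem_antidiagonal.1 hp; omega)⟩
  · exact exists_seriesReduces_coeff_ySer hm (by have := mem_antidiagonal.1 hp; omega)

theorem one_mem_isobaric_card (hm : ℓ = 2 * m + 5) :
    (1 : (ZMod ℓ)⟦X⟧) ∈ isobaric (ZMod ℓ) (ℓ - 1) := by
  have h := (seriesReduces_coeff_yHat hm).mem_isobaric (six_ne_zero_zmod hm)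
    (C_mul_mem_isobaric _ (isGraded_yHat (m + 2)))
  rwa [show 2 * (m + 2) = ℓ - 1 by omega] at h

variable (ℓ) in
/-- The reduction of `phiQ` modulo `ℓ`. -/
noncomputable def phiMod : (ZMod ℓ)⟦X⟧ :=
  C (3 / 2) * baseChange (ZMod ℓ) eisP - C (1 / 2) - 12 * baseChange (ZMod ℓ) (lerch 1)

theorem seriesReduces_phiQ (hm : ℓ = 2 * m + 5) : SeriesReduces phiQ (phiMod ℓ) := by
  have h2 := two_ne_zero_zmod hm
  exact (((SeriesReduces.const ((Reduces.ofNat 3).div (Reduces.ofNat 2) h2)).mul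
    (SeriesReduces.ofInt _)).sub (SeriesReduces.const (Reduces.one.div (Reduces.ofNat 2) h2))).sub
    ((SeriesReduces.ofNat 12).mul (SeriesReduces.ofInt _))

theorem seriesReduces_iterate_thetaOp (hm : ℓ = 2 * m + 5) (n : ℕ) :
    SeriesReduces (thetaOp^[n] phiQ) ((twistedD (ZMod ℓ))^[n] (phiMod ℓ)) := by
  induction n with
  | zero => exact seriesReduces_phiQ hm
  | succ n ih =>
    rw [Function.iterate_succ_apply', Function.iterate_succ_apply']
    exact ((SeriesReduces.ofNat 24).mul ih.euler).sub ((SeriesReduces.ofInt _).mul ih)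

theorem exists_seriesReduces_coeff_iterSer (hm : ℓ = 2 * m + 5) {k : ℕ} (hk : k < m + 2) :
    ∃ g : (ZMod ℓ)⟦X⟧, SeriesReduces (coeff k iterSer) g := by
  obtain ⟨a, ha⟩ := exists_reduces_sinhCoeff hm hk
  rw [iterSer, coeff_mk]
  exact ⟨_, (SeriesReduces.const ((Reduces.one.neg.pow k).mul ha)).mul
    (seriesReduces_iterate_thetaOp hm k)⟩

theorem seriesReduces_coeff_iterSer (hm : ℓ = 2 * m + 5) :
    SeriesReduces (C (ℓ.factorial : ℚ) * coeff (m + 2) iterSer)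
      (C ((-1) ^ (m + 2)) * (twistedD (ZMod ℓ))^[m + 2] (phiMod ℓ)) := by
  have h := (SeriesReduces.const ((Reduces.one.neg.pow (m + 2)).mul
    (reduces_factorial_mul_sinhCoeff hm))).mul (seriesReduces_iterate_thetaOp hm (m + 2))
  rw [mul_one] at h
  rw [iterSer, coeff_mk, ← mul_assoc, ← map_mul, mul_left_comm]
  exact h

theorem exists_seriesReduces_coeff_lerchSer (hm : ℓ = 2 * m + 5) {k : ℕ} (hk : k < m + 2) :
    ∃ g : (ZMod ℓ)⟦X⟧, SeriesReduces (coeff k lerchSer) g := by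
  obtain ⟨a, ha⟩ := exists_reduces_sinhCoeff hm hk
  rw [lerchSer, coeff_mk]
  exact ⟨_, (SeriesReduces.const ha).mul (SeriesReduces.ofInt _)⟩

theorem seriesReduces_coeff_lerchSer (hm : ℓ = 2 * m + 5) :
    SeriesReduces (C (ℓ.factorial : ℚ) * coeff (m + 2) lerchSer)
      (baseChange (ZMod ℓ) (lerch 1)) := by
  have h := (SeriesReduces.const (reduces_factorial_mul_sinhCoeff hm)).mul
    (SeriesReduces.ofInt (lerch ℓ))
  rw [baseChange_lerch_card, map_one, one_mul] at h
  rw [lerchSer, coeff_mk, ← mul_assoc, ← map_mul, lerchQ, show 2 * (m + 2) + 1 = ℓ by omega]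
  exact h

theorem coeff_wSer_succ (k : ℕ) : coeff (k + 1) wSer =
    coeff k iterSer + 12 * (C (coeff (k + 1) cschQ) + coeff k lerchSer) := by
  rw [wSer, alphaSer, map_add, coeff_succ_X_mul, ofNat_eq_C 12, coeff_C_mul, map_add,
    coeff_succ_X_mul, cschSer, coeff_map]

theorem exists_seriesReduces_coeff_wSer (hm : ℓ = 2 * m + 5) {k : ℕ} (hk : k < m + 2) :
    ∃ g : (ZMod ℓ)⟦X⟧, SeriesReduces (coeff k wSer) g := by
  rcases k with - | k
  · rw [coeff_zero_eq_constantCoeff_apply, constantCoeff_wSer]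
    exact ⟨_, (SeriesReduces.ofNat 12).neg⟩
  · obtain ⟨a, ha⟩ := exists_seriesReduces_coeff_iterSer hm (k := k) (by omega)
    obtain ⟨b, hb⟩ := exists_reduces_coeff_cschQ hm hk
    obtain ⟨c, hc⟩ := exists_seriesReduces_coeff_lerchSer hm (k := k) (by omega)
    rw [coeff_wSer_succ]
    exact ⟨_, ha.add ((SeriesReduces.ofNat 12).mul ((SeriesReduces.const hb).add hc))⟩

theorem seriesReduces_coeff_wSer (hm : ℓ = 2 * m + 5) :
    SeriesReduces (C (ℓ.factorial : ℚ) * coeff (m + 2) wSer) (12 : (ZMod ℓ)⟦X⟧) := by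
  obtain ⟨a, ha⟩ := exists_seriesReduces_coeff_iterSer hm (k := m + 1) (by omega)
  obtain ⟨c, hc⟩ := exists_seriesReduces_coeff_lerchSer hm (k := m + 1) (by omega)
  have h := ha.factorial_mul.add ((SeriesReduces.ofNat 12).mul
    ((SeriesReduces.const (reduces_factorial_mul_coeff_cschQ hm)).add hc.factorial_mul))
  rw [zero_add, map_one, add_zero, mul_one, map_mul] at h
  rw [coeff_wSer_succ]
  convert h using 1
  ring

theorem seriesReduces_coeff_wSer_succ (hm : ℓ = 2 * m + 5) :
    SeriesReduces (C (ℓ.factorial : ℚ) * coeff (m + 3) wSer)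
      (C ((-1) ^ (m + 2)) * (twistedD (ZMod ℓ))^[m + 2] (phiMod ℓ) +
        12 * (C (1 / 24) + baseChange (ZMod ℓ) (lerch 1))) := by
  have h := (seriesReduces_coeff_iterSer hm).add ((SeriesReduces.ofNat 12).mul
    ((SeriesReduces.const (reduces_factorial_mul_coeff_cschQ_succ hm)).add
      (seriesReduces_coeff_lerchSer hm)))
  rw [map_mul C (ℓ.factorial : ℚ) (coeff (m + 3) cschQ)] at h
  rw [coeff_wSer_succ]
  convert h using 1
  ring

theorem seriesReduces_coeff_wHat (hm : ℓ = 2 * m + 5) :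
    SeriesReduces (C (ℓ.factorial : ℚ) * coeff (m + 3) wHat)
      (C ((-1) ^ (m + 2)) * (twistedD (ZMod ℓ))^[m + 2] (phiMod ℓ) +
        12 * (C (1 / 24) + baseChange (ZMod ℓ) (lerch 1)) +
        C (1 / 8) * baseChange (ZMod ℓ) eisP * 12) := by
  have hexp : SeriesReduces (C (1 / 8 : ℚ) * eisPQ)
      (C (1 / 8 : ZMod ℓ) * baseChange (ZMod ℓ) eisP) :=
    (SeriesReduces.const (Reduces.one.div (Reduces.ofNat 8)
      (eight_ne_zero_zmod hm))).mul (SeriesReduces.ofInt _)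
  have h1 : coeff (m + 3) wHat = coeff (m + 3) wSer + (C (1 / 8) * eisPQ * coeff (m + 2) wSer +
      ∑ p ∈ antidiagonal (m + 1), coeff (p.1 + 1 + 1) (expSer (C (1 / 8) * eisPQ)) *
        coeff p.2 wSer) := by
    rw [wHat, coeff_mul, Finset.Nat.sum_antidiagonal_succ, Finset.Nat.sum_antidiagonal_succ,
      coeff_zero_eq_constantCoeff_apply, constantCoeff_expSer, one_mul, coeff_expSer]
    simp
  rw [h1, mul_add, mul_add, ← add_assoc, mul_left_comm (C (ℓ.factorial : ℚ)),
    ← add_zero (_ + C (1 / 8) * baseChange (ZMod ℓ) eisP * 12)]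
  refine ((seriesReduces_coeff_wSer_succ hm).add (hexp.mul (seriesReduces_coeff_wSer hm))).add
    (SeriesReduces.factorial_mul_sum (fun p hp => ?_) fun p hp => ?_)
  · exact ⟨_, hexp.expSer (by have := mem_antidiagonal.1 hp; omega)⟩
  · exact exists_seriesReduces_coeff_wSer hm (by have := mem_antidiagonal.1 hp; omega)

theorem eisP_mem_isobaric_card (hm : ℓ = 2 * m + 5) :
    baseChange (ZMod ℓ) eisP ∈ isobaric (ZMod ℓ) (ℓ + 1) := by
  have h := serre_mem_isobaric (one_mem_isobaric_card hm)
  rw [show ℓ - 1 + 2 = ℓ + 1 by omega, Nat.cast_sub (by omega), natCast_series_eq_zero] at h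
  simpa using h

/-- The image of `phiMod` under the Euler-criterion operator is a form of weight `ℓ + 1`. -/
theorem iterate_twistedD_phiMod_mem (hm : ℓ = 2 * m + 5) :
    (twistedD (ZMod ℓ))^[m + 2] (phiMod ℓ) - C ((-1) ^ (m + 2)) * phiMod ℓ ∈
      isobaric (ZMod ℓ) (ℓ + 1) := by
  have h := (seriesReduces_coeff_wHat hm).mem_isobaric (six_ne_zero_zmod hm)
    (C_mul_mem_isobaric _ (isGraded_wHat (m + 3)))
  rw [show 2 * (m + 3) = ℓ + 1 by omega] at h
  have h2 := C_mul_mem_isobaric ((-1) ^ (m + 2)) (sub_mem h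
    (C_mul_mem_isobaric 3 (eisP_mem_isobaric_card hm)))
  convert h2 using 1
  have hs : (C ((-1) ^ (m + 2) : ZMod ℓ) : (ZMod ℓ)⟦X⟧) * C ((-1) ^ (m + 2)) = 1 := by
    rw [← map_mul, ← mul_pow]
    simp
  have hn := two_ne_zero_zmod hm
  have h8 := eight_ne_zero_zmod hm
  have h24 := twentyFour_ne_zero_zmod hm
  have e1 : (C (1 / 24 : ZMod ℓ) : (ZMod ℓ)⟦X⟧) * 12 = C (1 / 2) := by
    rw [ofNat_eq_C 12, ← map_mul]
    congr 1
    field_simp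
    norm_num
  have e2 : (C (1 / 8 : ZMod ℓ) : (ZMod ℓ)⟦X⟧) * 12 - C 3 = - C (3 / 2) := by
    rw [ofNat_eq_C 12, ← map_mul, ← map_sub, ← map_neg]
    congr 1
    field_simp
    norm_num
  generalize (twistedD (ZMod ℓ))^[m + 2] (phiMod ℓ) = z
  rw [phiMod]
  linear_combination -z * hs -
    C ((-1) ^ (m + 2)) * e1 - C ((-1) ^ (m + 2)) * baseChange (ZMod ℓ) eisP * e2

end Fermat

end SptCongruence

namespace SptCongruence

open PowerSeries

/-- The generating function of `k ↦ sptA (24 k - 1)`. -/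
noncomputable def sptAGF : ℤ⟦X⟧ :=
  (partGF fun _ => 1) - 24 * qD (partGF fun _ => 1) - 12 * sptGF

theorem coeff_sptAGF (k : ℕ) :
    coeff k sptAGF = -(12 * spt k + (24 * k - 1) * partitionCount k) := by
  have hp : coeff k (partGF fun _ => 1) = (partitionCount k : ℤ) := by
    simp [partGF, partitionCount]
  have hs : coeff k sptGF = (spt k : ℤ) := by rw [sptGF, coeff_mk]
  rw [sptAGF, map_sub, map_sub, ← map_ofNat (C (R := ℤ)) 24, ← map_ofNat (C (R := ℤ)) 12,
    coeff_C_mul, coeff_C_mul, coeff_qD, hp, hs]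
  simp only [OfNat.ofNat]
  ring

theorem sptA_eq_coeff (k : ℕ) : sptA (24 * k - 1) = coeff k sptAGF := by
  rw [coeff_sptAGF, sptA, if_pos (by omega), show ((24 * k - 1 + 1) / 24 : ℤ).toNat = k by omega]

theorem pentagonalSeries_mul_sptAGF :
    pentagonalSeries ℤ * sptAGF = 1 - 36 * sigmaGF - 12 * lerch 1 := by
  rw [sptAGF, qD_partGF]
  linear_combination (1 - 24 * sigmaGF) * pentagonalSeries_mul_partGF -
    12 * pentagonalSeries_mul_sptGF

section Iteration

variable {A : Type*} [CommRing A]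

/-- The operator multiplying the coefficient at `k` by `24 k - 1`. -/
noncomputable def scaleD (f : A⟦X⟧) : A⟦X⟧ := 24 * qD f - f

theorem coeff_iterate_scaleD (f : A⟦X⟧) (r k : ℕ) :
    coeff k (scaleD^[r] f) = (24 * k - 1) ^ r * coeff k f := by
  induction r with
  | zero => simp
  | succ r ih =>
    rw [Function.iterate_succ_apply', scaleD, map_sub, ← map_ofNat (C (R := A)) 24, coeff_C_mul,
      coeff_qD, ih]
    ring

theorem twistedD_pentagonalSeries_mul (f : A⟦X⟧) :
    twistedD A (baseChange A (pentagonalSeries ℤ) * f) =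
      baseChange A (pentagonalSeries ℤ) * scaleD f := by
  have h := congrArg (baseChange A) qD_pentagonalSeries
  rw [map_mul, map_mul, map_sub, map_one, map_ofNat, map_qD] at h
  rw [twistedD, scaleD, qD_mul]
  linear_combination f * h

theorem iterate_twistedD_pentagonalSeries_mul (f : A⟦X⟧) (r : ℕ) :
    (twistedD A)^[r] (baseChange A (pentagonalSeries ℤ) * f) =
      baseChange A (pentagonalSeries ℤ) * scaleD^[r] f := by
  induction r with
  | zero => rfl
  | succ r ih =>
    rw [Function.iterate_succ_apply', ih, twistedD_pentagonalSeries_mul,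
      Function.iterate_succ_apply']

end Iteration

variable {ℓ m : ℕ} [Fact ℓ.Prime]

theorem phiMod_eq (hm : ℓ = 2 * m + 5) : phiMod ℓ =
    baseChange (ZMod ℓ) (pentagonalSeries ℤ) * baseChange (ZMod ℓ) sptAGF := by
  have h2 := two_ne_zero_zmod hm
  have h : (C (1 / 2 : ZMod ℓ) : (ZMod ℓ)⟦X⟧) * 2 = 1 := by
    rw [ofNat_eq_C 2, ← map_mul, one_div_mul_cancel h2, map_one]
  have h3 : (C (3 / 2 : ZMod ℓ) : (ZMod ℓ)⟦X⟧) = C (1 / 2) * 3 := by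
    rw [ofNat_eq_C 3, ← map_mul]
    ring_nf
  rw [← map_mul, pentagonalSeries_mul_sptAGF, phiMod, h3, eisP]
  simp only [map_sub, map_mul, map_one, map_ofNat]
  linear_combination (1 - 36 * baseChange (ZMod ℓ) sigmaGF) * h

/-- If the coefficients of `sptAGF` at all `k` with `24 k ≡ 1` vanish modulo `ℓ`, then so do
those with `1 - 24 k` a quadratic non-residue. -/
theorem coeff_sptAGF_mul_eq_zero (hm : ℓ = 2 * m + 5)
    (h : ∀ k : ℕ, (24 * k - 1 : ZMod ℓ) = 0 → ((coeff k sptAGF : ℤ) : ZMod ℓ) = 0) (k : ℕ) :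
    ((24 * k - 1 : ZMod ℓ) ^ (m + 2) - (-1) ^ (m + 2)) * ((coeff k sptAGF : ℤ) : ZMod ℓ) = 0 := by
  have hs : ((-1) ^ (m + 2) : ZMod ℓ) * (-1) ^ (m + 2) = 1 := by
    rw [← mul_pow]
    simp
  obtain ⟨B, hB⟩ : ∃ B : (ZMod ℓ)⟦X⟧, B = scaleD^[m + 2] (baseChange (ZMod ℓ) sptAGF) -
    C ((-1) ^ (m + 2)) * baseChange (ZMod ℓ) sptAGF := ⟨_, rfl⟩
  have hcoeff (k : ℕ) : coeff k B = ((24 * k - 1 : ZMod ℓ) ^ (m + 2) - (-1) ^ (m + 2)) *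
      ((coeff k sptAGF : ℤ) : ZMod ℓ) := by
    rw [hB, map_sub, coeff_iterate_scaleD, coeff_C_mul, coeff_map, Int.coe_castRingHom]
    ring
  have hBs : scaleD^[m + 2] B = C (-(-1) ^ (m + 2)) * B := by
    ext1 k
    rw [coeff_iterate_scaleD, coeff_C_mul, hcoeff]
    by_cases hk : (24 * k - 1 : ZMod ℓ) = 0
    · rw [h k hk]
      ring
    · have hf := ZMod.pow_card_sub_one_eq_one hk
      rw [show ℓ - 1 = (m + 2) + (m + 2) by omega, pow_add] at hf
      linear_combination ((coeff k sptAGF : ℤ) : ZMod ℓ) * (hf - hs)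
  have hmem := iterate_twistedD_phiMod_mem hm
  rw [phiMod_eq hm, iterate_twistedD_pentagonalSeries_mul, mul_left_comm, ← mul_sub, ← hB] at hmem
  have hc : (twistedD (ZMod ℓ))^[m + 2] (baseChange (ZMod ℓ) (pentagonalSeries ℤ) * B) =
      C (-(-1) ^ (m + 2)) * (baseChange (ZMod ℓ) (pentagonalSeries ℤ) * B) := by
    rw [iterate_twistedD_pentagonalSeries_mul, hBs, mul_left_comm]
  have hprime : ℓ.Prime := Fact.out
  have h0 := eq_zero_of_iterate_twistedD hprime (by omega) (by omega)
    (one_mem_isobaric_card hm) hmem hc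
  have hp := congrArg (baseChange (ZMod ℓ)) pentagonalSeries_mul_partGF
  rw [map_mul, map_one] at hp
  have hB0 : B = 0 := by linear_combination baseChange (ZMod ℓ) (partGF fun _ => 1) * h0 - B * hp
  rw [← hcoeff, hB0, map_zero]

end SptCongruence

/-- If there is `n ≥ 1` with `n ≡ 23 (mod 24)`, `(-n / ℓ) ≠ 1` and `ℓ ∤ a(n)`,
then `spt` does not have a congruence at the prime `ℓ ≥ 5`. -/
theorem no_spt_congruence_of_coeff (ℓ : ℕ) (hℓ : ℓ.Prime) (h5 : 5 ≤ ℓ)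
    (h : ∃ n : ℤ, 1 ≤ n ∧ n % 24 = 23 ∧ jacobiSym (-n) ℓ ≠ 1 ∧ ¬ (ℓ : ℤ) ∣ sptA n) :
    ¬ (∀ m : ℕ, 24 ∣ ℓ * m + 1 → ℓ ∣ spt ((ℓ * m + 1) / 24)) := by
  intro hspt
  have : Fact ℓ.Prime := ⟨hℓ⟩
  obtain ⟨n, hn1, hn, hj, hdvd⟩ := h
  obtain ⟨k, rfl⟩ : ∃ k : ℕ, n = 24 * k - 1 := ⟨((n + 1) / 24).toNat, by omega⟩
  obtain ⟨m, hm⟩ : ∃ m, ℓ = 2 * m + 5 := by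
    obtain ⟨j, hj⟩ := hℓ.odd_of_ne_two (by omega)
    exact ⟨j - 2, by omega⟩
  rw [SptCongruence.sptA_eq_coeff, ← ZMod.intCast_zmod_eq_zero_iff_dvd] at hdvd
  have hzero (k : ℕ) (hk : (24 * k - 1 : ZMod ℓ) = 0) :
      ((PowerSeries.coeff k SptCongruence.sptAGF : ℤ) : ZMod ℓ) = 0 := by
    rcases k.eq_zero_or_pos with rfl | hk0
    · simp at hk
    have h1 : ℓ ∣ 24 * k - 1 := by
      rw [← ZMod.natCast_eq_zero_iff, Nat.cast_sub (by omega)]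
      simpa using hk
    obtain ⟨c, hc⟩ := h1
    have h2 := hspt c ⟨k, by omega⟩
    rw [show (ℓ * c + 1) / 24 = k by omega, ← ZMod.natCast_eq_zero_iff] at h2
    rw [SptCongruence.coeff_sptAGF]
    push_cast
    rw [h2, hk]
    ring
  have hpow := (mul_eq_zero.1 (SptCongruence.coeff_sptAGF_mul_eq_zero hm hzero k)).resolve_right
    hdvd
  apply hj
  have hleg := legendreSym.eq_pow ℓ (-(24 * k - 1))
  have hneg : ((-(24 * (k : ℤ) - 1) : ℤ) : ZMod ℓ) = -1 * (24 * k - 1) := by push_cast; ring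
  rw [show ℓ / 2 = m + 2 by omega, hneg, mul_pow, sub_eq_zero.1 hpow, ← mul_pow, neg_one_mul,
    neg_neg, one_pow] at hleg
  rw [← jacobiSym.legendreSym.to_jacobiSym]
  have hne : ((-(24 * (k : ℤ) - 1) : ℤ) : ZMod ℓ) ≠ 0 := fun h0 => by
    rw [(legendreSym.eq_zero_iff ℓ _).2 h0] at hleg
    simp at hleg
  rcases legendreSym.eq_one_or_neg_one ℓ hne with h1 | h1
  · exact h1
  · rw [h1] at hleg
    have : Fact (2 < ℓ) := ⟨by omega⟩
    exact absurd (by simpa using hleg) (ZMod.neg_one_ne_one (n := ℓ))
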